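/- arXiv:1311.5883 — 2 statements merged into one kernel-verified Lean document; each statement's English description precedes it below -/
import Mathlib

section
/- Let U be an update family in two dimensions. Then p_c(ℤ², U) > 0 if and only if U is subcritical. -/
open Set MeasureTheory

/-- A site of the two-dimensional lattice. -/
abbrev Site : Type := ℤ × ℤ

/-- One step of the `U`-bootstrap process. -/
def bsStep (U : Finset (Finset Site)) (A : Set Site) : Set Site :=
  A ∪ {x : Site | ∃ X ∈ U, ∀ y ∈ X, y + x ∈ A}

/-- The `t`-th stage of the `U`-bootstrap process started from `A`. -/
def bsIter (U : Finset (Finset Site)) : ℕ → Set Site → Set Site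
  | 0, A => A
  | n + 1, A => bsStep U (bsIter U n A)

/-- The closure `[A]` under the `U`-bootstrap process. -/
def bsClosure (U : Finset (Finset Site)) (A : Set Site) : Set Site :=
  ⋃ n : ℕ, bsIter U n A

/-- `U` is an update family: a (finite) collection of finite nonempty subsets of `ℤ² \ {0}`. -/
def IsUpdateFamily (U : Finset (Finset Site)) : Prop :=
  U.Nonempty ∧ ∀ X ∈ U, X.Nonempty ∧ (0 : Site) ∉ X

/-- The discrete half-plane `H_u` determined by `u ∈ ℝ²`. -/
def halfPlane (u : ℝ × ℝ) : Set Site :=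
  {x : Site | (x.1 : ℝ) * u.1 + (x.2 : ℝ) * u.2 < 0}

/-- A direction `u` is stable for `U` if `[H_u] = H_u`. -/
def IsStableDir (U : Finset (Finset Site)) (u : ℝ × ℝ) : Prop :=
  bsClosure U (halfPlane u) = halfPlane u

/-- The unit vector of angle `θ`. -/
noncomputable def dir (θ : ℝ) : ℝ × ℝ := (Real.cos θ, Real.sin θ)

/-- `dir θ` lies in the interior of the stable set (is strongly stable). -/
def IsStronglyStableAngle (U : Finset (Finset Site)) (θ : ℝ) : Prop :=
  ∃ ε > 0, ∀ φ : ℝ, |φ - θ| < ε → IsStableDir U (dir φ)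

/-- `U` is subcritical: every open semicircle contains a strongly stable direction. -/
def Subcritical (U : Finset (Finset Site)) : Prop :=
  ∀ θ : ℝ, ∃ φ : ℝ, θ < φ ∧ φ < θ + Real.pi ∧ IsStronglyStableAngle U φ

/-- `U` is supercritical: some open semicircle contains no stable direction. -/
def Supercritical (U : Finset (Finset Site)) : Prop :=
  ∃ θ : ℝ, ∀ φ : ℝ, θ < φ → φ < θ + Real.pi → ¬ IsStableDir U (dir φ)

/-- The random set of infected sites determined by `ω`. -/
def siteSet (ω : Site → Bool) : Set Site := {x : Site | ω x = true}

/-- `μ` is the Bernoulli product measure with density `p` on `ℤ²`: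
each site lies in the random set independently with probability `p`. -/
def IsBernoulli (p : ℝ) (μ : Measure (Site → Bool)) : Prop :=
  ∀ (s : Finset Site) (f : Site → Bool),
    μ {ω : Site → Bool | ∀ x ∈ s, ω x = f x}
      = ∏ x ∈ s, ENNReal.ofReal (if f x then p else 1 - p)

/-- `A` percolates: its closure is all of `ℤ²`. -/
def Percolates (U : Finset (Finset Site)) (A : Set Site) : Prop :=
  bsClosure U A = Set.univ

/-- The critical probability `p_c(ℤ², U)`. -/
noncomputable def critProb (U : Finset (Finset Site)) : ℝ :=
  sInf {p : ℝ | p ∈ Set.Icc (0 : ℝ) 1 ∧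
    ∀ μ : Measure (Site → Bool), IsBernoulli p μ →
      μ {ω : Site → Bool | Percolates U (siteSet ω)} = 1}

/-- Euclidean embedding of the lattice into the complex plane. -/
noncomputable def toC (v : Site) : ℂ := ⟨(v.1 : ℝ), (v.2 : ℝ)⟩

/-- The range `r(U)`: the largest Euclidean distance between two sites of one update rule. -/
noncomputable def famRange (U : Finset (Finset Site)) : ℝ :=
  (U.sup fun X => X.sup fun a => X.sup fun b => nndist (toC a) (toC b) : NNReal)

section Animals

variable {α : Type*} [DecidableEq α]

/-- `IsAnimal adj x F`: the finite set `F` is obtained from `{x}` by repeatedly adding vertices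
adjacent to vertices that are already present. -/
inductive IsAnimal (adj : α → α → Prop) (x : α) : Finset α → Prop
  | single : IsAnimal adj x {x}
  | insert {F : Finset α} {z y : α} (hF : IsAnimal adj x F) (hz : z ∈ F) (hzy : adj z y) :
      IsAnimal adj x (insert y F)

theorem IsAnimal.root_mem {adj : α → α → Prop} {x : α} {F : Finset α} (h : IsAnimal adj x F) :
    x ∈ F := by
  induction h with
  | single => simp
  | insert hF hz hzy ih => simp [ih]

theorem IsAnimal.union {adj : α → α → Prop} {x y z : α} {F G : Finset α}
    (hF : IsAnimal adj x F) (hG : IsAnimal adj z G) (hy : y ∈ F) (hyz : adj y z) :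
    IsAnimal adj x (F ∪ G) := by
  induction hG with
  | single =>
    have := hF.insert hy hyz
    rwa [Finset.insert_eq, Finset.union_comm] at this
  | insert hG hw hwv ih =>
    rw [Finset.union_insert]
    exact ih.insert (Finset.mem_union_right _ hw) hwv

theorem IsAnimal.reroot {adj : α → α → Prop} (hsymm : ∀ a b, adj a b → adj b a) {x y : α}
    {F : Finset α} (hF : IsAnimal adj x F) (hy : y ∈ F) : IsAnimal adj y F := by
  induction hF generalizing y with
  | single =>
    obtain rfl := Finset.mem_singleton.1 hy
    exact .single
  | insert hF hz hzw ih =>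
    rcases Finset.mem_insert.1 hy with rfl | hy
    · have := IsAnimal.union (IsAnimal.single (adj := adj) (x := y)) (ih hz)
        (Finset.mem_singleton_self y) (hsymm _ _ hzw)
      rwa [← Finset.insert_eq] at this
    · exact (ih hy).insert hz hzw

theorem IsAnimal.insert_biUnion {adj : α → α → Prop} {κ : Type*} [DecidableEq κ] (u : α)
    (J : Finset κ) (z : κ → α) (F : κ → Finset α) (hF : ∀ j ∈ J, IsAnimal adj (z j) (F j))
    (hz : ∀ j ∈ J, adj u (z j)) : IsAnimal adj u (Insert.insert u (J.biUnion F)) := by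
  induction J using Finset.induction_on with
  | empty => simpa using IsAnimal.single
  | insert j J hj ih =>
    have h := ih (fun i hi => hF i (Finset.mem_insert_of_mem hi))
      (fun i hi => hz i (Finset.mem_insert_of_mem hi))
    have := h.union (hF j (Finset.mem_insert_self _ _)) (Finset.mem_insert_self _ _)
      (hz j (Finset.mem_insert_self _ _))
    rwa [Finset.biUnion_insert, Finset.union_comm (F j), ← Finset.insert_union]

end Animals

section Explanation

variable {α ι : Type*}

/-- `b` is a leaf reached from `x` by repeatedly passing to one of the children `c i`. -/
def IsLeafOf (A : Set α) (c : ι → α → α) (x b : α) : Prop :=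
  b ∈ A ∧ Relation.ReflTransGen (fun y z => y ∉ A ∧ ∃ i, z = c i y) x b

/-- Two vertices of `K` are linked if they have a common leaf. -/
def Linked (A : Set α) (c : ι → α → α) (K : Finset α) (x y : α) : Prop :=
  x ∈ K ∧ y ∈ K ∧ ∃ b, IsLeafOf A c x b ∧ IsLeafOf A c y b

/-- The equivalence relation (on `K`) generated by being linked. -/
def LinkClass (A : Set α) (c : ι → α → α) (K : Finset α) : α → α → Prop :=
  Relation.ReflTransGen (Linked A c K)

variable {A : Set α} {c : ι → α → α} {K : Finset α}

theorem Linked.symm {x y : α} (h : Linked A c K x y) : Linked A c K y x :=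
  ⟨h.2.1, h.1, h.2.2.imp fun _ hb => ⟨hb.2, hb.1⟩⟩

theorem LinkClass.symm {x y : α} (h : LinkClass A c K x y) : LinkClass A c K y x := by
  induction h with
  | refl => exact .refl
  | tail _ hl ih => exact .head hl.symm ih

theorem LinkClass.trans {x y z : α} (h : LinkClass A c K x y) (h' : LinkClass A c K y z) :
    LinkClass A c K x z :=
  Relation.ReflTransGen.trans h h'

theorem Linked.linkClass {x y : α} (h : Linked A c K x y) : LinkClass A c K x y :=
  Relation.ReflTransGen.single h

theorem IsLeafOf.eq_of_mem {x b : α} (h : IsLeafOf A c x b) (hx : x ∈ A) : b = x := by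
  rcases Relation.ReflTransGen.cases_head h.2 with h | ⟨y, hy, -⟩
  · exact h.symm
  · exact absurd hx hy.1

theorem IsLeafOf.of_child {x b : α} {i : ι} (hx : x ∉ A) (h : IsLeafOf A c (c i x) b) :
    IsLeafOf A c x b :=
  ⟨h.1, Relation.ReflTransGen.head ⟨hx, i, rfl⟩ h.2⟩

theorem IsLeafOf.exists_child {x b : α} (hx : x ∉ A) (h : IsLeafOf A c x b) :
    ∃ i, IsLeafOf A c (c i x) b := by
  rcases Relation.ReflTransGen.cases_head h.2 with h' | ⟨y, ⟨-, i, rfl⟩, hy⟩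
  · exact absurd (h' ▸ h.1) hx
  · exact ⟨i, h.1, hy⟩

theorem exists_isLeafOf [Nonempty ι] (τ : α → ℕ) (hτ : ∀ x ∉ A, ∀ i, τ (c i x) < τ x) (x : α) :
    ∃ b, IsLeafOf A c x b := by
  induction h : τ x using Nat.strong_induction_on generalizing x with
  | _ n ih =>
    by_cases hx : x ∈ A
    · exact ⟨x, hx, .refl⟩
    · obtain ⟨i⟩ := ‹Nonempty ι›
      obtain ⟨b, hb⟩ := ih _ (h ▸ hτ x hx i) (c i x) rfl
      exact ⟨b, hb.of_child hx⟩

variable [DecidableEq α] [Fintype ι]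

/-- Replace the vertex `u` of `K` by its children. -/
def expand (c : ι → α → α) (K : Finset α) (u : α) : Finset α :=
  K.erase u ∪ Finset.univ.image (fun i => c i u)

theorem child_mem_expand (u : α) (i : ι) : c i u ∈ expand c K u :=
  Finset.mem_union_right _ (Finset.mem_image_of_mem _ (Finset.mem_univ i))

theorem mem_expand_of_ne {u w : α} (hw : w ∈ K) (h : w ≠ u) : w ∈ expand c K u :=
  Finset.mem_union_left _ (Finset.mem_erase.2 ⟨h, hw⟩)

theorem exists_parent {u w : α} (hu : u ∈ K) (huA : u ∉ A) (hw : w ∈ expand c K u) :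
    ∃ x ∈ K, ∀ b, IsLeafOf A c w b → IsLeafOf A c x b := by
  rcases Finset.mem_union.1 hw with hw | hw
  · exact ⟨w, (Finset.mem_erase.1 hw).2, fun _ h => h⟩
  · obtain ⟨i, -, rfl⟩ := Finset.mem_image.1 hw
    exact ⟨u, hu, fun _ h => h.of_child huA⟩

theorem LinkClass.of_expand [Nonempty ι] (τ : α → ℕ) (hτ : ∀ x ∉ A, ∀ i, τ (c i x) < τ x)
    {u w w' x x' : α} (hu : u ∈ K) (huA : u ∉ A) (h : LinkClass A c (expand c K u) w w')
    (hx : x ∈ K) (hwx : ∀ b, IsLeafOf A c w b → IsLeafOf A c x b)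
    (hx' : x' ∈ K) (hwx' : ∀ b, IsLeafOf A c w' b → IsLeafOf A c x' b) :
    LinkClass A c K x x' := by
  induction h generalizing x' with
  | refl =>
    obtain ⟨b, hb⟩ := exists_isLeafOf τ hτ w
    exact Linked.linkClass ⟨hx, hx', b, hwx b hb, hwx' b hb⟩
  | tail h hl ih =>
    obtain ⟨y, hy, hy'⟩ := exists_parent hu huA hl.1
    obtain ⟨b, hb, hb'⟩ := hl.2.2
    exact (ih hy hy').trans (Linked.linkClass ⟨hy, hx', b, hy' b hb, hwx' b hb'⟩)

theorem LinkClass.expand_child {u x : α} (huA : u ∉ A) (hxu : x ≠ u)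
    (h : LinkClass A c K x u) : ∃ i, LinkClass A c (expand c K u) x (c i u) := by
  induction h using Relation.ReflTransGen.head_induction_on with
  | refl => exact absurd rfl hxu
  | head hxy hyu ih =>
    rename_i x y
    obtain ⟨b, hb, hb'⟩ := hxy.2.2
    by_cases hy : y = u
    · subst hy
      obtain ⟨i, hi⟩ := hb'.exists_child huA
      exact ⟨i, Linked.linkClass ⟨mem_expand_of_ne hxy.1 hxu, child_mem_expand _ _, b, hb, hi⟩⟩
    · obtain ⟨i, hi⟩ := ih hy
      exact ⟨i, (Linked.linkClass
        ⟨mem_expand_of_ne hxy.1 hxu, mem_expand_of_ne hxy.2.1 hy, b, hb, hb'⟩).trans hi⟩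

theorem LinkClass.expand_of_not {u x y : α} (hxy : LinkClass A c K x y)
    (hu : ¬ LinkClass A c K x u) : LinkClass A c (expand c K u) x y := by
  induction hxy with
  | refl => exact .refl
  | tail h hl ih =>
    rename_i y z
    have hy : y ≠ u := fun e => hu (e ▸ h)
    have hz : z ≠ u := fun e => hu (e ▸ h.tail hl)
    exact ih.trans (Linked.linkClass
      ⟨mem_expand_of_ne hl.1 hy, mem_expand_of_ne hl.2.1 hz, hl.2.2⟩)

theorem sum_pow_expand_lt (τ : α → ℕ) {u : α} (hu : u ∈ K) (hτ : ∀ i, τ (c i u) < τ u) :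
    ∑ w ∈ expand c K u, (Fintype.card ι + 1) ^ τ w < ∑ w ∈ K, (Fintype.card ι + 1) ^ τ w := by
  rw [← Finset.sum_erase_add _ _ hu]
  refine (Finset.sum_union_inter (s₁ := K.erase u)
    (s₂ := Finset.univ.image (fun i => c i u)) (f := fun w => (Fintype.card ι + 1) ^ τ w)
    ▸ Nat.le_add_right _ _ : _ ≤ _).trans_lt ?_
  refine Nat.add_lt_add_left ?_ _
  by_cases h0 : τ u = 0
  · have : IsEmpty ι := ⟨fun i => by have := hτ i; omega⟩
    simp
  obtain ⟨n, hn⟩ := Nat.exists_eq_succ_of_ne_zero h0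
  calc ∑ w ∈ Finset.univ.image (fun i => c i u), (Fintype.card ι + 1) ^ τ w
      ≤ ∑ w ∈ Finset.univ.image (fun i => c i u), (Fintype.card ι + 1) ^ n := by
        refine Finset.sum_le_sum fun w hw => ?_
        obtain ⟨i, -, rfl⟩ := Finset.mem_image.1 hw
        have := hτ i
        exact Nat.pow_le_pow_right (by omega) (by omega)
    _ ≤ Fintype.card ι * (Fintype.card ι + 1) ^ n := by
        rw [Finset.sum_const, smul_eq_mul]
        exact Nat.mul_le_mul_right _ (Finset.card_image_le.trans (by simp))
    _ < (Fintype.card ι + 1) ^ τ u := by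
        rw [hn, pow_succ, mul_comm]
        exact Nat.mul_lt_mul_of_pos_left (by omega) (by positivity)

end Explanation

section ToomLemma

variable {α ι : Type*} [DecidableEq α] [Fintype ι] [DecidableEq ι] [Nonempty ι]

/-- If each of finitely many potentials `L i` summing to zero can be increased by passing to a
child, then linked poles lie in an animal in which leaves have positive density. -/
theorem exists_animal_of_poles {A : Set α} {c : ι → α → α} (τ : α → ℕ) (L : ι → α → ℝ)
    (adj : α → α → Prop) (M : ℝ) (hsymm : ∀ a b, adj a b → adj b a)
    (hτ : ∀ x ∉ A, ∀ i, τ (c i x) < τ x)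
    (hL : ∀ x ∉ A, ∀ i, L i x + 1 ≤ L i (c i x))
    (hLM : ∀ x ∉ A, ∀ i j, L i x - M ≤ L i (c j x))
    (hL0 : ∀ x, ∑ i, L i x = 0) (hadj : ∀ x ∉ A, ∀ i, adj x (c i x))
    (K : Finset α) (v : ι → α) (hv : ∀ i, v i ∈ K) (hvv : ∀ i j, LinkClass A c K (v i) (v j)) :
    ∃ F B : Finset α, (∃ x, IsAnimal adj x F) ∧ (∀ i, v i ∈ F) ∧ B ⊆ F ∧ (∀ b ∈ B, b ∈ A) ∧
      (∀ b ∈ B, ∃ w ∈ K, IsLeafOf A c w b ∧ ∀ i, LinkClass A c K w (v i)) ∧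
      (F.card : ℝ) + ∑ i, L i (v i) + (Fintype.card ι * M + 1) ≤
        (Fintype.card ι * M + 2) * B.card := by
  induction hn : ∑ w ∈ K, (Fintype.card ι + 1) ^ τ w using Nat.strong_induction_on
    generalizing K v with
  | _ n ih =>
  by_cases hK : ∀ w ∈ K, w ∈ A
  · obtain ⟨i₀⟩ := ‹Nonempty ι›
    have heq : ∀ x y, LinkClass A c K x y → x = y := by
      intro x y h
      induction h with
      | refl => rfl
      | tail _ hl ih =>
        obtain ⟨b, hb, hb'⟩ := hl.2.2
        rw [ih, ← hb.eq_of_mem (hK _ hl.1), hb'.eq_of_mem (hK _ hl.2.1)]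
    have hvi : ∀ i, v i = v i₀ := fun i => heq _ _ (hvv i i₀)
    refine ⟨{v i₀}, {v i₀}, ⟨_, .single⟩, fun i => by simp [hvi i], subset_rfl, ?_, ?_, ?_⟩
    · simpa using hK _ (hv i₀)
    · intro b hb
      obtain rfl := Finset.mem_singleton.1 hb
      exact ⟨v i₀, hv i₀, ⟨hK _ (hv i₀), .refl⟩, fun i => hvv _ _⟩
    · simp only [hvi, hL0]
      simp
      linarith
  push Not at hK
  obtain ⟨u, hu, huA⟩ := hK
  set K' := expand c K u with hK'
  set v' : ι → α := fun i => if v i = u then c i u else v i with hv'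
  have hlt := sum_pow_expand_lt (c := c) τ hu (hτ u huA)
  have hv'K : ∀ i, v' i ∈ K' := by
    intro i
    by_cases h : v i = u
    · simp only [hv', h, if_true]; exact child_mem_expand _ _
    · simp only [hv', h, if_false]; exact mem_expand_of_ne (hv i) h
  have hpar : ∀ i b, IsLeafOf A c (v' i) b → IsLeafOf A c (v i) b := by
    intro i b hb
    by_cases h : v i = u
    · simp only [hv', h, if_true] at hb; rw [h]; exact hb.of_child huA
    · simpa only [hv', h, if_false] using hb
  have hlift : ∀ b w, w ∈ K' → IsLeafOf A c w b → (∃ i, LinkClass A c K' w (v' i)) →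
      ∃ w ∈ K, IsLeafOf A c w b ∧ ∀ i, LinkClass A c K w (v i) := by
    rintro b w hw hb ⟨i, hi⟩
    obtain ⟨x, hx, hwx⟩ := exists_parent hu huA hw
    exact ⟨x, hx, hwx b hb, fun j =>
      (LinkClass.of_expand τ hτ hu huA hi hx hwx (hv i) (hpar i)).trans (hvv i j)⟩
  have hLv : ∀ i, L i (v i) + (if v i = u then 1 else 0) ≤ L i (v' i) := by
    intro i
    by_cases h : v i = u
    · simp only [hv', h, if_true]; exact hL u huA i
    · simp [hv', h]
  by_cases hall : ∀ i j, LinkClass A c K' (v' i) (v' j)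
  · obtain ⟨F, B, ⟨x, hF⟩, hvF, hBF, hBA, hBw, hcard⟩ := ih _ (hn ▸ hlt) K' v' hv'K hall rfl
    have hB' : ∀ b ∈ B, ∃ w ∈ K, IsLeafOf A c w b ∧ ∀ i, LinkClass A c K w (v i) := by
      intro b hb
      obtain ⟨w, hw, hwb, hwi⟩ := hBw b hb
      exact hlift b w hw hwb ⟨Classical.arbitrary ι, hwi _⟩
    by_cases hm : ∃ i, v i = u
    · obtain ⟨i, hi⟩ := hm
      have hci : c i u ∈ F := by simpa [hv', hi] using hvF i
      refine ⟨insert u F, B, ⟨x, hF.insert hci (hsymm _ _ (hadj u huA i))⟩, ?_,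
        hBF.trans (Finset.subset_insert _ _), hBA, hB', ?_⟩
      · intro j
        by_cases hj : v j = u
        · simp [hj]
        · exact Finset.mem_insert_of_mem (by simpa [hv', hj] using hvF j)
      · have h1 : ((insert u F).card : ℝ) ≤ F.card + 1 := by
          exact_mod_cast Finset.card_insert_le _ _
        have h2 : ∑ i, L i (v i) + 1 ≤ ∑ i, L i (v' i) := by
          calc _ ≤ ∑ i, L i (v i) + ∑ j, (if v j = u then (1 : ℝ) else 0) := by
                gcongr
                calc (1 : ℝ) = if v i = u then (1 : ℝ) else 0 := by simp [hi]
                  _ ≤ _ := Finset.single_le_sum (f := fun j => if v j = u then (1 : ℝ) else 0)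
                    (fun j _ => by positivity) (Finset.mem_univ i)
            _ ≤ _ := by rw [← Finset.sum_add_distrib]; exact Finset.sum_le_sum fun i _ => hLv i
        linarith
    · push Not at hm
      have : v' = v := by funext i; simp [hv', hm i]
      rw [this] at hvF hcard
      exact ⟨F, B, ⟨x, hF⟩, hvF, hBF, hBA, hB', hcard⟩
  · have hvu : ∀ i, LinkClass A c K (v i) u := by
      by_contra hcon
      push Not at hcon
      obtain ⟨i, hi⟩ := hcon
      have hni : ∀ j, ¬ LinkClass A c K (v j) u := fun j hj => hi ((hvv i j).trans hj)
      have hvj : ∀ j, v' j = v j := by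
        intro j
        have : v j ≠ u := fun e => hni j (by rw [e]; exact .refl)
        simp [hv', this]
      exact hall fun j k => by
        rw [hvj, hvj]
        exact (hvv j k).expand_of_not (hni j)
    have hk : ∀ i, ∃ k, LinkClass A c K' (v' i) (c k u) := by
      intro i
      by_cases h : v i = u
      · exact ⟨i, by simp only [hv', h, if_true]; exact .refl⟩
      · simpa only [hv', h, if_false] using (hvu i).expand_child huA h
    choose k hk using hk
    let r : Setoid ι :=
      { r := fun i j => LinkClass A c K' (v' i) (v' j)
        iseqv := ⟨fun _ => .refl, fun h => h.symm, fun h h' => h.trans h'⟩ }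
    set ρ : ι → ι := fun i => (Quotient.mk r i).out with hρ
    have hρi : ∀ i, LinkClass A c K' (v' (ρ i)) (v' i) := fun i =>
      Quotient.exact (Quotient.out_eq (Quotient.mk r i))
    have hρeq : ∀ i j, LinkClass A c K' (v' i) (v' j) → ρ i = ρ j := fun i j h => by
      simp only [hρ]; rw [Quotient.sound (s := r) h]
    set J := Finset.univ.image ρ with hJ
    have hρJ : ∀ i, ρ i ∈ J := fun i => Finset.mem_image_of_mem _ (Finset.mem_univ i)
    have hρj : ∀ j ∈ J, ρ j = j := by
      intro j hj
      obtain ⟨i, -, rfl⟩ := Finset.mem_image.1 hj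
      exact hρeq _ _ (hρi i)
    have hne : ∀ j, ∃ i, ρ i ≠ j := by
      by_contra hcon
      push Not at hcon
      obtain ⟨j, hj⟩ := hcon
      exact hall fun i i' => (hρi i).symm.trans (by rw [hj i, ← hj i']; exact hρi i')
    have key : ∀ j, ∃ F B : Finset α, (∃ x, IsAnimal adj x F) ∧
        (∀ i, (if ρ i = j then v' i else c (k j) u) ∈ F) ∧ B ⊆ F ∧ (∀ b ∈ B, b ∈ A) ∧
        (∀ b ∈ B, ∃ w ∈ K', IsLeafOf A c w b ∧
          ∀ i, LinkClass A c K' w (if ρ i = j then v' i else c (k j) u)) ∧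
        (F.card : ℝ) + ∑ i, L i (if ρ i = j then v' i else c (k j) u) +
          (Fintype.card ι * M + 1) ≤ (Fintype.card ι * M + 2) * B.card := by
      intro j
      have hcl : ∀ i, LinkClass A c K' (v' j) (if ρ i = j then v' i else c (k j) u) := by
        intro i
        split_ifs with h
        · rw [← h]; exact hρi i
        · exact hk j
      refine ih _ (hn ▸ hlt) K' _ ?_ (fun i i' => (hcl i).symm.trans (hcl i')) rfl
      intro i
      split_ifs
      · exact hv'K i
      · exact child_mem_expand _ _
    choose F B hF hvF hBF hBA hBw hcard using key
    have hzF : ∀ j, c (k j) u ∈ F j := by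
      intro j
      obtain ⟨i, hi⟩ := hne j
      simpa [hi] using hvF j i
    have hBj : ∀ j ∈ J, ∀ b ∈ B j, ∃ w ∈ K', IsLeafOf A c w b ∧ LinkClass A c K' w (v' j) := by
      intro j hj b hb
      obtain ⟨w, hw, hwb, hwi⟩ := hBw j b hb
      exact ⟨w, hw, hwb, by simpa [hρj j hj] using hwi j⟩
    have hdisj : (J : Set ι).PairwiseDisjoint B := by
      intro j hj j' hj' hjj'
      refine Finset.disjoint_left.2 fun b hb hb' => hjj' ?_
      obtain ⟨w, hw, hwb, hwi⟩ := hBj j hj b hb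
      obtain ⟨w', hw', hwb', hwi'⟩ := hBj j' hj' b hb'
      have : LinkClass A c K' (v' j) (v' j') :=
        hwi.symm.trans ((Linked.linkClass ⟨hw, hw', b, hwb, hwb'⟩).trans hwi')
      rw [← hρj j hj, ← hρj j' hj', hρeq _ _ this]
    refine ⟨insert u (J.biUnion F), J.biUnion B, ⟨u, IsAnimal.insert_biUnion u J
      (fun j => c (k j) u) F (fun j _ => ?_) (fun j _ => hadj u huA _)⟩, ?_, ?_, ?_, ?_, ?_⟩
    · obtain ⟨x, hx⟩ := hF j
      exact hx.reroot hsymm (hzF j)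
    · intro i
      by_cases hi : v i = u
      · simp [hi]
      · refine Finset.mem_insert_of_mem (Finset.mem_biUnion.2 ⟨ρ i, hρJ i, ?_⟩)
        simpa [hv', hi] using hvF (ρ i) i
    · exact (Finset.biUnion_mono fun j _ => hBF j).trans (Finset.subset_insert _ _)
    · intro b hb
      obtain ⟨j, -, hj⟩ := Finset.mem_biUnion.1 hb
      exact hBA j b hj
    · intro b hb
      obtain ⟨j, hjJ, hj⟩ := Finset.mem_biUnion.1 hb
      obtain ⟨w, hw, hwb, hwi⟩ := hBj j hjJ b hj
      exact hlift b w hw hwb ⟨j, hwi⟩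
    · have hJ2 : (2 : ℝ) ≤ J.card := by
        obtain ⟨i, hi⟩ := hne (ρ (Classical.arbitrary ι))
        have : 1 < J.card := Finset.one_lt_card.2 ⟨_, hρJ i, _, hρJ _, hi⟩
        exact_mod_cast this
      have h1 : ((insert u (J.biUnion F)).card : ℝ) ≤ ∑ j ∈ J, ((F j).card : ℝ) + 1 := by
        have := (Finset.card_insert_le u (J.biUnion F)).trans
          (Nat.add_le_add_right Finset.card_biUnion_le 1)
        exact_mod_cast this
      have h2 : ((J.biUnion B).card : ℝ) = ∑ j ∈ J, ((B j).card : ℝ) := by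
        rw [Finset.card_biUnion hdisj]; push_cast; rfl
      have h3 : ∑ i, L i (v i) - (J.card - 1) * (Fintype.card ι * M) ≤
          ∑ j ∈ J, ∑ i, L i (if ρ i = j then v' i else c (k j) u) := by
        rw [Finset.sum_comm]
        have hi : ∀ i, L i (v i) + (J.card - 1) * (L i u - M) ≤
            ∑ j ∈ J, L i (if ρ i = j then v' i else c (k j) u) := by
          intro i
          calc L i (v i) + (J.card - 1) * (L i u - M)
              ≤ L i (v' i) + (J.card - 1) * (L i u - M) := by
                have := hLv i
                split_ifs at this <;> linarith
            _ = ∑ j ∈ J, ((L i u - M) + if ρ i = j then L i (v' i) - (L i u - M) else 0) := by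
                rw [Finset.sum_add_distrib, Finset.sum_ite_eq, if_pos (hρJ i)]
                simp
                ring
            _ ≤ _ := by
                refine Finset.sum_le_sum fun j _ => ?_
                split_ifs
                · linarith
                · linarith [hLM u huA i (k j)]
        calc _ = ∑ i, (L i (v i) + (J.card - 1) * (L i u - M)) := by
              rw [Finset.sum_add_distrib, ← Finset.mul_sum, Finset.sum_sub_distrib, hL0]
              simp
              ring
          _ ≤ _ := Finset.sum_le_sum fun i _ => hi i
      have h4 := Finset.sum_le_sum fun j (_ : j ∈ J) => hcard j
      rw [Finset.sum_add_distrib, Finset.sum_add_distrib, ← Finset.mul_sum, ← h2] at h4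
      simp only [Finset.sum_const, nsmul_eq_mul] at h4
      nlinarith

/-- A vertex all of whose potentials can be increased lies in an animal with many leaves. -/
theorem exists_animal_of_vertex {A : Set α} {c : ι → α → α} (τ : α → ℕ) (L : ι → α → ℝ)
    (adj : α → α → Prop) (M : ℝ) (hM : 0 ≤ M) (hsymm : ∀ a b, adj a b → adj b a)
    (hτ : ∀ x ∉ A, ∀ i, τ (c i x) < τ x)
    (hL : ∀ x ∉ A, ∀ i, L i x + 1 ≤ L i (c i x))
    (hLM : ∀ x ∉ A, ∀ i j, L i x - M ≤ L i (c j x))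
    (hL0 : ∀ x, ∑ i, L i x = 0) (hadj : ∀ x ∉ A, ∀ i, adj x (c i x)) (x : α) :
    ∃ F B : Finset α, IsAnimal adj x F ∧ B ⊆ F ∧ (∀ b ∈ B, b ∈ A) ∧
      (F.card : ℝ) ≤ (Fintype.card ι * M + 2) * B.card := by
  obtain ⟨F, B, ⟨y, hF⟩, hv, hBF, hBA, -, hcard⟩ :=
    exists_animal_of_poles τ L adj M hsymm hτ hL hLM hL0 hadj {x} (fun _ => x)
      (by simp) (fun _ _ => .refl)
  refine ⟨F, B, hF.reroot hsymm (hv (Classical.arbitrary ι)), hBF, hBA, ?_⟩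
  rw [hL0] at hcard
  have : 0 ≤ Fintype.card ι * M := by positivity
  linarith

end ToomLemma

section Closure

variable {U : Finset (Finset Site)} {A B : Set Site}

theorem bsIter_subset_succ (n : ℕ) : bsIter U n A ⊆ bsIter U (n + 1) A :=
  subset_union_left

theorem bsIter_mono : Monotone fun n => bsIter U n A :=
  monotone_nat_of_le_succ bsIter_subset_succ

theorem subset_bsClosure : A ⊆ bsClosure U A :=
  subset_iUnion (fun n => bsIter U n A) 0

theorem mem_bsClosure_of_rule {X : Finset Site} (hX : X ∈ U) {x : Site}
    (h : ∀ y ∈ X, y + x ∈ bsClosure U A) : x ∈ bsClosure U A := by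
  have h1 : ∀ᶠ n in Filter.atTop, ∀ y ∈ X, y + x ∈ bsIter U n A := by
    rw [Filter.eventually_all_finset]
    intro y hy
    obtain ⟨n, hn⟩ := mem_iUnion.1 (h y hy)
    filter_upwards [Filter.eventually_ge_atTop n] with m hm using bsIter_mono hm hn
  obtain ⟨n, hn⟩ := h1.exists
  exact mem_iUnion.2 ⟨n + 1, Or.inr ⟨X, hX, hn⟩⟩

theorem bsClosure_subset (hAB : A ⊆ B)
    (hB : ∀ X ∈ U, ∀ x, (∀ y ∈ X, y + x ∈ B) → x ∈ B) : bsClosure U A ⊆ B := by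
  refine iUnion_subset fun n => ?_
  induction n with
  | zero => exact hAB
  | succ n ih =>
    rintro x (hx | ⟨X, hX, hx⟩)
    · exact ih hx
    · exact hB X hX x fun y hy => ih (hx y hy)

theorem exists_infection_time (U : Finset (Finset Site)) (A : Set Site) :
    ∃ τ : Site → ℕ, ∀ x ∈ bsClosure U A, x ∉ A →
      ∃ X ∈ U, ∀ y ∈ X, y + x ∈ bsClosure U A ∧ τ (y + x) < τ x := by
  classical
  refine ⟨fun x => sInf {n | x ∈ bsIter U n A}, fun x hx hxA => ?_⟩
  obtain ⟨n, hn⟩ := mem_iUnion.1 hx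
  have h1 : x ∈ bsIter U (sInf {n | x ∈ bsIter U n A}) A :=
    Nat.sInf_mem (s := {n | x ∈ bsIter U n A}) ⟨n, hn⟩
  rcases h2 : sInf {n | x ∈ bsIter U n A} with _ | m
  · rw [h2] at h1
    exact absurd h1 hxA
  · have h3 : x ∉ bsIter U m A := fun h =>
      absurd (Nat.sInf_le (s := {n | x ∈ bsIter U n A}) h) (by omega)
    rw [h2] at h1
    rcases h1 with h1 | ⟨X, hX, h1⟩
    · exact absurd h1 h3
    · refine ⟨X, hX, fun y hy => ⟨mem_iUnion.2 ⟨m, h1 y hy⟩, ?_⟩⟩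
      exact lt_of_le_of_lt (Nat.sInf_le (s := {n | y + x ∈ bsIter U n A}) (h1 y hy))
        (by simp [h2])

/-- The pairing of a lattice site with a vector of the plane. -/
def pairing (y : Site) (u : ℝ × ℝ) : ℝ := y.1 * u.1 + y.2 * u.2

theorem pairing_add (x y : Site) (u : ℝ × ℝ) : pairing (x + y) u = pairing x u + pairing y u := by
  simp only [pairing, Prod.fst_add, Prod.snd_add]; push_cast; ring

theorem pairing_smul (y : Site) (r : ℝ) (u : ℝ × ℝ) : pairing y (r • u) = r * pairing y u := by
  simp only [pairing, Prod.smul_fst, Prod.smul_snd, smul_eq_mul]; ring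

theorem pairing_sum {ι : Type*} (s : Finset ι) (y : Site) (u : ι → ℝ × ℝ) :
    ∑ i ∈ s, pairing y (u i) = pairing y (∑ i ∈ s, u i) := by
  simp only [pairing, Prod.fst_sum, Prod.snd_sum, Finset.sum_add_distrib, Finset.mul_sum]

theorem continuous_pairing (y : Site) : Continuous (pairing y) := by
  unfold pairing; fun_prop

theorem isStableDir_iff {u : ℝ × ℝ} : IsStableDir U u ↔ ∀ X ∈ U, ∃ y ∈ X, 0 ≤ pairing y u := by
  have hH : ∀ x : Site, x ∈ halfPlane u ↔ pairing x u < 0 := fun x => Iff.rfl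
  constructor
  · intro h X hX
    by_contra! hc
    have h0 : (0 : Site) ∈ bsClosure U (halfPlane u) :=
      mem_bsClosure_of_rule hX fun y hy => subset_bsClosure (by simpa [hH] using hc y hy)
    rw [show bsClosure U (halfPlane u) = halfPlane u from h, hH] at h0
    simp [pairing] at h0
  · intro h
    refine Subset.antisymm (bsClosure_subset Subset.rfl fun X hX x hx => ?_) subset_bsClosure
    obtain ⟨y, hy, hyu⟩ := h X hX
    have := hx y hy
    rw [hH, pairing_add] at this
    rw [hH]
    linarith

theorem pairing_dir_subsingleton {y : Site} (hy : y ≠ 0) {a b : ℝ} (hab : b - a ≤ Real.pi) :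
    (Ioo a b ∩ {φ | pairing y (dir φ) = 0}).Subsingleton := by
  rintro φ ⟨hφ, h1⟩ ψ ⟨hψ, h2⟩
  simp only [mem_ofPred_eq, pairing, dir] at h1 h2
  have hs : Real.sin (φ - ψ) = 0 := by
    rw [Real.sin_sub]
    by_cases hy1 : (y.1 : ℝ) = 0
    · have hy2 : (y.2 : ℝ) ≠ 0 := fun h => hy (Prod.ext (by exact_mod_cast hy1) (by exact_mod_cast h))
      rw [hy1] at h1 h2
      apply mul_left_cancel₀ hy2
      linear_combination Real.cos ψ * h1 - Real.cos φ * h2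
    · apply mul_left_cancel₀ hy1
      linear_combination Real.sin φ * h2 - Real.sin ψ * h1 
  have := (Real.sin_eq_zero_iff_of_lt_of_lt (x := φ - ψ)
    (by linarith [hφ.1, hψ.2]) (by linarith [hφ.2, hψ.1])).1 hs
  linarith

theorem exists_angle_pairing_ne_zero (hU : IsUpdateFamily U) {a b : ℝ} (hab : a < b)
    (hab' : b - a ≤ Real.pi) :
    ∃ φ ∈ Ioo a b, ∀ X ∈ U, ∀ y ∈ X, pairing y (dir φ) ≠ 0 := by
  have hfin : (⋃ y ∈ U.biUnion id, Ioo a b ∩ {φ | pairing y (dir φ) = 0}).Finite := by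
    refine (Finset.finite_toSet _).biUnion fun y hy => (pairing_dir_subsingleton ?_ hab').finite
    obtain ⟨X, hX, hyX⟩ := Finset.mem_biUnion.1 hy
    rintro rfl
    exact (hU.2 X hX).2 hyX
  obtain ⟨φ, hφ, hφ'⟩ := ((Ioo_infinite hab).sdiff hfin).nonempty
  refine ⟨φ, hφ, fun X hX y hy h0 => hφ' ?_⟩
  exact mem_biUnion (Finset.mem_biUnion.2 ⟨X, hX, hy⟩) ⟨hφ, h0⟩

/-- Vectors with respect to which every rule has a strictly positive element. -/
def strictCone (U : Finset (Finset Site)) : Set (ℝ × ℝ) :=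
  {u | ∀ X ∈ U, ∃ y ∈ X, 0 < pairing y u}

theorem isOpen_strictCone : IsOpen (strictCone U) := by
  have : strictCone U = ⋂ X ∈ U, ⋃ y ∈ X, {u | 0 < pairing y u} := by
    ext u; simp [strictCone]
  rw [this]
  exact isOpen_biInter_finset fun X _ => isOpen_biUnion fun y _ =>
    isOpen_lt continuous_const (continuous_pairing y)

theorem Subcritical.exists_strictCone (h : Subcritical U) (hU : IsUpdateFamily U) (θ : ℝ) :
    ∃ φ ∈ Ioo θ (θ + Real.pi), dir φ ∈ strictCone U := by
  obtain ⟨φ₀, h1, h2, ε, hε, h3⟩ := h θ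
  obtain ⟨φ, hφ, h4⟩ := exists_angle_pairing_ne_zero hU (a := max θ (φ₀ - ε))
    (b := min (θ + Real.pi) (φ₀ + ε))
    (max_lt (lt_min (by linarith) (by linarith)) (lt_min (by linarith) (by linarith)))
    (by linarith [le_max_left θ (φ₀ - ε), min_le_left (θ + Real.pi) (φ₀ + ε)])
  simp only [mem_Ioo, max_lt_iff, lt_min_iff] at hφ
  refine ⟨φ, ⟨hφ.1.1, hφ.2.1⟩, fun X hX => ?_⟩
  obtain ⟨y, hy, h5⟩ := isStableDir_iff.1 (h3 φ (abs_lt.2 ⟨by linarith [hφ.1.2], by linarith [hφ.2.2]⟩)) X hX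
  exact ⟨y, hy, lt_of_le_of_ne h5 (h4 X hX y hy).symm⟩

theorem Subcritical.zero_mem_convexHull (h : Subcritical U) (hU : IsUpdateFamily U) :
    (0 : ℝ × ℝ) ∈ convexHull ℝ (strictCone U) := by
  by_contra h0
  obtain ⟨f, hf⟩ := geometric_hahn_banach_point_open (convex_convexHull ℝ (strictCone U))
    isOpen_strictCone.convexHull h0
  have hv : ∀ v : ℝ × ℝ, f v = v.1 * f (1, 0) + v.2 * f (0, 1) := fun v => by
    rw [← smul_eq_mul, ← smul_eq_mul, ← map_smul, ← map_smul, ← map_add]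
    simp
  set z : ℂ := ⟨f (1, 0), f (0, 1)⟩ with hz
  obtain ⟨φ, hφ, h1⟩ := h.exists_strictCone hU (z.arg + Real.pi / 2)
  have h2 := hf _ (subset_convexHull ℝ _ h1)
  have h3 : f (dir φ) = ‖z‖ * Real.cos (φ - z.arg) := by
    rw [hv, Real.cos_sub]
    have e1 : f (1, 0) = ‖z‖ * Real.cos z.arg := by rw [Complex.norm_mul_cos_arg]
    have e2 : f (0, 1) = ‖z‖ * Real.sin z.arg := by rw [Complex.norm_mul_sin_arg]
    rw [e1, e2]
    simp only [dir]
    ring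
  have h4 : Real.cos (φ - z.arg) < 0 :=
    Real.cos_neg_of_pi_div_two_lt_of_lt (by linarith [hφ.1]) (by linarith [hφ.2])
  rw [map_zero, h3] at h2
  nlinarith [norm_nonneg z]

theorem Subcritical.exists_potentials (h : Subcritical U) (hU : IsUpdateFamily U) :
    ∃ (n : ℕ) (u : Fin (n + 1) → ℝ × ℝ), ∑ i, u i = 0 ∧ ∀ X ∈ U, ∀ i, ∃ y ∈ X, 1 ≤ pairing y (u i) := by
  obtain ⟨ι, _, z, w, hz, -, hw, hw1, hwz⟩ :=
    eq_pos_convex_span_of_mem_convexHull (h.zero_mem_convexHull hU)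
  have hpos : ∀ X ∈ U, ∀ i, ∃ y ∈ X, 0 < pairing y (w i • z i) := fun X hX i => by
    obtain ⟨y, hy, h1⟩ := hz (mem_range_self i) X hX
    exact ⟨y, hy, by rw [pairing_smul]; exact mul_pos (hw i) h1⟩
  have hne : Nonempty ι := by
    by_contra hc
    rw [not_nonempty_iff] at hc
    simp at hw1
  have hev : ∀ᶠ r : ℝ in Filter.atTop, ∀ X ∈ U, ∀ i, ∃ y ∈ X, 1 ≤ pairing y (r • w i • z i) := by
    rw [Filter.eventually_all_finset]
    intro X hX
    rw [Filter.eventually_all]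
    intro i
    obtain ⟨y, hy, h1⟩ := hpos X hX i
    filter_upwards [Filter.eventually_ge_atTop (1 / pairing y (w i • z i))] with r hr
    refine ⟨y, hy, ?_⟩
    rw [pairing_smul]
    exact (div_le_iff₀ h1).1 hr
  obtain ⟨r, hr⟩ := hev.exists
  obtain ⟨n, hn⟩ : ∃ n, Fintype.card ι = n + 1 := Nat.exists_eq_add_one.2 Fintype.card_pos
  let e := (Fintype.equivFinOfCardEq hn).symm
  refine ⟨n, fun i => r • w (e i) • z (e i), ?_, fun X hX i => hr X hX _⟩
  rw [e.sum_comp (fun i => r • w i • z i), ← Finset.smul_sum, hwz, smul_zero]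

end Closure

section Walks

/-- The list of sites visited by the walk with starting point `x` and list of steps `w`. -/
def trail : Site → List Site → List Site
  | x, [] => [x]
  | x, d :: w => x :: trail (x + d) w

theorem length_trail (x : Site) (w : List Site) : (trail x w).length = w.length + 1 := by
  induction w generalizing x with
  | nil => rfl
  | cons d w ih => simp [trail, ih]

theorem exists_trail_detour {S : Finset Site} (hS : ∀ d ∈ S, -d ∈ S) {x z d : Site}
    {w : List Site} (hw : ∀ e ∈ w, e ∈ S) (hz : z ∈ trail x w) (hd : d ∈ S) :
    ∃ w' : List Site, (∀ e ∈ w', e ∈ S) ∧ w'.length = w.length + 2 ∧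
      (∀ a ∈ trail x w, a ∈ trail x w') ∧ z + d ∈ trail x w' := by
  by_cases hxz : z = x
  · subst hxz
    refine ⟨d :: (-d) :: w, ?_, by simp, ?_, ?_⟩
    · simpa [hd, hS d hd] using hw
    · intro a ha
      simp [trail, ha]
    · simp [trail]
  · induction w generalizing x with
    | nil => simp [trail, hxz] at hz
    | cons e w ih =>
      have hz' : z ∈ trail (x + e) w := by simpa [trail, hxz] using hz
      have hw' : ∀ a ∈ w, a ∈ S := fun a ha => hw a (List.mem_cons_of_mem _ ha)
      have he : e ∈ S := hw e List.mem_cons_self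
      by_cases hxz' : z = x + e
      · refine ⟨e :: d :: (-d) :: w, ?_, by simp, ?_, ?_⟩
        · simpa [hd, hS d hd, he] using hw'
        · intro a ha
          simp only [trail, List.mem_cons] at ha
          rcases ha with ha | ha <;> simp [trail, ha]
        · simp [trail, hxz']
      · obtain ⟨w', h1, h2, h3, h4⟩ := ih hw' hz' hxz'
        refine ⟨e :: w', by simpa [he] using h1, by simp [h2], ?_, ?_⟩
        · intro a ha
          simp only [trail, List.mem_cons] at ha ⊢
          exact ha.imp_right (h3 a)
        · simp [trail, h4]

theorem IsAnimal.exists_trail {S : Finset Site} (hS : ∀ d ∈ S, -d ∈ S) {x : Site} {F : Finset Site}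
    (hF : IsAnimal (fun a b => b - a ∈ S) x F) :
    ∃ w : List Site, (∀ e ∈ w, e ∈ S) ∧ w.length + 2 = 2 * F.card ∧ ∀ a ∈ F, a ∈ trail x w := by
  induction hF with
  | single => exact ⟨[], by simp, by simp, by simp [trail]⟩
  | @insert F z y hF hz hzy ih =>
    obtain ⟨w, h1, h2, h3⟩ := ih
    by_cases hy : y ∈ F
    · exact ⟨w, h1, by rwa [Finset.insert_eq_of_mem hy], by rwa [Finset.insert_eq_of_mem hy]⟩
    · obtain ⟨w', h4, h5, h6, h7⟩ := exists_trail_detour hS h1 (h3 z hz) hzy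
      refine ⟨w', h4, by rw [Finset.card_insert_of_notMem hy]; omega, fun a ha => ?_⟩
      rcases Finset.mem_insert.1 ha with rfl | ha
      · simpa using h7
      · exact h6 a (h3 a ha)

theorem mem_trail_replicate_append {x a : Site} {w : List Site} (n : ℕ) (ha : a ∈ trail x w) :
    a ∈ trail x (List.replicate n 0 ++ w) := by
  induction n with
  | zero => simpa using ha
  | succ n ih => simp [List.replicate_succ, trail, ih]

theorem IsAnimal.map {α β : Type*} [DecidableEq α] [DecidableEq β] {adj : α → α → Prop}
    {adj' : β → β → Prop} (g : α → β) (hg : ∀ a b, adj a b → adj' (g a) (g b)) {x : α}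
    {F : Finset α} (hF : IsAnimal adj x F) : IsAnimal adj' (g x) (F.image g) := by
  induction hF with
  | single => simpa using IsAnimal.single
  | insert hF hz hzy ih =>
    rw [Finset.image_insert]
    exact ih.insert (Finset.mem_image_of_mem g hz) (hg _ _ hzy)

/-- The symmetrised set of displacements occurring in the rules of `U`. -/
def stepSet (U : Finset (Finset Site)) : Finset Site :=
  insert 0 (U.biUnion id ∪ (U.biUnion id).image fun y => -y)

theorem neg_mem_stepSet {U : Finset (Finset Site)} {d : Site} (hd : d ∈ stepSet U) :
    -d ∈ stepSet U := by
  simp only [stepSet, Finset.mem_insert, Finset.mem_union, Finset.mem_image] at hd ⊢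
  rcases hd with rfl | hd | ⟨y, hy, rfl⟩
  · simp
  · exact Or.inr (Or.inr ⟨d, hd, rfl⟩)
  · exact Or.inr (Or.inl (by simpa using hy))

theorem mem_stepSet {U : Finset (Finset Site)} {X : Finset Site} {y : Site} (hX : X ∈ U)
    (hy : y ∈ X) : y ∈ stepSet U :=
  Finset.mem_insert_of_mem (Finset.mem_union_left _ (Finset.mem_biUnion.2 ⟨X, hX, hy⟩))

theorem Subcritical.exists_animal {U : Finset (Finset Site)} (h : Subcritical U)
    (hU : IsUpdateFamily U) :
    ∃ C : ℕ, ∀ (A : Set Site), ∀ x ∈ bsClosure U A, ∃ F B : Finset Site,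
      IsAnimal (fun a b => b - a ∈ stepSet U) x F ∧ B ⊆ F ∧ (∀ b ∈ B, b ∈ A) ∧
        F.card ≤ C * B.card := by
  classical
  obtain ⟨n, u, hu0, hu⟩ := h.exists_potentials hU
  obtain ⟨M, hM, hM0⟩ : ∃ M : ℝ, (∀ X ∈ U, ∀ y ∈ X, ∀ i, -M ≤ pairing y (u i)) ∧ 0 ≤ M := by
    have : ∀ᶠ M : ℝ in Filter.atTop, ∀ X ∈ U, ∀ y ∈ X, ∀ i, -M ≤ pairing y (u i) := by
      simp only [Filter.eventually_all_finset, Filter.eventually_all]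
      intro X _ y _ i
      filter_upwards [Filter.eventually_ge_atTop (-pairing y (u i))] with M hM
      linarith
    exact (this.and (Filter.eventually_ge_atTop 0)).exists
  refine ⟨⌈(Fintype.card (Fin (n + 1)) * M + 2 : ℝ)⌉₊, fun A x hx => ?_⟩
  obtain ⟨τ, hτ⟩ := exists_infection_time U A
  have hc : ∀ z : bsClosure U A, ∃ c : Fin (n + 1) → bsClosure U A, (z : Site) ∉ A →
      ∀ i, τ (c i) < τ z ∧ ((c i : Site) - z ∈ stepSet U) ∧
        1 ≤ pairing ((c i : Site) - z) (u i) ∧ ∀ j, -M ≤ pairing ((c i : Site) - z) (u j) := by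
    intro z
    by_cases hz : (z : Site) ∈ A
    · exact ⟨fun _ => z, fun h => absurd hz h⟩
    · obtain ⟨X, hX, hX'⟩ := hτ z z.2 hz
      choose y hy hy' using hu X hX
      refine ⟨fun i => ⟨y i + z, (hX' _ (hy i)).1⟩, fun _ i => ?_⟩
      simp only [add_sub_cancel_right]
      exact ⟨(hX' _ (hy i)).2, mem_stepSet hX (hy i), hy' i, hM X hX _ (hy i)⟩
  choose c hc using hc
  have hL : ∀ (a b : Site) (i : Fin (n + 1)), pairing a (u i) = pairing b (u i) + pairing (a - b) (u i) :=
    fun a b i => by rw [← pairing_add]; simp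
  obtain ⟨F, B, hF, hBF, hBA, hcard⟩ := exists_animal_of_vertex (α := bsClosure U A)
    (A := {z | (z : Site) ∈ A}) (c := fun i z => c z i) (fun z => τ z) (fun i z => pairing (z : Site) (u i))
    (fun a b => (b : Site) - a ∈ stepSet U) M hM0
    (fun a b hab => by simpa using neg_mem_stepSet hab)
    (fun z hz i => (hc z hz i).1)
    (fun z hz i => by
      have := (hc z hz i).2.2.1
      simp only [hL (c z i) z]
      linarith)
    (fun z hz i j => by
      have := (hc z hz j).2.2.2 i
      simp only [hL (c z j) z]
      linarith)
    (fun z => by rw [pairing_sum, hu0]; simp [pairing])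
    (fun z hz i => (hc z hz i).2.1) ⟨x, hx⟩
  refine ⟨F.image Subtype.val, B.image Subtype.val, hF.map (adj' := fun a b => b - a ∈ stepSet U) Subtype.val fun a b hab => hab, Finset.image_subset_image hBF,
    ?_, ?_⟩
  · intro b hb
    obtain ⟨b', hb', rfl⟩ := Finset.mem_image.1 hb
    exact hBA b' hb'
  · rw [Finset.card_image_of_injective _ Subtype.val_injective,
      Finset.card_image_of_injective _ Subtype.val_injective]
    have : (F.card : ℝ) ≤ (⌈(Fintype.card (Fin (n + 1)) * M + 2 : ℝ)⌉₊ : ℝ) * B.card :=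
      hcard.trans (by gcongr; exact Nat.le_ceil _)
    exact_mod_cast this

theorem Subcritical.exists_walk {U : Finset (Finset Site)} (h : Subcritical U)
    (hU : IsUpdateFamily U) :
    ∃ D : ℕ, ∀ (A : Set Site), ∀ x ∈ bsClosure U A, ∃ k : ℕ, ∃ w : Fin (D * (k + 1)) → Site,
      (∀ i, w i ∈ stepSet U) ∧ ∃ B : Finset Site, B ⊆ (trail x (List.ofFn w)).toFinset ∧
        B.card = k + 1 ∧ ∀ b ∈ B, b ∈ A := by
  obtain ⟨C, hC⟩ := h.exists_animal hU
  refine ⟨2 * C, fun A x hx => ?_⟩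
  obtain ⟨F, B, hF, hBF, hBA, hcard⟩ := hC A x hx
  obtain ⟨w, h1, h2, h3⟩ := hF.exists_trail fun d => neg_mem_stepSet
  have hF0 : 0 < F.card := Finset.card_pos.2 ⟨x, hF.root_mem⟩
  obtain ⟨k, hk⟩ : ∃ k, B.card = k + 1 := Nat.exists_eq_add_one.2 (by
    by_contra hB
    have : B.card = 0 := by omega
    rw [this] at hcard
    omega)
  rw [hk] at hcard
  have hlen : (List.replicate (2 * C * (k + 1) - w.length) 0 ++ w).length = 2 * C * (k + 1) := by
    rw [List.length_append, List.length_replicate]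
    have : 2 * C * (k + 1) = 2 * (C * (k + 1)) := by ring
    omega
  generalize hw' : List.replicate (2 * C * (k + 1) - w.length) (0 : Site) ++ w = w' at hlen
  refine ⟨k, fun i => w'.get (i.cast hlen.symm), fun i => ?_, B, fun b hb => ?_, hk, hBA⟩
  · have := List.get_mem w' (i.cast hlen.symm)
    beta_reduce
    generalize w'.get (i.cast hlen.symm) = a at this ⊢
    rw [← hw', List.mem_append] at this
    rcases this with h4 | h4
    · rw [List.eq_of_mem_replicate h4]
      simp [stepSet]
    · exact h1 a h4
  · have h5 : List.ofFn (fun i : Fin (2 * C * (k + 1)) => w'.get (i.cast hlen.symm)) = w' := by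
      rw [← List.ofFn_congr hlen.symm.symm, List.ofFn_get]
    rw [h5, List.mem_toFinset, ← hw']
    exact mem_trail_replicate_append _ (h3 b (hBF hb))

end Walks

section Bernoulli

/-- The configurations agreeing with `f` on `s`. -/
def cyl (s : Finset Site) (f : Site → Bool) : Set (Site → Bool) := {ω | ∀ x ∈ s, ω x = f x}

theorem measurableSet_cyl (s : Finset Site) (f : Site → Bool) : MeasurableSet (cyl s f) := by
  have : cyl s f = ⋂ x ∈ s, {ω | ω x = f x} := by ext; simp [cyl]
  rw [this]
  exact Finset.measurableSet_biInter _ fun x _ =>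
    measurableSet_eq_fun (measurable_pi_apply x) measurable_const

variable {p : ℝ} {μ ν : Measure (Site → Bool)}

theorem IsBernoulli.isProbabilityMeasure (h : IsBernoulli p μ) : IsProbabilityMeasure μ :=
  ⟨by simpa using h ∅ fun _ => true⟩

theorem IsBernoulli.ext (hμ : IsBernoulli p μ) (hν : IsBernoulli p ν) : μ = ν := by
  have := hμ.isProbabilityMeasure
  have := hν.isProbabilityMeasure
  refine ext_of_generate_finite (range fun q : Finset Site × (Site → Bool) => cyl q.1 q.2) ?_ ?_ ?_
    (by simp)
  · refine le_antisymm (iSup_le fun x => ?_) ?_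
    · refine Measurable.comap_le (@measurable_to_bool _ (_) (fun ω : Site → Bool => ω x) ?_)
      refine MeasurableSpace.measurableSet_generateFrom ⟨⟨{x}, fun _ => true⟩, ?_⟩
      ext ω; simp [cyl]
    · refine MeasurableSpace.generateFrom_le ?_
      rintro _ ⟨q, rfl⟩
      exact measurableSet_cyl _ _
  · classical
    rintro _ ⟨q, rfl⟩ _ ⟨r, rfl⟩ ⟨ω, hω, hω'⟩
    refine ⟨⟨q.1 ∪ r.1, ω⟩, ?_⟩
    ext η
    simp only [cyl, mem_ofPred_eq, mem_inter_iff, Finset.mem_union] at hω hω' ⊢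
    constructor
    · exact fun h => ⟨fun x hx => (h x (Or.inl hx)).trans (hω x hx),
        fun x hx => (h x (Or.inr hx)).trans (hω' x hx)⟩
    · rintro ⟨h1, h2⟩ x (hx | hx)
      · rw [h1 x hx, hω x hx]
      · rw [h2 x hx, hω' x hx]
  · rintro _ ⟨q, rfl⟩
    exact (hμ _ _).trans (hν _ _).symm

theorem exists_isBernoulli (hp : p ∈ Icc (0 : ℝ) 1) :
    ∃ μ, IsBernoulli p μ ∧ ProbabilityTheory.iIndepFun (fun (x : Site) ω => ω x) μ := by
  let β : Measure Bool := ENNReal.ofReal p • Measure.dirac true +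
    ENNReal.ofReal (1 - p) • Measure.dirac false
  have hβ : IsProbabilityMeasure β := ⟨by
    simp only [β, Measure.coe_add, Measure.coe_smul, Pi.add_apply, Pi.smul_apply, measure_univ,
      smul_eq_mul, mul_one]
    rw [← ENNReal.ofReal_add hp.1 (by linarith [hp.2])]
    simp⟩
  refine ⟨Measure.infinitePi fun _ : Site => β, fun s f => ?_,
    ProbabilityTheory.iIndepFun_infinitePi (X := fun _ b => b) fun _ => measurable_id⟩
  have : {ω : Site → Bool | ∀ x ∈ s, ω x = f x} = Set.pi s fun x => {f x} := by
    ext; simp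
  rw [this, Measure.infinitePi_pi _ fun _ _ => measurableSet_singleton _]
  refine Finset.prod_congr rfl fun x _ => ?_
  cases f x <;> simp [β]

theorem IsBernoulli.measure_forall_true (h : IsBernoulli p μ) (s : Finset Site) :
    μ {ω | ∀ x ∈ s, ω x = true} = ENNReal.ofReal p ^ s.card := by
  simpa using h s fun _ => true

theorem one_mem_critSet (U : Finset (Finset Site)) (hμ : IsBernoulli 1 μ) :
    μ {ω | Percolates U (siteSet ω)} = 1 := by
  have := hμ.isProbabilityMeasure
  have h1 : ∀ᵐ ω ∂μ, ∀ x : Site, ω x = true := by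
    refine ae_all_iff.2 fun x => ?_
    rw [ae_iff_measure_eq]
    · simpa using hμ.measure_forall_true {x}
    · exact (measurableSet_eq_fun (measurable_pi_apply x) measurable_const).nullMeasurableSet
  have h2 : ∀ᵐ ω ∂μ, Percolates U (siteSet ω) := by
    filter_upwards [h1] with ω hω
    exact eq_univ_of_forall fun x => subset_bsClosure (hω x)
  rw [← measure_univ (μ := μ)]
  exact measure_congr (Filter.eventuallyEq_univ.2 h2)

theorem measure_zero_mem_le {U : Finset (Finset Site)} (h : Subcritical U)
    (hU : IsUpdateFamily U) : ∃ Q : ℕ, ∀ (p : ℝ) (μ : Measure (Site → Bool)), IsBernoulli p μ →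
      μ {ω | (0 : Site) ∈ bsClosure U (siteSet ω)} ≤
        ∑' k : ℕ, 2 * (Q * ENNReal.ofReal p) ^ (k + 1) := by
  classical
  obtain ⟨D, hD⟩ := h.exists_walk hU
  refine ⟨((stepSet U).card * 2) ^ D, fun p μ hμ => ?_⟩
  have hsub : {ω | (0 : Site) ∈ bsClosure U (siteSet ω)} ⊆
      ⋃ k : ℕ, ⋃ w ∈ Fintype.piFinset fun _ : Fin (D * (k + 1)) => stepSet U,
        ⋃ B ∈ (trail 0 (List.ofFn w)).toFinset.powersetCard (k + 1), {ω | ∀ b ∈ B, ω b = true} := by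
    intro ω hω
    obtain ⟨k, w, hw, B, hB, hBk, hBA⟩ := hD _ _ hω
    simp only [mem_iUnion]
    exact ⟨k, w, Fintype.mem_piFinset.2 hw, B, Finset.mem_powersetCard.2 ⟨hB, hBk⟩, hBA⟩
  refine (measure_mono hsub).trans ((measure_iUnion_le _).trans (ENNReal.tsum_le_tsum fun k => ?_))
  calc _ ≤ ∑ w ∈ Fintype.piFinset fun _ : Fin (D * (k + 1)) => stepSet U,
        ∑ B ∈ (trail 0 (List.ofFn w)).toFinset.powersetCard (k + 1),
          μ {ω | ∀ b ∈ B, ω b = true} :=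
        (measure_biUnion_finset_le _ _).trans
          (Finset.sum_le_sum fun w _ => measure_biUnion_finset_le _ _)
    _ ≤ ∑ w ∈ Fintype.piFinset fun _ : Fin (D * (k + 1)) => stepSet U,
        (2 ^ (D * (k + 1) + 1) : ℕ) * ENNReal.ofReal p ^ (k + 1) := by
        refine Finset.sum_le_sum fun w _ => ?_
        rw [Finset.sum_congr rfl fun B hB => by
          rw [hμ.measure_forall_true B, (Finset.mem_powersetCard.1 hB).2], Finset.sum_const,
          nsmul_eq_mul]
        gcongr
        refine (Finset.card_le_card fun B hB =>
          Finset.mem_powerset.2 (Finset.mem_powersetCard.1 hB).1).trans ?_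
        rw [Finset.card_powerset]
        refine Nat.pow_le_pow_right two_pos ((List.toFinset_card_le _).trans ?_)
        rw [length_trail, List.length_ofFn]
    _ = _ := by
        rw [Finset.sum_const, Fintype.card_piFinset, nsmul_eq_mul]
        simp only [Finset.prod_const, Finset.card_univ, Fintype.card_fin]
        push_cast
        rw [mul_pow (_ ^ D), ← pow_mul, mul_pow, pow_succ]
        ring

theorem Subcritical.critProb_pos {U : Finset (Finset Site)} (h : Subcritical U)
    (hU : IsUpdateFamily U) : 0 < critProb U := by
  obtain ⟨Q, hQ⟩ := measure_zero_mem_le h hU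
  have hpos : (0 : ℝ) < 1 / (8 * (Q + 1)) := by positivity
  refine lt_of_lt_of_le hpos (le_csInf ⟨1, by simp, fun μ hμ => one_mem_critSet U hμ⟩ ?_)
  rintro p ⟨hp, hperc⟩
  by_contra! hlt
  obtain ⟨μ, hμ, -⟩ := exists_isBernoulli hp
  have h1 : (1 : ENNReal) ≤ μ {ω | (0 : Site) ∈ bsClosure U (siteSet ω)} := by
    rw [← hperc μ hμ]
    refine measure_mono fun ω hω => ?_
    rw [mem_ofPred_eq, show bsClosure U (siteSet ω) = univ from hω]
    trivial
  have h2 : (Q * ENNReal.ofReal p : ENNReal) ≤ 8⁻¹ := by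
    rw [← ENNReal.ofReal_natCast, ← ENNReal.ofReal_mul (by positivity),
      ← ENNReal.ofReal_ofNat 8, ← ENNReal.ofReal_inv_of_pos (by norm_num)]
    refine ENNReal.ofReal_le_ofReal ?_
    rw [lt_div_iff₀ (by positivity)] at hlt
    nlinarith [hp.1]
  have h3 : (∑' k : ℕ, 2 * (Q * ENNReal.ofReal p) ^ (k + 1) : ENNReal) ≤ 2 * (8⁻¹ * 2) := by
    rw [ENNReal.tsum_mul_left]
    gcongr
    calc _ ≤ ∑' k : ℕ, (8⁻¹ : ENNReal) ^ (k + 1) := ENNReal.tsum_le_tsum fun k => by gcongr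
      _ = 8⁻¹ * (1 - 8⁻¹)⁻¹ := ENNReal.tsum_geometric_add_one _
      _ ≤ 8⁻¹ * 2 := by
        gcongr
        rw [ENNReal.inv_le_iff_inv_le]
        refine ENNReal.le_sub_of_add_le_left (by simp) ?_
        calc (8⁻¹ + 2⁻¹ : ENNReal) ≤ 2⁻¹ + 2⁻¹ := by gcongr; norm_num
          _ = 1 := ENNReal.inv_two_add_inv_two
  have h4 : (2 * (8⁻¹ * 2) : ENNReal) < 1 := by
    rw [show (2 * (8⁻¹ * 2) : ENNReal) = 4 * 8⁻¹ by ring, ← div_eq_mul_inv, ENNReal.div_lt_iff] <;> norm_num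
  exact absurd (h1.trans ((hQ p μ hμ).trans h3)) (not_le.2 h4)

end Bernoulli

section Rationalise

variable {U : Finset (Finset Site)}

/-- The cross product of two plane vectors. -/
def cross (u v : ℝ × ℝ) : ℝ := u.1 * v.2 - u.2 * v.1

/-- The unstable vectors of `U`. -/
def unstableCone (U : Finset (Finset Site)) : Set (ℝ × ℝ) :=
  {u | ∃ X ∈ U, ∀ y ∈ X, pairing y u < 0}

theorem not_isStableDir_iff {u : ℝ × ℝ} : ¬ IsStableDir U u ↔ u ∈ unstableCone U := by
  rw [isStableDir_iff]
  push Not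
  rfl

theorem smul_mem_unstableCone {u : ℝ × ℝ} (hu : u ∈ unstableCone U) {r : ℝ} (hr : 0 < r) :
    r • u ∈ unstableCone U := by
  obtain ⟨X, hX, h⟩ := hu
  exact ⟨X, hX, fun y hy => by rw [pairing_smul]; exact mul_neg_of_pos_of_neg hr (h y hy)⟩

theorem exists_polar {θ : ℝ} {u : ℝ × ℝ} (hu : 0 < cross (dir θ) u) :
    ∃ r φ : ℝ, 0 < r ∧ θ < φ ∧ φ < θ + Real.pi ∧ u = r • dir φ := by
  set z : ℂ := ⟨u.1 * Real.cos θ + u.2 * Real.sin θ, u.2 * Real.cos θ - u.1 * Real.sin θ⟩ with hz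
  have him : 0 < z.im := by
    simp only [cross, dir] at hu
    simp only [hz]
    linarith
  have h0 : 0 < ‖z‖ := norm_pos_iff.2 fun h => by simp [h] at him
  have h1 := Complex.norm_mul_cos_arg z
  have h2 := Complex.norm_mul_sin_arg z
  have h3 : 0 < Real.sin z.arg := by
    by_contra! h
    nlinarith
  have h4 : 0 < z.arg := by
    by_contra! h
    linarith [Real.sin_nonpos_of_nonpos_of_neg_pi_le h (Complex.neg_pi_lt_arg z).le]
  have h5 : z.arg < Real.pi := by
    refine lt_of_le_of_ne (Complex.arg_le_pi z) fun h => ?_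
    rw [h, Real.sin_pi] at h3
    exact lt_irrefl _ h3
  refine ⟨‖z‖, θ + z.arg, h0, by linarith, by linarith, ?_⟩
  have hsc := Real.sin_sq_add_cos_sq θ
  ext
  · simp only [dir, Prod.smul_fst, smul_eq_mul, Real.cos_add]
    simp only [hz] at h1 h2
    linear_combination (-Real.cos θ) * h1 + Real.sin θ * h2 - u.1 * hsc
  · simp only [dir, Prod.smul_snd, smul_eq_mul, Real.sin_add]
    simp only [hz] at h1 h2
    linear_combination (-Real.sin θ) * h1 - Real.cos θ * h2 - u.2 * hsc

theorem exists_subset_closure_of_not_subcritical (h : ¬ Subcritical U) :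
    ∃ e : ℝ × ℝ, e ≠ 0 ∧ {u | 0 < cross e u} ⊆ closure (unstableCone U) := by
  simp only [Subcritical, not_forall, not_exists] at h
  obtain ⟨θ, hθ⟩ := h
  refine ⟨dir θ, fun h0 => ?_, fun u hu => ?_⟩
  · have h1 := congrArg Prod.fst h0
    have h2 := congrArg Prod.snd h0
    simp only [dir, Prod.fst_zero, Prod.snd_zero] at h1 h2
    have := Real.sin_sq_add_cos_sq θ
    rw [h1, h2] at this
    norm_num at this
  · obtain ⟨r, φ, hr, h1, h2, rfl⟩ := exists_polar hu
    rw [mem_closure_iff]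
    intro O hO hφO
    have hcont : Continuous fun ψ : ℝ => r • dir ψ := by unfold dir; fun_prop
    obtain ⟨ε, hε, hball⟩ := Metric.isOpen_iff.1 (hO.preimage hcont) φ hφO
    have h3 : ¬ IsStronglyStableAngle U φ := fun h => hθ φ ⟨h1, h2, h⟩
    simp only [IsStronglyStableAngle, not_exists, not_and, not_forall] at h3
    obtain ⟨ψ, hψ, h4⟩ := h3 ε hε
    exact ⟨r • dir ψ, hball (by rwa [Metric.mem_ball, Real.dist_eq]),
      smul_mem_unstableCone (not_isStableDir_iff.1 h4) hr⟩

/-- A lattice site as a vector of the plane. -/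
def toPlane (x : Site) : ℝ × ℝ := (x.1, x.2)

theorem continuous_cross (e : ℝ × ℝ) : Continuous (cross e) := by
  unfold cross; fun_prop

theorem exists_int_smul_of_dense {O : Set (ℝ × ℝ)} (hO : IsOpen O) (hne : O.Nonempty) :
    ∃ (α : Site) (v : ℝ × ℝ) (r : ℝ), 0 < r ∧ v ∈ O ∧ toPlane α = r • v := by
  have hd : DenseRange (Prod.map ((↑) : ℚ → ℝ) ((↑) : ℚ → ℝ)) :=
    Rat.denseRange_cast.prodMap Rat.denseRange_cast
  obtain ⟨⟨s, t⟩, hst⟩ := hd.exists_mem_open hO hne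
  have hs : (s : ℝ) * s.den = s.num := by exact_mod_cast Rat.mul_den_eq_num s
  have ht : (t : ℝ) * t.den = t.num := by exact_mod_cast Rat.mul_den_eq_num t
  refine ⟨(s.num * t.den, t.num * s.den), _, s.den * t.den, ?_, hst, ?_⟩
  · have := s.den_pos; have := t.den_pos; positivity
  · ext
    · simp only [toPlane, Prod.map, Prod.smul_fst, smul_eq_mul]
      push_cast
      rw [← hs]; ring
    · simp only [toPlane, Prod.map, Prod.smul_snd, smul_eq_mul]
      push_cast
      rw [← ht]; ring

theorem exists_int_subset_closure (hU : IsUpdateFamily U) {e : ℝ × ℝ} (he : e ≠ 0)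
    (h : {u | 0 < cross e u} ⊆ closure (unstableCone U)) :
    ∃ α : Site, α ≠ 0 ∧ {u | 0 < cross (toPlane α) u} ⊆ closure (unstableCone U) := by
  by_cases hy : ∃ X ∈ U, ∃ y ∈ X, pairing y e = 0
  · obtain ⟨X, hX, y, hyX, hye⟩ := hy
    have hy0 : y ≠ 0 := fun h0 => (hU.2 X hX).2 (h0 ▸ hyX)
    obtain ⟨r, hr⟩ : ∃ r : ℝ, e = r • toPlane (-y.2, y.1) := by
      simp only [pairing] at hye
      by_cases hy1 : (y.1 : ℝ) = 0
      · have hy2 : (y.2 : ℝ) ≠ 0 := fun h => hy0 (Prod.ext (by exact_mod_cast hy1) (by exact_mod_cast h))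
        rw [hy1, zero_mul, zero_add] at hye
        have he2 := (mul_eq_zero.1 hye).resolve_left hy2
        refine ⟨-e.1 / y.2, Prod.ext ?_ ?_⟩
        · simp [toPlane]; field_simp
        · simp [toPlane, hy1, he2]
      · refine ⟨e.2 / y.1, Prod.ext ?_ ?_⟩
        · simp [toPlane]; field_simp; linarith
        · simp [toPlane]; field_simp
    have hr0 : r ≠ 0 := fun h0 => he (by rw [hr, h0, zero_smul])
    have hc : ∀ u, cross e u = r * cross (toPlane (-y.2, y.1)) u := fun u => by
      rw [hr]; simp only [cross, Prod.smul_fst, Prod.smul_snd, smul_eq_mul]; ring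
    have hyy : (-y.2, y.1) ≠ (0 : Site) := fun h0 => hy0 (by
      rw [Prod.ext_iff] at h0 ⊢
      simp only [Prod.fst_zero, Prod.snd_zero, neg_eq_zero] at h0 ⊢
      exact h0.symm)
    rcases lt_or_gt_of_ne hr0 with hr' | hr'
    · refine ⟨-(-y.2, y.1), neg_ne_zero.2 hyy, fun u hu => h ?_⟩
      rw [mem_ofPred_eq, hc]
      have : cross (toPlane (-(-y.2, y.1))) u = - cross (toPlane (-y.2, y.1)) u := by
        simp only [cross, toPlane, Prod.fst_neg, Prod.snd_neg]; push_cast; ring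
      rw [mem_ofPred_eq, this] at hu
      nlinarith
    · refine ⟨(-y.2, y.1), hyy, fun u hu => h ?_⟩
      rw [mem_ofPred_eq, hc]
      exact mul_pos hr' hu
  · push Not at hy
    set O : ℝ → Set (ℝ × ℝ) := fun σ => {v | ∀ X ∈ U, ∀ y ∈ X, 0 < σ * pairing y e * pairing y v}
      with hO
    have hOopen : ∀ σ, IsOpen (O σ) := fun σ => by
      have : O σ = ⋂ X ∈ U, ⋂ y ∈ X, {v | 0 < σ * pairing y e * pairing y v} := by
        ext; simp [hO]
      rw [this]
      exact isOpen_biInter_finset fun X _ => isOpen_biInter_finset fun y _ =>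
        isOpen_lt continuous_const (continuous_const.mul (continuous_pairing y))
    have heO : ∀ σ : ℝ, σ ≠ 0 → σ • e ∈ O σ := fun σ hσ X hX y hy' => by
      rw [pairing_smul]
      have := hy X hX y hy'
      have h2 : 0 < (σ * pairing y e) ^ 2 := by positivity
      linarith
    obtain ⟨α, v, r, hr, hv, hα⟩ := exists_int_smul_of_dense (hOopen 1) ⟨_, heO 1 one_ne_zero⟩
    have hαO : ∀ X ∈ U, ∀ y ∈ X, 0 < pairing y e * pairing y (toPlane α) := fun X hX y hy' => by
      rw [hα, pairing_smul]
      have := hv X hX y hy'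
      rw [one_mul] at this
      rw [mul_left_comm]
      positivity
    obtain ⟨X₀, hX₀⟩ := hU.1
    obtain ⟨y₀, hy₀⟩ := (hU.2 X₀ hX₀).1
    have hα0 : α ≠ 0 := by
      rintro rfl
      have := hαO X₀ hX₀ y₀ hy₀
      simp [toPlane, pairing] at this
    refine ⟨α, hα0, fun u hu => ?_⟩
    by_cases hu' : 0 < cross e u
    · exact h hu'
    rw [mem_ofPred_eq] at hu
    push Not at hu'
    set a := toPlane α with ha
    -- the identity expressing `u` through `e` and `a`
    have hid : ∀ y : Site, cross a e * pairing y u = cross a u * pairing y e - cross e u * pairing y a := by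
      intro y; simp only [cross, pairing]; ring
    set σ := cross a e with hσ
    by_cases hσ0 : σ = 0
    · exfalso
      have h1 := hid y₀
      rw [hσ0, zero_mul] at h1
      have h2 := hαO X₀ hX₀ y₀ hy₀
      have h3 := hy X₀ hX₀ y₀ hy₀
      have h4 : 0 < (pairing y₀ e) ^ 2 := by positivity
      have h5 : 0 = cross a u * pairing y₀ e ^ 2 + -cross e u * (pairing y₀ e * pairing y₀ a) := by
        linear_combination pairing y₀ e * h1
      linarith [mul_pos hu h4, mul_nonneg (neg_nonneg.2 hu') h2.le]
    · -- `σ • e` is a limit of unstable vectors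
      have hmem : σ • e ∈ closure (unstableCone U) := by
        have : σ • e ∈ closure {u | 0 < cross e u} := by
          have hne : ∃ n : ℝ × ℝ, 0 < cross e n := by
            refine ⟨(-e.2, e.1), ?_⟩
            simp only [cross]
            have : e.1 ≠ 0 ∨ e.2 ≠ 0 := by
              by_contra! hc
              exact he (Prod.ext hc.1 hc.2)
            rcases this with h1 | h1
            · have : 0 < e.1 ^ 2 := by positivity
              nlinarith [sq_nonneg e.2]
            · have : 0 < e.2 ^ 2 := by positivity
              nlinarith [sq_nonneg e.1]
          obtain ⟨n, hn⟩ := hne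
          have ht : Filter.Tendsto (fun t : ℝ => σ • e + t • n) (nhdsWithin 0 (Ioi 0))
              (nhds (σ • e)) := by
            have : Continuous fun t : ℝ => σ • e + t • n := by fun_prop
            simpa using (this.tendsto 0).mono_left nhdsWithin_le_nhds
          refine mem_closure_of_tendsto ht ?_
          filter_upwards [self_mem_nhdsWithin] with t ht
          have : cross e (σ • e + t • n) = t * cross e n := by
            simp only [cross, Prod.fst_add, Prod.snd_add, Prod.smul_fst, Prod.smul_snd, smul_eq_mul]
            ring
          rw [this]
          exact mul_pos ht hn
        exact closure_minimal h isClosed_closure this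
      obtain ⟨v, hvO, X, hX, hvX⟩ := mem_closure_iff.1 hmem _ (hOopen σ) (heO σ hσ0)
      refine subset_closure ⟨X, hX, fun y hy' => ?_⟩
      have h1 := hvO X hX y hy'
      have h2 := hvX y hy'
      have h3 : σ * pairing y e < 0 := by
        by_contra! hc
        nlinarith
      have h4 := hαO X hX y hy'
      have h5 := hid y
      have h7 : σ ^ 2 * pairing y u = cross a u * (σ * pairing y e) + (- cross e u) * (σ * pairing y a) := by
        linear_combination σ * h5
      have h8 : σ * pairing y a < 0 := by
        by_contra! hc
        have : 0 < pairing y e ^ 2 := by have := hy X hX y hy'; positivity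
        nlinarith [mul_pos (neg_pos.2 h3) h4, mul_nonneg hc this.le]
      have h9 : 0 < σ ^ 2 := by positivity
      have h10 : cross a u * (σ * pairing y e) < 0 := mul_neg_of_pos_of_neg hu h3
      have h11 : (- cross e u) * (σ * pairing y a) ≤ 0 :=
        mul_nonpos_of_nonneg_of_nonpos (by linarith) h8.le
      by_contra! hc
      nlinarith [mul_nonneg h9.le hc]

theorem exists_basis_of_not_subcritical (hU : IsUpdateFamily U) (h : ¬ Subcritical U) :
    ∃ α β : Site, α.1 * β.2 - α.2 * β.1 = 1 ∧ ∀ s t : ℝ, s < t → ∃ c ∈ Ioo s t, ∃ X ∈ U,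
      ∀ y ∈ X, pairing y (toPlane β) + c * pairing y (toPlane α) < 0 := by
  obtain ⟨e, he, h1⟩ := exists_subset_closure_of_not_subcritical h
  obtain ⟨γ, hγ, h2⟩ := exists_int_subset_closure hU he h1
  have hg : 0 < Int.gcd γ.1 γ.2 := by
    rw [Int.gcd_pos_iff]
    by_contra! hc
    exact hγ (Prod.ext hc.1 hc.2)
  obtain ⟨a, ha⟩ := Int.gcd_dvd_left γ.1 γ.2
  obtain ⟨b, hb⟩ := Int.gcd_dvd_right γ.1 γ.2
  have hbez := Int.gcd_eq_gcd_ab γ.1 γ.2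
  obtain ⟨g, hgdef⟩ : ∃ g : ℤ, g = (Int.gcd γ.1 γ.2 : ℤ) := ⟨_, rfl⟩
  have hg' : 0 < g := by rw [hgdef]; exact_mod_cast hg
  rw [← hgdef] at ha hb hbez
  have hdet : a * γ.1.gcdA γ.2 - b * -(γ.1.gcdB γ.2) = 1 := by
    apply mul_left_cancel₀ hg'.ne'
    linear_combination (-1 : ℤ) * hbez + (-Int.gcdA γ.1 γ.2) * ha + (-Int.gcdB γ.1 γ.2) * hb
  refine ⟨(a, b), (-(γ.1.gcdB γ.2), γ.1.gcdA γ.2), hdet, fun s t hst => ?_⟩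
  set α : ℝ × ℝ := toPlane (a, b) with hα
  set β : ℝ × ℝ := toPlane (-(γ.1.gcdB γ.2), γ.1.gcdA γ.2) with hβ
  have hdet' : cross α β = 1 := by
    simp only [cross, hα, hβ, toPlane]
    exact_mod_cast hdet
  have hcr : ∀ u, cross (toPlane γ) u = g * cross α u := fun u => by
    have e1 : (γ.1 : ℝ) = g * a := by exact_mod_cast ha
    have e2 : (γ.2 : ℝ) = g * b := by exact_mod_cast hb
    simp only [cross, toPlane, hα, e1, e2]; ring
  set m := (s + t) / 2 with hm
  have hmem : β + m • α ∈ closure (unstableCone U) := by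
    refine h2 ?_
    rw [mem_ofPred_eq, hcr]
    have : cross α (β + m • α) = cross α β := by
      simp only [cross, Prod.fst_add, Prod.snd_add, Prod.smul_fst, Prod.smul_snd, smul_eq_mul]; ring
    rw [this, hdet', mul_one]
    exact_mod_cast hg'
  have hO : IsOpen {v | 0 < cross α v ∧ s * cross α v < - cross β v ∧ - cross β v < t * cross α v} := by
    refine (isOpen_lt continuous_const (continuous_cross α)).inter
      ((isOpen_lt (continuous_const.mul (continuous_cross α)) (continuous_cross β).neg).inter
      (isOpen_lt (continuous_cross β).neg (continuous_const.mul (continuous_cross α))))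
  have hin : 0 < cross α (β + m • α) ∧ s * cross α (β + m • α) < - cross β (β + m • α) ∧
      - cross β (β + m • α) < t * cross α (β + m • α) := by
    have e1 : cross α (β + m • α) = cross α β := by
      simp only [cross, Prod.fst_add, Prod.snd_add, Prod.smul_fst, Prod.smul_snd, smul_eq_mul]; ring
    have e2 : - cross β (β + m • α) = m * cross α β := by
      simp only [cross, Prod.fst_add, Prod.snd_add, Prod.smul_fst, Prod.smul_snd, smul_eq_mul]; ring
    rw [e1, e2, hdet']
    refine ⟨one_pos, ?_, ?_⟩ <;> linarith
  obtain ⟨v, ⟨hv1, hv2, hv3⟩, X, hX, hv⟩ := mem_closure_iff.1 hmem _ hO hin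
  refine ⟨- cross β v / cross α v, ⟨(lt_div_iff₀ hv1).2 hv2, (div_lt_iff₀ hv1).2 hv3⟩, X, hX,
    fun y hy => ?_⟩
  have hid : pairing y v = cross α v * (pairing y β + - cross β v / cross α v * pairing y α) := by
    field_simp
    have : pairing y v * cross α β = pairing y β * cross α v - pairing y α * cross β v := by
      simp only [pairing, cross]; ring
    rw [hdet'] at this
    linarith
  have := hv y hy
  rw [hid] at this
  by_contra! hc
  nlinarith
end Rationalise

section Frame

/-- The linear functional of slope `s`. -/
def slopeForm (s : ℝ) (x : Site) : ℝ := x.2 + s * x.1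

theorem slopeForm_add (s : ℝ) (x y : Site) :
    slopeForm s (x + y) = slopeForm s x + slopeForm s y := by
  simp only [slopeForm, Prod.fst_add, Prod.snd_add]; push_cast; ring

theorem slopeForm_zsmul (s : ℝ) (c : ℤ) (x : Site) : slopeForm s (c • x) = c * slopeForm s x := by
  simp only [slopeForm, Prod.smul_fst, Prod.smul_snd, smul_eq_mul]; push_cast; ring

/-- A rule which can be used on the side of slope `s` of a droplet whose slopes are `Sl`, on the
half of the side lying in the direction given by the sign `ε`. -/
def SideRule (ε : ℝ) (Sl : Finset ℝ) (s : ℝ) (X : Finset Site) : Prop :=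
  ∀ y ∈ X, slopeForm s y ≤ 0 ∧ (slopeForm s y = 0 → ε * y.1 < 0) ∧
    (∀ t ∈ Sl, ε * s < ε * t → (∀ u ∈ Sl, ε * s < ε * u → ε * t ≤ ε * u) → slopeForm t y ≤ 0) ∧
    ((∀ t ∈ Sl, ε * t ≤ ε * s) → ε * y.1 ≤ 0)

/-- Slopes, growth rates and rules out of which growing droplets are built. -/
structure IsFrame (U : Finset (Finset Site)) (Sl : Finset ℝ) (T S δ : ℝ) (r : ℕ) : Prop where
  nonempty : Sl.Nonempty
  delta_pos : 0 < δ
  delta_le : δ ≤ 1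
  one_le : 1 ≤ S
  rate : S ^ 4 + 2 * S ^ 2 + 1 ≤ T
  bound : ∀ s ∈ Sl, |s| + 8 * δ ≤ S
  gap : ∀ s ∈ Sl, ∀ t ∈ Sl, s < t → s + 8 * δ ≤ t
  lattice : ∀ s ∈ Sl, ∃ w : Site, 0 < w.1 ∧ slopeForm s w = 0 ∧
    ∀ y, slopeForm s y = 0 → ∃ c : ℤ, y = c • w
  range : ∀ X ∈ U, ∀ y ∈ X, |y.1| ≤ (r : ℤ) ∧ |y.2| ≤ (r : ℤ)
  rule : ∀ ε : ℝ, ε = 1 ∨ ε = -1 → ∀ s ∈ Sl, ∃ X ∈ U, SideRule ε Sl s X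

variable {U : Finset (Finset Site)}

theorem exists_primitive_of_rat (q : ℚ) : ∃ w : Site, 0 < w.1 ∧ slopeForm q w = 0 ∧
    ∀ y, slopeForm q y = 0 → ∃ c : ℤ, y = c • w := by
  have hq : (q : ℝ) * q.den = q.num := by exact_mod_cast Rat.mul_den_eq_num q
  have hd : (0 : ℤ) < q.den := by exact_mod_cast q.den_pos
  have hd' : (0 : ℝ) < q.den := by exact_mod_cast q.den_pos
  refine ⟨(q.den, -q.num), hd, ?_, fun y hy => ?_⟩
  · simp only [slopeForm]
    push_cast
    linarith
  · have h1 : (q.den : ℤ) * y.2 = -(q.num * y.1) := by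
      have : (q.den : ℝ) * y.2 = -(q.num * y.1) := by
        rw [← hq]
        simp only [slopeForm] at hy
        linear_combination (q.den : ℝ) * hy
      exact_mod_cast this
    have hcop : IsCoprime (q.den : ℤ) q.num := by
      rw [Int.isCoprime_iff_nat_coprime]
      simpa [Nat.coprime_comm] using q.reduced
    obtain ⟨c, hc⟩ : (q.den : ℤ) ∣ y.1 :=
      hcop.dvd_of_dvd_mul_left (by rw [← dvd_neg, ← h1]; exact dvd_mul_right _ _)
    refine ⟨c, Prod.ext ?_ ?_⟩
    · simp [hc, mul_comm]
    · apply mul_left_cancel₀ hd.ne'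
      rw [h1, hc]
      simp
      ring

theorem exists_sideRule {Sl : Finset ℝ}
    (hP : ∀ s t : ℝ, s < t → ∃ c ∈ Ioo s t, ∃ X ∈ U, ∀ y ∈ X, slopeForm c y < 0)
    (hroot : ∀ X ∈ U, ∀ y ∈ X, ∀ s, y.1 ≠ 0 → slopeForm s y = 0 → s ∈ Sl) {ε : ℝ}
    (hε : ε = 1 ∨ ε = -1) (s : ℝ) : ∃ X ∈ U, SideRule ε Sl s X := by
  have hεε : ε * ε = 1 := by rcases hε with rfl | rfl <;> norm_num
  have hP' : ∀ s t : ℝ, s < t → ∃ c ∈ Ioo s t, ∃ X ∈ U, ∀ y ∈ X, slopeForm (ε * c) y < 0 := by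
    intro s t hst
    rcases hε with rfl | rfl
    · simpa using hP s t hst
    · obtain ⟨c, hc, h⟩ := hP (-t) (-s) (by linarith)
      exact ⟨-c, ⟨by linarith [hc.2], by linarith [hc.1]⟩, by simpa using h⟩
  have hf : ∀ (t : ℝ) (y : Site), slopeForm t y = y.2 + (ε * t) * (ε * y.1) := fun t y => by
    simp only [slopeForm]; linear_combination (-t * y.1) * hεε
  -- a sign change of `t ↦ slopeForm t y` produces an element of `Sl`
  have hsign : ∀ X ∈ U, ∀ y ∈ X, ∀ a b : ℝ, a < b → slopeForm (ε * a) y < 0 →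
      0 < slopeForm (ε * b) y ∨ 0 < ε * (y.1 : ℝ) →
      ∃ u ∈ Sl, a < ε * u ∧ (0 < slopeForm (ε * b) y → ε * u < b) := by
    intro X hX y hy a b hab h1 h2
    have e : ∀ t : ℝ, slopeForm (ε * t) y = y.2 + t * (ε * y.1) := fun t => by
      rw [hf]; linear_combination (t * ε * y.1) * hεε
    have hpos : 0 < ε * (y.1 : ℝ) := by
      rcases h2 with h2 | h2
      · rw [e] at h1 h2
        by_contra! hc
        nlinarith
      · exact h2
    have hroot' : slopeForm (ε * (-y.2 / (ε * y.1))) y = 0 := by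
      rw [hf, ← mul_assoc ε ε, hεε, one_mul, div_mul_cancel₀ _ hpos.ne']; ring
    refine ⟨_, hroot X hX y hy _ (fun h0 => by simp [h0] at hpos) hroot', ?_, fun h3 => ?_⟩
    · rw [← mul_assoc, hεε, one_mul, lt_div_iff₀ hpos]
      rw [e] at h1; linarith
    · rw [← mul_assoc, hεε, one_mul, div_lt_iff₀ hpos]
      rw [e] at h3; linarith
  have hsign' : ∀ X ∈ U, ∀ y ∈ X, ∀ a b : ℝ, a < b → 0 < slopeForm (ε * a) y →
      slopeForm (ε * b) y < 0 → ∃ u ∈ Sl, a < ε * u ∧ ε * u < b := by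
    intro X hX y hy a b hab h1 h2
    have e : ∀ t : ℝ, slopeForm (ε * t) y = y.2 + t * (ε * y.1) := fun t => by
      rw [hf]; linear_combination (t * ε * y.1) * hεε
    have hneg : ε * (y.1 : ℝ) < 0 := by
      rw [e] at h1 h2
      by_contra! hc
      nlinarith
    have hne : ε * (y.1 : ℝ) ≠ 0 := hneg.ne
    have hroot' : slopeForm (ε * (-y.2 / (ε * y.1))) y = 0 := by
      rw [hf, ← mul_assoc ε ε, hεε, one_mul, div_mul_cancel₀ _ hne]; ring
    refine ⟨_, hroot X hX y hy _ (fun h0 => by simp [h0] at hneg) hroot', ?_, ?_⟩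
    · rw [← mul_assoc, hεε, one_mul, lt_div_iff_of_neg hneg]
      rw [e] at h1; linarith
    · rw [← mul_assoc, hεε, one_mul, div_lt_iff_of_neg hneg]
      rw [e] at h2; linarith
  have hcancel : ∀ t, ε * (ε * t) = t := fun t => by rw [← mul_assoc, hεε, one_mul]
  have hzero : ∀ (c : ℝ) (y : Site), ε * s < c → slopeForm (ε * c) y < 0 → slopeForm s y = 0 →
      ε * (y.1 : ℝ) < 0 := by
    intro c y hc h1 h2
    rw [hf, hcancel] at h1
    rw [hf] at h2
    by_contra! hcon
    nlinarith
  by_cases hnext : ∃ t ∈ Sl, ε * s < ε * t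
  · obtain ⟨t, ht, hmin⟩ := (Sl.filter fun t => ε * s < ε * t).exists_min_image (fun t => ε * t)
      (by obtain ⟨t, ht, h⟩ := hnext; exact ⟨t, Finset.mem_filter.2 ⟨ht, h⟩⟩)
    simp only [Finset.mem_filter] at ht hmin
    obtain ⟨c, hc, X, hX, hXc⟩ := hP' (ε * s) (ε * t) ht.2
    refine ⟨X, hX, fun y hy => ⟨?_, hzero c y hc.1 (hXc y hy), fun t' ht' h1 h2 => ?_, fun h => ?_⟩⟩
    · by_contra! hcon
      obtain ⟨u, hu, h1, h2⟩ := hsign' X hX y hy (ε * s) c hc.1 (by rwa [hcancel]) (hXc y hy)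
      linarith [hmin u ⟨hu, h1⟩, hc.2]
    · have htt : ε * t' = ε * t := le_antisymm (h2 t ht.1 ht.2) (hmin t' ⟨ht', h1⟩)
      have htt' : t' = t := by rw [← hcancel t', htt, hcancel]
      rw [htt']
      by_contra! hcon
      have hcon' : 0 < slopeForm (ε * (ε * t)) y := by rwa [hcancel]
      obtain ⟨u, hu, h3, h4⟩ := hsign X hX y hy c (ε * t) hc.2 (hXc y hy) (Or.inl hcon')
      linarith [hmin u ⟨hu, hc.1.trans h3⟩, h4 hcon']
    · exact absurd (h t ht.1) (not_le.2 ht.2)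
  · push Not at hnext
    obtain ⟨c, hc, X, hX, hXc⟩ := hP' (ε * s) (ε * s + 1) (by linarith)
    refine ⟨X, hX, fun y hy => ⟨?_, hzero c y hc.1 (hXc y hy), fun t' ht' h1 _ => ?_, fun h => ?_⟩⟩
    · by_contra! hcon
      obtain ⟨u, hu, h1, h2⟩ := hsign' X hX y hy (ε * s) c hc.1 (by rwa [hcancel]) (hXc y hy)
      linarith [hnext u hu]
    · exact absurd (hnext t' ht') (not_le.2 h1)
    · by_contra! hcon
      obtain ⟨u, hu, h3, -⟩ := hsign X hX y hy c (c + 1) (by linarith) (hXc y hy) (Or.inr hcon)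
      linarith [hnext u hu, hc.1]

theorem exists_isFrame
    (hP : ∀ s t : ℝ, s < t → ∃ c ∈ Ioo s t, ∃ X ∈ U, ∀ y ∈ X, slopeForm c y < 0) :
    ∃ Sl T S δ r, IsFrame U Sl T S δ r := by
  classical
  set Q : Finset ℚ := insert 0 ((U.biUnion id).image fun y => -(y.2 : ℚ) / y.1) with hQ
  set Sl : Finset ℝ := Q.image (↑) with hSl
  have hroot : ∀ X ∈ U, ∀ y ∈ X, ∀ s, y.1 ≠ 0 → slopeForm s y = 0 → s ∈ Sl := by
    intro X hX y hy s hy1 hs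
    have hy1' : (y.1 : ℝ) ≠ 0 := by exact_mod_cast hy1
    refine Finset.mem_image.2 ⟨-(y.2 : ℚ) / y.1, Finset.mem_insert_of_mem (Finset.mem_image.2
      ⟨y, Finset.mem_biUnion.2 ⟨X, hX, hy⟩, rfl⟩), ?_⟩
    push_cast
    rw [div_eq_iff hy1']
    simp only [slopeForm] at hs
    linarith
  have hgap : ∀ᶠ δ : ℝ in nhdsWithin 0 (Ioi 0), ∀ s ∈ Sl, ∀ t ∈ Sl, s < t → s + 8 * δ ≤ t := by
    simp only [Filter.eventually_all_finset]
    intro s _ t _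
    by_cases hst : s < t
    · have : Filter.Tendsto (fun δ : ℝ => s + 8 * δ) (nhdsWithin 0 (Ioi 0)) (nhds s) := by
        have hc : Continuous fun δ : ℝ => s + 8 * δ := by fun_prop
        simpa using (hc.tendsto 0).mono_left nhdsWithin_le_nhds
      filter_upwards [this.eventually_lt_const hst] with δ hδ _ using hδ.le
    · exact Filter.Eventually.of_forall fun δ h => absurd h hst
  obtain ⟨δ, hδ, hδ0, hδ1⟩ := (hgap.and (Ioc_mem_nhdsGT (zero_lt_one (α := ℝ)))).exists
  have hbound : ∀ᶠ S : ℝ in Filter.atTop, ∀ s ∈ Sl, |s| + 8 * δ ≤ S := by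
    simp only [Filter.eventually_all_finset]
    exact fun s _ => Filter.eventually_ge_atTop _
  obtain ⟨S, hS, hS1⟩ := (hbound.and (Filter.eventually_ge_atTop 1)).exists
  have hrange : ∀ᶠ r : ℕ in Filter.atTop, ∀ X ∈ U, ∀ y ∈ X, |y.1| ≤ (r : ℤ) ∧ |y.2| ≤ (r : ℤ) := by
    simp only [Filter.eventually_all_finset]
    intro X _ y _
    filter_upwards [Filter.eventually_ge_atTop (max y.1.natAbs y.2.natAbs)] with r hr
    have := le_max_left y.1.natAbs y.2.natAbs
    have := le_max_right y.1.natAbs y.2.natAbs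
    rw [Int.abs_eq_natAbs, Int.abs_eq_natAbs]
    omega
  obtain ⟨r, hr⟩ := hrange.exists
  refine ⟨Sl, _, S, δ, r, ⟨⟨0, Finset.mem_image.2 ⟨0, by simp [hQ], by simp⟩⟩, hδ0, hδ1, hS1, le_rfl,
    hS, hδ, fun s hs => ?_, hr, fun ε hε s hs => exists_sideRule hP hroot hε s⟩⟩
  obtain ⟨q, -, rfl⟩ := Finset.mem_image.1 hs
  exact exists_primitive_of_rat q

end Frame

section Slack

/-- Height of the side of slope `s` of the droplet of size `N`. -/
noncomputable def height (T N s : ℝ) : ℝ := T * (N + s ^ 2 / (4 * T)) ^ 2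

theorem height_eq {T : ℝ} (hT : 0 < T) (N s : ℝ) :
    height T N s = T * N ^ 2 + N * s ^ 2 / 2 + s ^ 4 / (16 * T) := by
  unfold height; field_simp; ring

theorem abs_height_sub_le {S T s t : ℝ} (N : ℝ) (hT : S ^ 4 + 2 * S ^ 2 + 1 ≤ T) (hs : |s| ≤ S)
    (ht : |t| ≤ S) : |height T N t - height T N s - N * (t ^ 2 - s ^ 2) / 2| ≤ 1 := by
  have hT0 : 0 < T := by nlinarith [sq_nonneg S, sq_nonneg (S ^ 2)]
  rw [height_eq hT0, height_eq hT0]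
  have h4 : ∀ u : ℝ, |u| ≤ S → 0 ≤ u ^ 4 / (16 * T) ∧ u ^ 4 / (16 * T) ≤ 1 := fun u hu => by
    have : u ^ 4 ≤ S ^ 4 := by
      have := pow_le_pow_left₀ (abs_nonneg u) hu 4
      rwa [Even.pow_abs (by decide)] at this
    refine ⟨by positivity, (div_le_one (by positivity)).2 ?_⟩
    nlinarith [sq_nonneg S]
  have h1 := h4 s hs
  have h2 := h4 t ht
  rw [abs_le]
  constructor <;> linarith [h1.1, h1.2, h2.1, h2.2]

variable {S δ N r hs ht s t a ya yb : ℝ}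

theorem mul_le_of_abs_le (hS : |t| ≤ S) (hya : |ya| ≤ r) (hyb : |yb| ≤ r) :
    |yb + t * ya| ≤ r * (1 + S) := by
  calc |yb + t * ya| ≤ |yb| + |t * ya| := abs_add_le _ _
    _ = |yb| + |t| * |ya| := by rw [abs_mul]
    _ ≤ r + S * r := by
      have : 0 ≤ |t| := abs_nonneg t
      have : 0 ≤ |ya| := abs_nonneg ya
      nlinarith
    _ = r * (1 + S) := by ring

/-- Moving far enough from a side towards slopes below, the constraint has slack. -/
theorem slack_below {v : ℝ} (hδ : 0 < δ) (hN : r * (1 + S) + 2 ≤ δ ^ 2 * N) (hr : 0 ≤ r)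
    (hS : 1 ≤ S) (hst : t + 8 * δ ≤ s)
    (hh : |ht - hs - N * (t ^ 2 - s ^ 2) / 2| ≤ 1) (hv : v ≤ hs) (ha : N * (s - δ) ≤ a)
    (hy : |yb + t * ya| ≤ r * (1 + S)) :
    v + (t - s) * a + (yb + t * ya) < ht := by
  have h1 := (abs_le.1 hh).1
  have h2 := (abs_le.1 hy).2
  have hN0 : 0 < N := by
    have : 0 < δ ^ 2 * N := by nlinarith
    exact (pos_iff_pos_of_mul_pos this).1 (by positivity)
  have h3 : (s - t) * (N * (s - δ)) ≤ (s - t) * a := by gcongr; linarith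
  have h4 : 8 * δ * (3 * δ) ≤ (s - t) * ((s - t) / 2 - δ) := by
    apply mul_le_mul <;> linarith
  nlinarith [mul_le_mul_of_nonneg_left h4 hN0.le]

theorem side_end_le (hδ : 0 < δ) (hst : s + 8 * δ ≤ t)
    (hh : |ht - hs - N * (t ^ 2 - s ^ 2) / 2| ≤ 1) (ha : hs + (t - s) * a ≤ ht) :
    8 * δ * a ≤ 8 * δ * (N * (t + s) / 2) + 1 := by
  have h1 := (abs_le.1 hh).2
  by_contra! hc
  have h2 : 0 < a - N * (t + s) / 2 := by
    by_contra! h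
    nlinarith
  nlinarith

/-- Beyond the next side, the constraints have slack. -/
theorem slack_above {t' ht' : ℝ} (hδ : 0 < δ) (hN : r * (1 + S) + 2 ≤ δ ^ 2 * N) (hr : 0 ≤ r)
    (hS : 1 ≤ S) (hst' : s + 8 * δ ≤ t') (hst : t' + 8 * δ ≤ t)
    (hh' : |ht' - hs - N * (t' ^ 2 - s ^ 2) / 2| ≤ 1)
    (hh : |ht - ht' - N * (t ^ 2 - t' ^ 2) / 2| ≤ 1) (ha : hs + (t' - s) * a ≤ ht')
    (hy : |yb + t * ya| ≤ r * (1 + S)) :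
    hs + (t - s) * a + (yb + t * ya) < ht := by
  have h0 := side_end_le hδ hst' hh' ha
  have h1 := (abs_le.1 hh).1
  have h2 := (abs_le.1 hy).2
  have hN0 : 0 < N := by
    have : 0 < δ ^ 2 * N := by nlinarith
    exact (pos_iff_pos_of_mul_pos this).1 (by positivity)
  -- the slack at the side of slope `t`
  have h3 : 8 * δ * (N * (t + t') / 2 - a) ≥ 64 * (δ ^ 2 * N) - 1 := by
    nlinarith [mul_le_mul_of_nonneg_left (show 16 * δ ≤ t - s by linarith)
      (show 0 ≤ δ * N by positivity)]
  have h4 : 0 < N * (t + t') / 2 - a := by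
    by_contra! h
    nlinarith
  have h5 : 8 * δ * (N * (t + t') / 2 - a) ≤ (t - t') * (N * (t + t') / 2 - a) := by
    gcongr; linarith
  nlinarith

theorem width_le (hδ : 0 < δ) (hδ1 : δ ≤ 1) (hN : r * (1 + S) + 2 ≤ δ ^ 2 * N) (hr : 0 ≤ r)
    (hS : 1 ≤ S) (hst : s + 8 * δ ≤ t) (htS : t + 8 * δ ≤ S)
    (hh : |ht - hs - N * (t ^ 2 - s ^ 2) / 2| ≤ 1) (ha : hs + (t - s) * a ≤ ht) :
    a + r ≤ S * N := by
  have h0 := side_end_le hδ hst hh ha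
  have hN0 : 0 < N := by
    have : 0 < δ ^ 2 * N := by nlinarith
    exact (pos_iff_pos_of_mul_pos this).1 (by positivity)
  by_contra! hc
  have h1 : 8 * δ * (S * N) < 8 * δ * (a + r) := by gcongr
  have h2 : δ * N * (t + s + 16 * δ) ≤ δ * N * (2 * S) := by gcongr; linarith
  have h3 : δ * r ≤ r := by nlinarith
  nlinarith

end Slack

section Droplet

variable {U : Finset (Finset Site)} {Sl : Finset ℝ} {T S δ N : ℝ} {r : ℕ}

/-- The parabola-shaped region inside which droplets grow. -/
def parabola : Set Site := {x | x.1 ^ 2 ≤ x.2}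

theorem slopeForm_change {ε : ℝ} (hε : ε = 1 ∨ ε = -1) (s t : ℝ) (z : Site) :
    slopeForm t z = slopeForm s z + (ε * t - ε * s) * (ε * z.1) := by
  rcases hε with rfl | rfl <;> simp only [slopeForm] <;> ring

theorem IsFrame.abs_le (hF : IsFrame U Sl T S δ r) {s : ℝ} (hs : s ∈ Sl) : |s| ≤ S := by
  linarith [hF.bound s hs, hF.delta_pos]

theorem IsFrame.abs_range (hF : IsFrame U Sl T S δ r) {X : Finset Site} (hX : X ∈ U) {y : Site}
    (hy : y ∈ X) : |(y.1 : ℝ)| ≤ r ∧ |(y.2 : ℝ)| ≤ r := by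
  have := hF.range X hX y hy
  exact ⟨by exact_mod_cast this.1, by exact_mod_cast this.2⟩

theorem IsFrame.lt_of_large (hF : IsFrame U Sl T S δ r) (hN : r * (1 + S) + 2 ≤ δ ^ 2 * N) :
    (r : ℝ) + 2 ≤ N ∧ (r : ℝ) + 2 ≤ δ * N := by
  have h1 := hF.delta_pos
  have h2 := hF.delta_le
  have h3 := hF.one_le
  have hr : (0 : ℝ) ≤ r := r.cast_nonneg
  have hpos : 0 < δ ^ 2 * N := by nlinarith
  have hN0 : 0 < N := (pos_iff_pos_of_mul_pos hpos).1 (by positivity)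
  have h4 : δ * N ≤ N := by nlinarith
  have h5 : δ ^ 2 * N ≤ δ * N := by nlinarith [mul_pos h1 hN0]
  constructor <;> nlinarith

theorem IsFrame.abs_height_sub_le (hF : IsFrame U Sl T S δ r) {ε : ℝ} (hε : ε = 1 ∨ ε = -1)
    {s t : ℝ} (hs : s ∈ Sl) (ht : t ∈ Sl) :
    |height T N t - height T N s - N * ((ε * t) ^ 2 - (ε * s) ^ 2) / 2| ≤ 1 := by
  have := _root_.abs_height_sub_le N hF.rate (hF.abs_le hs) (hF.abs_le ht)
  rcases hε with rfl | rfl <;> simpa using this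

theorem IsFrame.sign_gap (hF : IsFrame U Sl T S δ r) {ε : ℝ} (hε : ε = 1 ∨ ε = -1)
    {s t : ℝ} (hs : s ∈ Sl) (ht : t ∈ Sl) (h : ε * s < ε * t) : ε * s + 8 * δ ≤ ε * t := by
  rcases hε with rfl | rfl
  · simpa using hF.gap s hs t ht (by simpa using h)
  · linarith [hF.gap t ht s hs (by linarith)]

theorem IsFrame.sign_bound (hF : IsFrame U Sl T S δ r) {ε : ℝ} (hε : ε = 1 ∨ ε = -1)
    {s : ℝ} (hs : s ∈ Sl) : ε * s + 8 * δ ≤ S ∧ -S ≤ ε * s - 8 * δ := by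
  have h := hF.bound s hs
  have := neg_abs_le s
  have := le_abs_self s
  rcases hε with rfl | rfl <;> constructor <;> linarith

theorem abs_le_of_sign {ε a b : ℝ} (hε : ε = 1 ∨ ε = -1) (h1 : -b ≤ ε * a) (h2 : ε * a ≤ b) :
    |a| ≤ b := by
  rw [_root_.abs_le]
  rcases hε with rfl | rfl <;> constructor <;> linarith

theorem sign_mul_le_abs {ε : ℝ} (hε : ε = 1 ∨ ε = -1) (a : ℝ) : |ε * a| = |a| := by
  rcases hε with rfl | rfl <;> simp

theorem IsFrame.mem_parabola_of_side (hF : IsFrame U Sl T S δ r)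
    (hN : r * (1 + S) + 2 ≤ δ ^ 2 * N) {s : ℝ} (hs : s ∈ Sl) {y z : Site}
    (hy : |(y.2 : ℝ)| ≤ r) (hz : slopeForm s z = height T N s) (hza : |(z.1 : ℝ)| ≤ S * N)
    (hyz : |((y + z).1 : ℝ)| ≤ S * N) : y + z ∈ parabola := by
  obtain ⟨hN1, -⟩ := hF.lt_of_large hN
  have hr : (0 : ℝ) ≤ r := r.cast_nonneg
  have hS := hF.one_le
  have hT := hF.rate
  have hT0 : 0 < T := by nlinarith [sq_nonneg S, sq_nonneg (S ^ 2)]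
  have h1 : s * z.1 ≤ S * (S * N) := by
    calc s * z.1 ≤ |s * z.1| := le_abs_self _
      _ = |s| * |(z.1 : ℝ)| := abs_mul _ _
      _ ≤ S * (S * N) := mul_le_mul (hF.abs_le hs) hza (abs_nonneg _) (by linarith)
  have h2 := (_root_.abs_le.1 hy).1
  have h3 : T * N ^ 2 ≤ height T N s := by
    rw [height_eq hT0]
    have : 0 ≤ N * s ^ 2 / 2 + s ^ 4 / (16 * T) := by
      have : 0 ≤ N := by linarith
      positivity
    linarith
  have h4 : ((y + z).1 : ℝ) ^ 2 ≤ (S * N) ^ 2 := sq_le_sq' (by linarith [(_root_.abs_le.1 hyz).1])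
    (_root_.abs_le.1 hyz).2
  have h5 : (S ^ 4 + 2 * S ^ 2 + 1) * N ^ 2 ≤ T * N ^ 2 := by gcongr
  have h6 : S ^ 2 * N ≤ S ^ 2 * N ^ 2 := by
    have : N ≤ N ^ 2 := by nlinarith
    gcongr
  have h7 : N ≤ N ^ 2 := by nlinarith
  have h8 : 0 ≤ S ^ 4 * N ^ 2 := by positivity
  have h9 : (((y + z).1 : ℤ) : ℝ) ^ 2 ≤ ((y + z).2 : ℤ) := by
    simp only [slopeForm] at hz
    have : (((y + z).2 : ℤ) : ℝ) = y.2 + z.2 := by simp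
    rw [this]
    nlinarith
  show (y + z).1 ^ 2 ≤ (y + z).2
  exact_mod_cast h9

theorem IsFrame.side_step (hF : IsFrame U Sl T S δ r) (hN : r * (1 + S) + 2 ≤ δ ^ 2 * N)
    {ε : ℝ} (hε : ε = 1 ∨ ε = -1) {s : ℝ} (hs : s ∈ Sl) {X : Finset Site} (hX : X ∈ U)
    (hrule : SideRule ε Sl s X) {x z : Site} (hx : slopeForm s x = height T N s)
    (hz : slopeForm s z = height T N s) (hxle : ∀ t ∈ Sl, slopeForm t x ≤ height T N t)
    (hxw : |(x.1 : ℝ)| ≤ S * N) (hlo : N * (ε * s - δ) ≤ ε * z.1) (hzx : ε * z.1 ≤ ε * x.1)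
    {y : Site} (hy : y ∈ X) (hys : slopeForm s y < 0) :
    (∀ t ∈ Sl, slopeForm t (y + z) ≤ height T N t ∧ (slopeForm t (y + z) = height T N t →
      ε * s < ε * t ∧ slopeForm t x = height T N t)) ∧
    |((y + z).1 : ℝ)| ≤ S * N ∧ y + z ∈ parabola := by
  obtain ⟨hy1, hy2⟩ := hF.abs_range hX hy
  obtain ⟨-, hys0, hnext, hmax⟩ := hrule y hy
  obtain ⟨hN1, hN2⟩ := hF.lt_of_large hN
  have hr : (0 : ℝ) ≤ r := r.cast_nonneg
  have hδ := hF.delta_pos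
  have hεy : |ε * (y.1 : ℝ)| ≤ r := by rwa [sign_mul_le_abs hε]
  have hεx : ε * (x.1 : ℝ) ≤ S * N := (le_abs_self _).trans (by rwa [sign_mul_le_abs hε])
  have hform : ∀ t ∈ Sl, |y.2 + ε * t * (ε * y.1)| ≤ r * (1 + S) := fun t ht =>
    mul_le_of_abs_le (by rw [sign_mul_le_abs hε]; exact hF.abs_le ht) hεy hy2
  have hyt : ∀ t, slopeForm t y = y.2 + ε * t * (ε * y.1) := fun t => by
    rcases hε with rfl | rfl <;> simp [slopeForm]
  have hzt : ∀ t, slopeForm t z = height T N s + (ε * t - ε * s) * (ε * z.1) := fun t => by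
    rw [slopeForm_change hε s t, hz]
  have hxt : ∀ t, slopeForm t x = height T N s + (ε * t - ε * s) * (ε * x.1) := fun t => by
    rw [slopeForm_change hε s t, hx]
  have hztx : ∀ t, ε * s ≤ ε * t → slopeForm t z ≤ slopeForm t x := fun t ht => by
    rw [hzt, hxt]
    have : (ε * t - ε * s) * (ε * z.1) ≤ (ε * t - ε * s) * (ε * x.1) := by gcongr
    linarith
  -- the successor of `s` among the slopes
  have hsucc : (∀ t ∈ Sl, ε * t ≤ ε * s) ∨
      ∃ t' ∈ Sl, ε * s < ε * t' ∧ ∀ t ∈ Sl, ε * s < ε * t → ε * t' ≤ ε * t := by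
    by_cases h : ∃ t ∈ Sl, ε * s < ε * t
    · obtain ⟨t, ht, hmin⟩ := (Sl.filter fun t => ε * s < ε * t).exists_min_image (fun t => ε * t)
        (by obtain ⟨t, ht, h⟩ := h; exact ⟨t, Finset.mem_filter.2 ⟨ht, h⟩⟩)
      simp only [Finset.mem_filter] at ht hmin
      exact Or.inr ⟨t, ht.1, ht.2, fun u hu h => hmin u ⟨hu, h⟩⟩
    · push Not at h
      exact Or.inl h
  have hslope : ∀ t ∈ Sl, slopeForm t (y + z) ≤ height T N t ∧
      (slopeForm t (y + z) = height T N t → ε * s < ε * t ∧ slopeForm t x = height T N t) := by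
    intro t ht
    have key : slopeForm t (y + z) < height T N t → slopeForm t (y + z) ≤ height T N t ∧
        (slopeForm t (y + z) = height T N t → ε * s < ε * t ∧ slopeForm t x = height T N t) :=
      fun h => ⟨h.le, fun h' => absurd h' h.ne⟩
    rcases lt_trichotomy (ε * t) (ε * s) with hts | hts | hts
    · apply key
      have := slack_below hδ hN hr hF.one_le (hF.sign_gap hε ht hs hts)
        (hF.abs_height_sub_le hε hs ht) le_rfl hlo (hform t ht)
      rw [slopeForm_add, hyt, hzt]
      linarith
    · have : t = s := by rcases hε with rfl | rfl <;> linarith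
      apply key
      rw [this, slopeForm_add, hz]
      linarith
    · rcases hsucc with h | ⟨t', ht', hst', hmin⟩
      · exact absurd (h t ht) (not_le.2 hts)
      rcases (hmin t ht hts).eq_or_lt with htt | htt
      · have hyt0 := hnext t ht hts (fun u hu h => htt ▸ hmin u hu h)
        have h1 := hztx t hts.le
        have h2 := hxle t ht
        rw [slopeForm_add]
        exact ⟨by linarith, fun h => ⟨hts, by linarith⟩⟩
      · apply key
        have := slack_above hδ hN hr hF.one_le (hF.sign_gap hε hs ht' hst')
          (hF.sign_gap hε ht' ht htt) (hF.abs_height_sub_le hε hs ht')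
          (hF.abs_height_sub_le hε ht' ht)
          (by rw [← hzt]; exact (hztx t' hst'.le).trans (hxle t' ht')) (hform t ht)
        rw [slopeForm_add, hyt, hzt]
        linarith
  have hsb := (hF.sign_bound hε hs).2
  have hN0 : 0 ≤ N := by linarith
  have hlow : -(S * N) + r ≤ ε * z.1 := by nlinarith
  have hza : |(z.1 : ℝ)| ≤ S * N := abs_le_of_sign hε (by linarith) (hzx.trans hεx)
  have hyz : |((y + z).1 : ℝ)| ≤ S * N := by
    have e : ε * (((y + z).1 : ℤ) : ℝ) = ε * y.1 + ε * z.1 := by simp; ring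
    refine abs_le_of_sign hε ?_ ?_
    · rw [e]; linarith [(_root_.abs_le.1 hεy).1]
    · rw [e]
      rcases hsucc with h | ⟨t', ht', hst', hmin⟩
      · linarith [hmax h]
      · have := width_le hδ hF.delta_le hN hr hF.one_le (hF.sign_gap hε hs ht' hst')
          (hF.sign_bound hε ht').1 (hF.abs_height_sub_le hε hs ht')
          (by rw [← hzt]; exact (hztx t' hst'.le).trans (hxle t' ht'))
        linarith [(_root_.abs_le.1 hεy).2]
  exact ⟨hslope, hyz, hF.mem_parabola_of_side hN hs hy2 hz hza hyz⟩

/-- A run of `R` infected sites, larger than the range of a rule, can be extended as long as the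
remaining sites of the rule are infected. -/
theorem row_fill {I : Set Site} {X : Finset Site}
    (hI : ∀ z, (∀ y ∈ X, y + z ∈ I) → z ∈ I) {p w : Site} {R n : ℕ}
    (hrun : ∀ i < R, p + (i : ℤ) • w ∈ I)
    (hstep : ∀ c : ℕ, R ≤ c → c ≤ n → ∀ y ∈ X,
      (∃ k : ℕ, 1 ≤ k ∧ k ≤ R ∧ y = -((k : ℤ) • w)) ∨ y + (p + (c : ℤ) • w) ∈ I) :
    ∀ c : ℕ, c ≤ n → p + (c : ℤ) • w ∈ I := by
  intro c
  induction c using Nat.strong_induction_on with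
  | _ c ih =>
    intro hc
    rcases lt_or_ge c R with h | h
    · exact hrun c h
    refine hI _ fun y hy => ?_
    rcases hstep c h hc y hy with ⟨k, hk1, hkR, rfl⟩ | h'
    · have := ih (c - k) (by omega) (by omega)
      rw [Nat.cast_sub (hkR.trans h), sub_smul] at this
      rwa [neg_add_eq_sub, add_sub_assoc]
    · exact h'

end Droplet

section Size

variable {U : Finset (Finset Site)} {Sl : Finset ℝ} {T S δ N : ℝ} {r : ℕ}

/-- The size of the smallest droplet containing a given site. -/
noncomputable def dropletSize (Sl : Finset ℝ) (hne : Sl.Nonempty) (T S : ℝ) (x : Site) : ℝ :=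
  max (|(x.1 : ℝ)| / S) (Sl.sup' hne fun s => √(slopeForm s x / T) - s ^ 2 / (4 * T))

theorem dropletSize_le_iff (hne : Sl.Nonempty) (hT : 0 < T) (hS : 0 < S) (hN : 0 ≤ N) (x : Site) :
    dropletSize Sl hne T S x ≤ N ↔
      |(x.1 : ℝ)| ≤ S * N ∧ ∀ s ∈ Sl, slopeForm s x ≤ height T N s := by
  rw [dropletSize, max_le_iff, Finset.sup'_le_iff, div_le_iff₀ hS, mul_comm]
  refine and_congr_right fun _ => forall₂_congr fun s _ => ?_
  rw [sub_le_iff_le_add, Real.sqrt_le_left (by positivity), div_le_iff₀ hT, height, mul_comm]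

theorem dropletSize_lt_iff (hne : Sl.Nonempty) (hT : 0 < T) (hS : 0 < S) (hN : 0 < N) (x : Site) :
    dropletSize Sl hne T S x < N ↔
      |(x.1 : ℝ)| < S * N ∧ ∀ s ∈ Sl, slopeForm s x < height T N s := by
  rw [dropletSize, max_lt_iff, Finset.sup'_lt_iff, div_lt_iff₀ hS, mul_comm]
  refine and_congr_right fun _ => forall₂_congr fun s _ => ?_
  rw [sub_lt_iff_lt_add, Real.sqrt_lt' (by positivity), div_lt_iff₀ hT, height, mul_comm]

theorem finite_droplet (hne : Sl.Nonempty) (hT : 0 < T) (hS : 0 < S) (N : ℝ) :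
    {x : Site | x ∈ parabola ∧ dropletSize Sl hne T S x ≤ N}.Finite := by
  obtain ⟨s, hs⟩ := hne
  set M := max N 0
  set L := |s| * (S * M) + height T M s + S * M with hL
  refine ((Set.finite_Icc (-⌈L⌉) ⌈L⌉).prod (Set.finite_Icc (-⌈L⌉) ⌈L⌉)).subset fun x hx => ?_
  have hM : 0 ≤ M := le_max_right _ _
  obtain ⟨h1, h2⟩ := (dropletSize_le_iff ⟨s, hs⟩ hT hS hM x).1 (hx.2.trans (le_max_left _ _))
  have h3 : (0 : ℝ) ≤ x.2 := by exact_mod_cast (sq_nonneg x.1).trans hx.1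
  have h4 := h2 s hs
  have h5 : -(|s| * (S * M)) ≤ s * x.1 := by
    have : |s * x.1| ≤ |s| * (S * M) := by rw [abs_mul]; gcongr
    linarith [(_root_.abs_le.1 this).1]
  have h6 : 0 ≤ height T M s := by unfold height; positivity
  have h7 : 0 ≤ |s| * (S * M) := by positivity
  have h8 : 0 ≤ S * M := by positivity
  have hint : ∀ n : ℤ, |(n : ℝ)| ≤ L → n ∈ Set.Icc (-⌈L⌉) ⌈L⌉ := fun n hn => by
    have h := hn.trans (Int.le_ceil L)
    rw [← Int.cast_abs, Int.cast_le] at h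
    exact ⟨(_root_.abs_le.1 h).1, (_root_.abs_le.1 h).2⟩
  simp only [slopeForm] at h4
  exact ⟨hint _ (by linarith), hint _ (by rw [abs_of_nonneg h3]; linarith)⟩

theorem IsFrame.rate_pos (hF : IsFrame U Sl T S δ r) : 0 < T := by
  nlinarith [hF.rate, sq_nonneg S, sq_nonneg (S ^ 2)]

theorem IsFrame.side_fill (hF : IsFrame U Sl T S δ r) (hN : r * (1 + S) + 2 ≤ δ ^ 2 * N)
    {I : Set Site} (hI : ∀ X ∈ U, ∀ z, (∀ y ∈ X, y + z ∈ I) → z ∈ I)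
    {ε : ℝ} (hε : ε = 1 ∨ ε = -1) {s : ℝ} (hs : s ∈ Sl) {x p v : Site} {n : ℕ}
    (hx : slopeForm s x = height T N s) (hxle : ∀ t ∈ Sl, slopeForm t x ≤ height T N t)
    (hxw : |(x.1 : ℝ)| ≤ S * N) (hv : 0 < ε * (v.1 : ℝ)) (hsv : slopeForm s v = 0)
    (hlat : ∀ y, slopeForm s y = 0 → ∃ c : ℤ, y = c • v)
    (hrun : ∀ i < r + 1, p + (i : ℤ) • v ∈ I) (hp : N * (ε * s - δ) ≤ ε * p.1)
    (hxp : x = p + (n : ℤ) • v)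
    (hlow : ∀ z ∈ parabola, |(z.1 : ℝ)| ≤ S * N → (∀ t ∈ Sl, slopeForm t z ≤ height T N t ∧
      (slopeForm t z = height T N t → ε * s < ε * t ∧ slopeForm t x = height T N t)) → z ∈ I) :
    x ∈ I := by
  obtain ⟨X, hX, hrule⟩ := hF.rule ε hε s hs
  have hv1 : (1 : ℝ) ≤ ε * v.1 := by
    rcases hε with rfl | rfl
    · rw [one_mul] at hv ⊢
      exact_mod_cast hv
    · have h : (0 : ℝ) < ((-v.1 : ℤ) : ℝ) := by push_cast; linarith
      have : (1 : ℝ) ≤ ((-v.1 : ℤ) : ℝ) := by exact_mod_cast h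
      push_cast at this; linarith
  have hfirst : ∀ c : ℕ, ε * ((p + (c : ℤ) • v).1 : ℝ) = ε * p.1 + c * (ε * v.1) := fun c => by
    simp; ring
  rw [hxp]
  refine row_fill (hI X hX) hrun (fun c hRc hcn y hy => ?_) n le_rfl
  obtain ⟨h1, h2, -⟩ := hrule y hy
  rcases h1.eq_or_lt with h0 | h0
  · left
    obtain ⟨k, rfl⟩ := hlat y h0
    have hk : (k : ℝ) * (ε * v.1) < 0 := by
      have := h2 h0
      simp only [Prod.smul_fst, smul_eq_mul, Int.cast_mul] at this
      linarith
    have hk0 : (k : ℝ) < 0 := by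
      by_contra! h
      nlinarith
    have hkr : -(r : ℝ) ≤ k * (ε * v.1) := by
      have := (hF.abs_range hX hy).1
      rw [← sign_mul_le_abs hε] at this
      simp only [Prod.smul_fst, smul_eq_mul, Int.cast_mul] at this
      linarith [(_root_.abs_le.1 this).1]
    have hkr' : -(r : ℝ) ≤ k := by nlinarith
    have hk0' : k < 0 := by exact_mod_cast hk0
    have hkr'' : -(r : ℤ) ≤ k := by exact_mod_cast hkr'
    refine ⟨(-k).toNat, by omega, by omega, ?_⟩
    rw [Int.toNat_of_nonneg (by omega), neg_smul, neg_neg]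
  · right
    have hc0 : (0 : ℝ) ≤ c := c.cast_nonneg
    have hcn' : (c : ℝ) ≤ n := by exact_mod_cast hcn
    obtain ⟨h3, h4, h5⟩ := hF.side_step hN hε hs hX hrule (z := p + (c : ℤ) • v) hx
      (by
        have := hx
        rw [hxp, slopeForm_add, slopeForm_zsmul, hsv] at this
        rw [slopeForm_add, slopeForm_zsmul, hsv]
        linarith)
      hxle hxw (by rw [hfirst]; nlinarith) (by rw [hxp, hfirst, hfirst]; gcongr) hy h0
    exact hlow _ h5 h4 h3

end Size

section Growth

variable {U : Finset (Finset Site)} {Sl : Finset ℝ} {T S δ N : ℝ} {r : ℕ}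

theorem IsFrame.column_fill (hF : IsFrame U Sl T S δ r) (hN : r * (1 + S) + 2 ≤ δ ^ 2 * N)
    {I : Set Site} (hI : ∀ X ∈ U, ∀ z, (∀ y ∈ X, y + z ∈ I) → z ∈ I)
    {x : Site} {b : ℤ} (hxΓ : x ∈ parabola) (hxw : |(x.1 : ℝ)| = S * N)
    (hxlt : ∀ t ∈ Sl, slopeForm t x < height T N t)
    (hb : x.1 ^ 2 - |x.1| ≤ b) (hb' : b + r ≤ x.1 ^ 2)
    (hrun : ∀ i < r + 1, (x.1, b) + (i : ℤ) • ((0, 1) : Site) ∈ I)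
    (hlow : ∀ z ∈ parabola, |(z.1 : ℝ)| < S * N →
      (∀ t ∈ Sl, slopeForm t z < height T N t) → z ∈ I) : x ∈ I := by
  obtain ⟨hN1, hN2⟩ := hF.lt_of_large hN
  have hr : (0 : ℝ) ≤ r := r.cast_nonneg
  have hδ := hF.delta_pos
  have hS := hF.one_le
  obtain ⟨e, he, hex⟩ : ∃ e : ℤ, (e = 1 ∨ e = -1) ∧ e * x.1 = |x.1| := by
    rcases le_total 0 x.1 with h | h
    · exact ⟨1, Or.inl rfl, by rw [abs_of_nonneg h, one_mul]⟩
    · exact ⟨-1, Or.inr rfl, by rw [abs_of_nonpos h, neg_one_mul]⟩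
  have hε : (e : ℝ) = 1 ∨ (e : ℝ) = -1 := by rcases he with rfl | rfl <;> simp
  obtain ⟨s, hs, hmax⟩ := Sl.exists_max_image (fun t => (e : ℝ) * t) hF.nonempty
  obtain ⟨X, hX, hrule⟩ := hF.rule e hε s hs
  have hm : (r : ℤ) + 2 ≤ |x.1| := by
    have : (r : ℝ) + 2 ≤ |(x.1 : ℝ)| := by rw [hxw]; nlinarith
    exact_mod_cast this
  have hxb : b + r ≤ x.2 := hb'.trans hxΓ
  have hxe : x = (x.1, b) + (((x.2 - b).toNat : ℕ) : ℤ) • ((0, 1) : Site) := by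
    rw [Int.toNat_of_nonneg (by omega)]
    ext <;> simp
  rw [hxe]
  refine row_fill (hI X hX) hrun (fun c hRc hcn y hy => ?_) _ le_rfl
  obtain ⟨h1, h2, -, h4⟩ := hrule y hy
  obtain ⟨hy1, hy2⟩ := hF.range X hX y hy
  have hey : (e : ℝ) * y.1 ≤ 0 := h4 hmax
  rcases eq_or_ne y.1 0 with h0 | h0
  · left
    simp only [slopeForm, h0, Int.cast_zero, mul_zero, add_zero, lt_irrefl, imp_false] at h1 h2
    have h3 : y.2 < 0 := by exact_mod_cast lt_of_le_of_ne h1 h2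
    have h5 := (_root_.abs_le.1 hy2).1
    refine ⟨(-y.2).toNat, by omega, by omega, ?_⟩
    rw [Int.toNat_of_nonneg (by omega)]
    ext <;> simp [h0]
  · right
    set z : Site := (x.1, b) + (c : ℤ) • ((0, 1) : Site) with hz
    have hz1 : z.1 = x.1 := by simp [hz]
    have hz2 : z.2 = b + c := by simp [hz]
    have hcx : b + c ≤ x.2 := by omega
    have hey' : e * y.1 ≤ -1 := by
      have h3 : e * y.1 ≤ 0 := by exact_mod_cast hey
      have h5 : e * y.1 ≠ 0 := by rcases he with rfl | rfl <;> simpa using h0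
      omega
    have hyz1 : |(y + z).1| ≤ |x.1| - 1 := by
      have h3 := _root_.abs_le.1 hy1
      rw [Prod.fst_add, hz1, _root_.abs_le]
      rcases he with rfl | rfl <;> constructor <;> omega
    have hzt : ∀ t ∈ Sl, slopeForm t z < height T N t := fun t ht => by
      refine lt_of_le_of_lt ?_ (hxlt t ht)
      simp only [slopeForm, hz1, hz2]
      have : ((b + c : ℤ) : ℝ) ≤ x.2 := by exact_mod_cast hcx
      linarith
    refine hlow _ ?_ ?_ fun t ht => ?_
    · show (y + z).1 ^ 2 ≤ (y + z).2
      have h3 : (y + z).1 ^ 2 ≤ (|x.1| - 1) ^ 2 := by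
        rw [← sq_abs (y + z).1]
        exact pow_le_pow_left₀ (abs_nonneg _) hyz1 2
      have h5 := (_root_.abs_le.1 hy2).1
      have h6 : (|x.1| - 1) ^ 2 = x.1 ^ 2 - 2 * |x.1| + 1 := by rw [← sq_abs x.1]; ring
      rw [Prod.snd_add, hz2]
      have : (r : ℤ) + 1 ≤ c := by exact_mod_cast hRc
      omega
    · rw [← hxw]
      have : ((|(y + z).1| : ℤ) : ℝ) ≤ ((|x.1| - 1 : ℤ) : ℝ) := by exact_mod_cast hyz1
      push_cast at this ⊢
      linarith
    · rw [slopeForm_add]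
      rcases (hmax t ht).eq_or_lt with hts | hts
      · have : t = s := by rcases hε with h | h <;> rw [h] at hts <;> linarith
        rw [this]
        linarith [hzt s hs]
      · have hyt : slopeForm t y = y.2 + e * t * (e * y.1) := by
          rcases hε with h | h <;> simp [slopeForm, h]
        have hez : (e : ℝ) * z.1 = S * N := by
          rw [hz1, ← hxw]; exact_mod_cast hex
        have hy' := hF.abs_range hX hy
        have := slack_below (ya := e * y.1) (yb := y.2) hδ hN hr hF.one_le
          (hF.sign_gap hε ht hs hts)
          (hF.abs_height_sub_le hε hs ht) (hzt s hs).le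
          (a := e * z.1) (by rw [hez]; nlinarith [(hF.sign_bound hε hs).1])
          (mul_le_of_abs_le (by rw [sign_mul_le_abs hε]; exact hF.abs_le ht)
            (by rw [sign_mul_le_abs hε]; exact hy'.1) hy'.2)
        rw [hyt, slopeForm_change hε s t z]
        linarith

/-- Droplets of size at least `N₀` keep growing in the presence of helpful sites. -/
theorem IsFrame.parabola_subset (hF : IsFrame U Sl T S δ r) {I : Set Site}
    (hI : ∀ X ∈ U, ∀ z, (∀ y ∈ X, y + z ∈ I) → z ∈ I)
    {N₀ : ℝ} (hN₀ : r * (1 + S) + 2 ≤ δ ^ 2 * N₀) {w : ℝ → Site}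
    (hw : ∀ s ∈ Sl, 0 < (w s).1 ∧ slopeForm s (w s) = 0 ∧
      ∀ y, slopeForm s y = 0 → ∃ c : ℤ, y = c • w s)
    (hseed : ∀ x ∈ parabola, dropletSize Sl hF.nonempty T S x ≤ N₀ → x ∈ I)
    (hside : ∀ N, N₀ ≤ N → ∀ s ∈ Sl, ∀ z, slopeForm s z = height T N s →
      N * (s - δ) ≤ z.1 → z.1 ≤ N * (s - δ) + (w s).1 →
      ∃ c : ℕ, (c + r + 1) * ((w s).1 : ℝ) ≤ N * δ ∧
        ∀ i < r + 1, z + ((c + i : ℕ) : ℤ) • w s ∈ I)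
    (hcol : ∀ a : ℤ, N₀ ≤ |(a : ℝ)| → ∃ c : ℕ, (c : ℤ) + r ≤ |a| ∧
      ∀ i < r + 1, (a, a ^ 2 - |a|) + ((c + i : ℕ) : ℤ) • ((0, 1) : Site) ∈ I) :
    parabola ⊆ I := by
  have hS := hF.one_le
  have hS0 : 0 < S := by linarith
  have hT := hF.rate_pos
  have hδ := hF.delta_pos
  set G := dropletSize Sl hF.nonempty T S with hG
  set idx : Site → WithBot ℝ := fun x =>
    (Sl.filter fun s => slopeForm s x = height T (G x) s).max with hidx
  intro x₀ hx₀
  by_contra hx₀I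
  obtain ⟨x, hx, hmin⟩ := Set.exists_min_image {x | (x ∈ parabola ∧ G x ≤ G x₀) ∧ x ∉ I}
    (fun x => toLex (G x, idx x))
    ((finite_droplet hF.nonempty hT hS0 (G x₀)).subset fun x hx => hx.1) ⟨x₀, ⟨hx₀, le_rfl⟩, hx₀I⟩
  obtain ⟨⟨hxΓ, hxG⟩, hxI⟩ := hx
  have hbelow : ∀ z ∈ parabola, toLex (G z, idx z) < toLex (G x, idx x) → z ∈ I := by
    intro z hz hlt
    by_contra hzI
    refine absurd (hmin z ⟨⟨hz, ?_⟩, hzI⟩) (not_le.2 hlt)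
    rcases Prod.Lex.toLex_lt_toLex.1 hlt with h | h
    · exact h.le.trans hxG
    · exact h.1.le.trans hxG
  set N := G x with hNx
  have hN₀N : N₀ < N := by
    by_contra! h
    exact hxI (hseed x hxΓ h)
  have hN : r * (1 + S) + 2 ≤ δ ^ 2 * N := hN₀.trans (by gcongr)
  obtain ⟨hN1, hN2⟩ := hF.lt_of_large hN
  have hr : (0 : ℝ) ≤ r := r.cast_nonneg
  have hN0 : 0 < N := by linarith
  obtain ⟨hxw, hxle⟩ := (dropletSize_le_iff hF.nonempty hT hS0 hN0.le x).1 le_rfl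
  rcases eq_or_ne (idx x) ⊥ with hbot | hbot
  · -- the site lies on a vertical side of its droplet only
    have hne : ∀ t ∈ Sl, slopeForm t x < height T N t := fun t ht =>
      lt_of_le_of_ne (hxle t ht) fun h => by
        have hmem : t ∈ Sl.filter fun s => slopeForm s x = height T N s :=
          Finset.mem_filter.2 ⟨ht, h⟩
        rw [Finset.max_eq_bot.1 hbot] at hmem
        simp at hmem
    have hxw' : |(x.1 : ℝ)| = S * N := hxw.antisymm <| not_lt.1 fun h =>
      absurd ((dropletSize_lt_iff hF.nonempty hT hS0 hN0 x).2 ⟨h, hne⟩) (lt_irrefl _)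
    obtain ⟨c, hc, hrun⟩ := hcol x.1 (by rw [hxw']; nlinarith)
    refine hxI (hF.column_fill hN hI (b := x.1 ^ 2 - |x.1| + c) hxΓ hxw' hne (by omega) (by omega)
      (fun i hi => ?_) fun z hz hz1 hz2 => hbelow z hz (Prod.Lex.toLex_lt_toLex.2 (Or.inl
        ((dropletSize_lt_iff hF.nonempty hT hS0 hN0 z).2 ⟨hz1, hz2⟩))))
    convert hrun i hi using 1
    ext <;> simp
    ring
  · obtain ⟨s, hs'⟩ := WithBot.ne_bot_iff_exists.1 hbot
    obtain ⟨hs, hsx⟩ := Finset.mem_filter.1 (Finset.mem_of_max hs'.symm)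
    have hidxx : ∀ t ∈ Sl, slopeForm t x = height T N t → t ≤ s := fun t ht h => by
      have hmem : t ∈ Sl.filter fun s => slopeForm s x = height T N s :=
        Finset.mem_filter.2 ⟨ht, h⟩
      have := Finset.le_max hmem
      change _ ≤ idx x at this
      rw [← hs'] at this
      exact WithBot.coe_le_coe.1 this
    have hlow : ∀ z ∈ parabola, |(z.1 : ℝ)| ≤ S * N → (∀ t ∈ Sl, slopeForm t z ≤ height T N t ∧
        (slopeForm t z = height T N t → t < s)) → z ∈ I := by
      intro z hz hz1 hz2
      apply hbelow z hz
      have hle : G z ≤ N :=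
        (dropletSize_le_iff hF.nonempty hT hS0 hN0.le z).2 ⟨hz1, fun t ht => (hz2 t ht).1⟩
      rcases hle.lt_or_eq with h | h
      · exact Prod.Lex.toLex_lt_toLex.2 (Or.inl h)
      · refine Prod.Lex.toLex_lt_toLex.2 (Or.inr ⟨h, ?_⟩)
        rw [← hs']
        rcases eq_or_ne (idx z) ⊥ with h0 | h0
        · rw [h0]; exact WithBot.bot_lt_coe s
        · obtain ⟨t, ht⟩ := WithBot.ne_bot_iff_exists.1 h0
          obtain ⟨ht1, ht2⟩ := Finset.mem_filter.1 (Finset.mem_of_max ht.symm)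
          rw [← ht]
          exact WithBot.coe_lt_coe.2 ((hz2 t ht1).2 (by rw [ht2, h]))
    obtain ⟨hw1, hw2, hw3⟩ := hw s hs
    have hw1' : (1 : ℝ) ≤ (w s).1 := by exact_mod_cast hw1
    set q : ℝ := (((w s).1 : ℤ) : ℝ) with hq
    set d : ℤ := ⌈(N * (s - δ) - x.1) / q⌉ with hd
    have hd1 : N * (s - δ) - x.1 ≤ d * q := (div_le_iff₀ (by linarith)).1 (Int.le_ceil _)
    have hd2 : d * q ≤ N * (s - δ) - x.1 + q := by
      have := (Int.ceil_lt_add_one ((N * (s - δ) - x.1) / q)).le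
      have h := mul_le_mul_of_nonneg_right this (show 0 ≤ q by linarith)
      rwa [add_mul, div_mul_cancel₀ _ (by linarith), one_mul] at h
    have hfst : ∀ e : ℤ, (((x + e • w s).1 : ℤ) : ℝ) = x.1 + e * q := fun e => by simp [hq]
    obtain ⟨c, hc, hrun⟩ := hside N hN₀N.le s hs (x + d • w s)
      (by rw [slopeForm_add, slopeForm_zsmul, hw2, hsx, mul_zero, add_zero])
      (by rw [hfst]; linarith) (by rw [hfst]; linarith)
    have hrun' : ∀ i < r + 1, x + (d + c) • w s + (i : ℤ) • w s ∈ I := fun i hi => by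
      have := hrun i hi
      rw [add_assoc, ← add_smul] at this ⊢
      push_cast at this
      rwa [add_assoc]
    have hcr : (c : ℝ) * q + r * q + q ≤ N * δ := by linarith
    have hq0 : 0 ≤ (r : ℝ) * q := by positivity
    rcases le_or_gt (d + c) 0 with hdc | hdc
    · refine hxI (hF.side_fill hN hI (Or.inl rfl) hs (p := x + (d + c) • w s) (v := w s)
        (n := (-(d + c)).toNat) hsx hxle hxw (by rw [one_mul]; linarith) hw2 hw3 hrun' ?_ ?_ ?_)
      · rw [one_mul, one_mul, hfst]
        push_cast
        have : 0 ≤ (c : ℝ) * q := by positivity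
        linarith
      · rw [Int.toNat_of_nonneg (by omega), add_assoc, ← add_smul]
        simp
      · refine fun z hz h1 h2 => hlow z hz h1 fun t ht => ⟨(h2 t ht).1, fun h => ?_⟩
        obtain ⟨h3, h4⟩ := (h2 t ht).2 h
        have := hidxx t ht h4
        linarith
    · refine hxI (hF.side_fill hN hI (Or.inr rfl) hs (p := x + (d + c + r) • w s) (v := -w s)
        (n := (d + c + r).toNat) hsx hxle hxw ?_ ?_ ?_ (fun i hi => ?_) ?_ ?_ ?_)
      · simp only [Prod.fst_neg, Int.cast_neg]; linarith
      · simpa [hw2] using slopeForm_zsmul s (-1) (w s)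
      · intro y hy
        obtain ⟨k, hk⟩ := hw3 y hy
        exact ⟨-k, by rw [hk]; simp⟩
      · have := hrun' (r - i) (by omega)
        rw [Nat.cast_sub (by omega), add_assoc, ← add_smul] at this
        convert this using 1
        rw [add_assoc, smul_neg, ← sub_eq_add_neg, ← sub_smul]
        congr 2
        ring
      · rw [hfst]
        push_cast
        linarith
      · rw [Int.toNat_of_nonneg (by omega)]
        simp
      · refine fun z hz h1 h2 => hlow z hz h1 fun t ht => ⟨(h2 t ht).1, fun h => ?_⟩
        linarith [((h2 t ht).2 h).1]

end Growth

section Runs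

variable {U : Finset (Finset Site)} {Sl : Finset ℝ} {T S δ N : ℝ} {r : ℕ}

/-- From every high enough site of the cone `|x.1| ≤ x.2` and in every direction of `W`,
there is a run of `R` consecutive sites of `A` at distance at most of order `√x.2 / K`. -/
def HasRuns (A : Set Site) (W : Finset Site) (R K : ℕ) (B : ℤ) : Prop :=
  ∀ z : Site, B ≤ z.2 → |z.1| ≤ z.2 → ∀ w ∈ W, ∃ j < Nat.sqrt z.2.toNat / K,
    ∀ i < R, z + ((j * R + i : ℕ) : ℤ) • w ∈ A

theorem IsFrame.row_bounds (hF : IsFrame U Sl T S δ r) (hN0 : 2 ≤ N) {s : ℝ} (hs : s ∈ Sl)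
    {z : Site} (hz : slopeForm s z = height T N s) (hza : |(z.1 : ℝ)| ≤ S * N) :
    N ≤ z.2 ∧ |(z.1 : ℝ)| ≤ z.2 ∧ (z.2 : ℝ) ≤ (3 * T * N) ^ 2 := by
  have hT := hF.rate_pos
  have hS := hF.one_le
  have hsz : |s * z.1| ≤ S * (S * N) := by
    rw [abs_mul]
    exact mul_le_mul (hF.abs_le hs) hza (abs_nonneg _) (by linarith)
  have hz2' : (z.2 : ℝ) = height T N s - s * z.1 := by
    rw [← hz]; simp [slopeForm]
  have hs2 : s ^ 2 ≤ S ^ 2 := by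
    rw [← sq_abs s]
    exact pow_le_pow_left₀ (abs_nonneg s) (hF.abs_le hs) 2
  have hTS : S ^ 2 + S ^ 2 + 1 ≤ T := by nlinarith [hF.rate, sq_nonneg (S ^ 2)]
  have hlow : S ^ 2 * N ^ 2 + N ^ 2 ≤ z.2 := by
    have h1 : T * N ^ 2 ≤ height T N s := by
      unfold height
      have : 0 ≤ s ^ 2 / (4 * T) := by positivity
      gcongr
      linarith
    have h2 := (_root_.abs_le.1 hsz).2
    have h3 : S ^ 2 * N ≤ S ^ 2 * N ^ 2 := by gcongr; nlinarith
    have h4 : (S ^ 2 + S ^ 2 + 1) * N ^ 2 ≤ T * N ^ 2 := by gcongr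
    rw [hz2']
    nlinarith
  have hup : (z.2 : ℝ) ≤ (3 * T * N) ^ 2 := by
    have h1 : height T N s ≤ T * (N + 1) ^ 2 := by
      unfold height
      have : s ^ 2 / (4 * T) ≤ 1 := (div_le_one (by positivity)).2 (by nlinarith)
      gcongr
    have h2 := (_root_.abs_le.1 hsz).1
    have h3 : T * (N + 1) ^ 2 ≤ T * (2 * N) ^ 2 := by gcongr; linarith
    have h4 : S * (S * N) ≤ T * N ^ 2 := by nlinarith [sq_nonneg S]
    have h5 : T * N ^ 2 ≤ T ^ 2 * N ^ 2 := by gcongr; nlinarith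
    rw [hz2']
    nlinarith
  have hSN : N ≤ S * N := by nlinarith
  have hSN2 : S * N ≤ S ^ 2 * N ^ 2 := by nlinarith
  exact ⟨by nlinarith, by nlinarith, hup⟩

theorem IsFrame.exists_seed (hF : IsFrame U Sl T S δ r) :
    ∃ (W : Finset Site) (R K : ℕ), 0 < R ∧ 0 < K ∧ (∀ w ∈ W, w ≠ 0 ∧ R * w.2.natAbs ≤ K) ∧
      ∀ B : ℤ, ∃ Seed : Finset Site, (∀ x ∈ Seed, 0 ≤ x.2) ∧
        ∀ A : Set Site, ↑Seed ⊆ A → HasRuns A W R K B → parabola ⊆ bsClosure U A := by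
  classical
  have hT := hF.rate_pos
  have hS := hF.one_le
  have hδ := hF.delta_pos
  have hδ1 := hF.delta_le
  have hr : (0 : ℝ) ≤ r := r.cast_nonneg
  choose! w hw using hF.lattice
  set W : Finset Site := insert (0, 1) (Sl.image w)
  obtain ⟨K, hK⟩ : ∃ K : ℕ, 0 < K ∧ r + 1 ≤ K ∧ (∀ v ∈ W, (r + 1) * v.2.natAbs ≤ K) ∧
      ∀ s ∈ Sl, 3 * T * (r + 1) * ((w s).1 : ℝ) ≤ δ * K := by
    have h1 : ∀ᶠ K : ℕ in Filter.atTop, ∀ s ∈ Sl, 3 * T * (r + 1) * ((w s).1 : ℝ) ≤ δ * K := by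
      simp only [Filter.eventually_all_finset]
      exact fun s _ => (tendsto_natCast_atTop_atTop.const_mul_atTop hδ).eventually_ge_atTop _
    have h2 : ∀ᶠ K : ℕ in Filter.atTop, ∀ v ∈ W, (r + 1) * v.2.natAbs ≤ K := by
      simp only [Filter.eventually_all_finset]
      exact fun v _ => Filter.eventually_ge_atTop _
    obtain ⟨K, h⟩ := ((Filter.eventually_gt_atTop 0).and
      ((Filter.eventually_ge_atTop (r + 1)).and (h2.and h1))).exists
    exact ⟨K, h⟩
  obtain ⟨hK0, hKr, hKW, hKs⟩ := hK
  refine ⟨W, r + 1, K, r.succ_pos, hK0, fun v hv => ⟨?_, hKW v hv⟩, fun B => ?_⟩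
  · rcases Finset.mem_insert.1 hv with rfl | hv
    · simp
    · obtain ⟨s, hs, rfl⟩ := Finset.mem_image.1 hv
      intro h
      have := (hw s hs).1
      simp [h] at this
  obtain ⟨N₀, hN₀, hN₀B, hN₀2, hN₀w⟩ : ∃ N₀ : ℝ, r * (1 + S) + 2 ≤ δ ^ 2 * N₀ ∧ (B : ℝ) ≤ N₀ ∧
      2 ≤ N₀ ∧ ∀ s ∈ Sl, ((w s).1 : ℝ) ≤ δ * N₀ := by
    have h1 : ∀ᶠ N : ℝ in Filter.atTop, ∀ s ∈ Sl, ((w s).1 : ℝ) ≤ δ * N := by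
      simp only [Filter.eventually_all_finset]
      exact fun s _ => (Filter.tendsto_id.const_mul_atTop hδ).eventually_ge_atTop _
    have h2 : ∀ᶠ N : ℝ in Filter.atTop, r * (1 + S) + 2 ≤ δ ^ 2 * N :=
      (Filter.tendsto_id.const_mul_atTop (by positivity : 0 < δ ^ 2)).eventually_ge_atTop _
    exact (h2.and ((Filter.eventually_ge_atTop _).and
      ((Filter.eventually_ge_atTop _).and h1))).exists
  have hfin := finite_droplet (S := S) hF.nonempty hT (by linarith) N₀
  refine ⟨hfin.toFinset, fun x hx => ?_, fun A hA hruns => ?_⟩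
  · exact (sq_nonneg x.1).trans ((hfin.mem_toFinset.1 hx).1)
  refine hF.parabola_subset (fun X hX z hz => mem_bsClosure_of_rule hX hz) hN₀ hw
    (fun x hx hxN => subset_bsClosure (hA (hfin.mem_toFinset.2 ⟨hx, hxN⟩)))
    (fun N hN s hs z hz hz1 hz2 => ?_) fun a ha => ?_
  · have hN0 : 2 ≤ N := hN₀2.trans hN
    have hb := hF.sign_bound (Or.inl rfl) hs
    rw [one_mul] at hb
    have hwN : ((w s).1 : ℝ) ≤ δ * N := (hN₀w s hs).trans (by gcongr)
    have hza : |(z.1 : ℝ)| ≤ S * N := by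
      rw [_root_.abs_le]
      constructor <;> nlinarith
    obtain ⟨hzN, hzz, hup⟩ := hF.row_bounds hN0 hs hz hza
    obtain ⟨j, hj, hrun⟩ := hruns z
      (by
        have : (B : ℝ) ≤ z.2 := by linarith
        exact_mod_cast this)
      (by
        exact_mod_cast hzz) (w s) (Finset.mem_insert_of_mem (Finset.mem_image_of_mem w hs))
    refine ⟨j * (r + 1), ?_, fun i hi => subset_bsClosure (hrun i hi)⟩
    have hz0 : 0 ≤ z.2 := by
      have : (0 : ℝ) ≤ z.2 := by linarith
      exact_mod_cast this
    have h1 : (j + 1) * K ≤ Nat.sqrt z.2.toNat :=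
      (Nat.mul_le_mul_right K hj).trans (Nat.div_mul_le_self _ _)
    have h2 : ((Nat.sqrt z.2.toNat : ℕ) : ℝ) ≤ 3 * T * N := by
      refine abs_le_of_sq_le_sq' ?_ (by positivity) |>.2
      refine le_trans ?_ hup
      have : Nat.sqrt z.2.toNat ^ 2 ≤ z.2.toNat := Nat.sqrt_le' _
      have h : ((Nat.sqrt z.2.toNat ^ 2 : ℕ) : ℤ) ≤ z.2 := by
        rw [← Int.toNat_of_nonneg hz0]
        exact_mod_cast this
      exact_mod_cast h
    have h3 : ((j : ℝ) + 1) * K ≤ 3 * T * N := le_trans (by exact_mod_cast h1) h2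
    have hKpos : (0 : ℝ) < K := by exact_mod_cast hK0
    have hj0 : (0 : ℝ) ≤ j := j.cast_nonneg
    have hw0 : (0 : ℝ) < (w s).1 := by exact_mod_cast (hw s hs).1
    have h4 := hKs s hs
    push_cast
    have h5 : ((j : ℝ) * (r + 1) + r + 1) * (w s).1 = (j + 1) * ((r + 1) * (w s).1) := by ring
    rw [h5]
    refine le_of_mul_le_mul_right ?_ hKpos
    calc ((j : ℝ) + 1) * ((r + 1) * (w s).1) * K = ((j + 1) * K) * ((r + 1) * (w s).1) := by ring
      _ ≤ (3 * T * N) * ((r + 1) * (w s).1) := by gcongr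
      _ = N * (3 * T * (r + 1) * (w s).1) := by ring
      _ ≤ N * (δ * K) := by gcongr
      _ = N * δ * K := by ring
  · have ha2 : 2 ≤ |a| := by
      have : (2 : ℝ) ≤ |(a : ℝ)| := hN₀2.trans ha
      exact_mod_cast this
    have haB : B ≤ |a| := by
      have : (B : ℝ) ≤ |(a : ℝ)| := hN₀B.trans ha
      exact_mod_cast this
    have hsq : |a| * 2 ≤ a ^ 2 := by
      rw [← sq_abs a]; nlinarith
    obtain ⟨j, hj, hrun⟩ := hruns (a, a ^ 2 - |a|) (by simp only; omega) (by simp only; omega)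
      (0, 1) (Finset.mem_insert_self _ _)
    refine ⟨j * (r + 1), ?_, fun i hi => subset_bsClosure (hrun i hi)⟩
    have h1 : (j + 1) * K ≤ Nat.sqrt (a ^ 2 - |a|).toNat :=
      (Nat.mul_le_mul_right K hj).trans (Nat.div_mul_le_self _ _)
    have h2 : Nat.sqrt (a ^ 2 - |a|).toNat ≤ a.natAbs := by
      rw [← Nat.sqrt_eq' a.natAbs]
      apply Nat.sqrt_le_sqrt
      have := Int.natAbs_sq a
      zify
      rw [Int.toNat_of_nonneg (by omega), sq_abs]
      omega
    have h3 : (j + 1) * (r + 1) ≤ (j + 1) * K := Nat.mul_le_mul_left _ hKr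
    have h4 : (j + 1) * (r + 1) = j * (r + 1) + r + 1 := by ring
    rw [Int.abs_eq_natAbs]
    omega

end Runs

section Independence

variable {p : ℝ} {μ : Measure (Site → Bool)}

theorem IsBernoulli.iIndepFun (h : IsBernoulli p μ) (hp : p ∈ Icc (0 : ℝ) 1) :
    ProbabilityTheory.iIndepFun (fun (x : Site) ω => ω x) μ := by
  obtain ⟨ν, hν, hind⟩ := exists_isBernoulli hp
  rwa [h.ext hν]

theorem measurableSet_iSup_comap {E : Set (Site → Bool)} {S : Set Site} (hE : MeasurableSet E)
    (hES : DependsOn (· ∈ E) S) :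
    MeasurableSet[⨆ x ∈ S, MeasurableSpace.comap (fun ω : Site → Bool => ω x) inferInstance] E := by
  classical
  let φ : (Site → Bool) → Site → Bool := fun ω x => if x ∈ S then ω x else false
  have hφ : φ ⁻¹' E = E := by
    ext ω
    exact iff_of_eq (hES fun x hx => by simp [φ, hx])
  rw [← hφ]
  refine Measurable.of_comap_le ?_ hE
  simp only [MeasurableSpace.pi, MeasurableSpace.comap_iSup, MeasurableSpace.comap_comp]
  refine iSup_le fun x => ?_
  by_cases hx : x ∈ S
  · refine le_trans (le_of_eq ?_) (le_iSup₂ (f := fun x (_ : x ∈ S) =>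
      MeasurableSpace.comap (fun ω : Site → Bool => ω x) inferInstance) x hx)
    congr 1
    ext ω
    simp [φ, hx]
  · have : ((fun b : Site → Bool => b x) ∘ φ) = fun _ => false := by
      ext ω
      simp [φ, hx]
    rw [this, MeasurableSpace.comap_const]
    exact bot_le

theorem IsBernoulli.measure_inter (h : IsBernoulli p μ) (hp : p ∈ Icc (0 : ℝ) 1)
    {E E' : Set (Site → Bool)} {S S' : Set Site} (hE : MeasurableSet E) (hE' : MeasurableSet E')
    (hES : DependsOn (· ∈ E) S) (hES' : DependsOn (· ∈ E') S') (hS : Disjoint S S') :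
    μ (E ∩ E') = μ E * μ E' := by
  have hind := ProbabilityTheory.indep_iSup_of_disjoint
    (fun x => (measurable_pi_apply x).comap_le) (h.iIndepFun hp).iIndep hS
  exact (ProbabilityTheory.Indep_iff _ _ _).1 hind E E' (measurableSet_iSup_comap hE hES)
    (measurableSet_iSup_comap hE' hES')

theorem measurableSet_forall_true (s : Finset Site) :
    MeasurableSet {ω : Site → Bool | ∀ x ∈ s, ω x = true} :=
  measurableSet_cyl s fun _ => true

theorem IsBernoulli.measure_forall_not_le (h : IsBernoulli p μ) (hp : p ∈ Icc (0 : ℝ) 1)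
    {D : ℕ → Finset Site} (hD : Pairwise fun i j => Disjoint (D i) (D j)) {m : ℕ}
    (hm : ∀ i, (D i).card = m) (n : ℕ) :
    μ {ω | ∀ j < n, ¬∀ x ∈ D j, ω x = true} ≤ (1 - ENNReal.ofReal p ^ m) ^ n := by
  have := h.isProbabilityMeasure
  have hmeas : ∀ n, MeasurableSet {ω : Site → Bool | ∀ j < n, ¬∀ x ∈ D j, ω x = true} := by
    intro n
    have : {ω : Site → Bool | ∀ j < n, ¬∀ x ∈ D j, ω x = true} =
        ⋂ j ∈ Finset.range n, {ω | ∀ x ∈ D j, ω x = true}ᶜ := by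
      ext; simp
    rw [this]
    exact Finset.measurableSet_biInter _ fun j _ => (measurableSet_forall_true _).compl
  induction n with
  | zero => simp
  | succ n ih =>
    have : {ω : Site → Bool | ∀ j < n + 1, ¬∀ x ∈ D j, ω x = true} =
        {ω | ∀ j < n, ¬∀ x ∈ D j, ω x = true} ∩ {ω | ∀ x ∈ D n, ω x = true}ᶜ := by
      ext ω
      simp only [Nat.lt_succ_iff_lt_or_eq, mem_ofPred_eq, mem_inter_iff, mem_compl_iff]
      exact ⟨fun H => ⟨fun j hj => H j (Or.inl hj), H n (Or.inr rfl)⟩,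
        fun H j hj => hj.elim (H.1 j) fun e => e ▸ H.2⟩
    rw [this, h.measure_inter hp (S := ⋃ j ∈ Finset.range n, ↑(D j)) (S' := ↑(D n)) (hmeas n)
      (measurableSet_forall_true _).compl, pow_succ]
    · gcongr
      rw [prob_compl_eq_one_sub (measurableSet_forall_true _), h.measure_forall_true, hm]
    · intro ω ω' hω
      simp only [mem_iUnion, Finset.mem_range, Finset.mem_coe, mem_ofPred_eq] at hω ⊢
      refine propext (forall₂_congr fun j hj => not_congr (forall₂_congr fun x hx => ?_))
      rw [hω x ⟨j, hj, hx⟩]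
    · intro ω ω' hω
      simp only [mem_compl_iff, mem_ofPred_eq]
      refine propext (not_congr (forall₂_congr fun x hx => ?_))
      rw [hω x hx]
    · rw [Set.disjoint_iUnion₂_left]
      exact fun j hj => Finset.disjoint_coe.2 (hD (Finset.mem_range.1 hj).ne)

end Independence

section Environment

variable {p : ℝ} {μ : Measure (Site → Bool)}

theorem IsBernoulli.measure_no_run_le (h : IsBernoulli p μ) (hp : p ∈ Icc (0 : ℝ) 1) {w : Site}
    (hw : w ≠ 0) (z : Site) (R κ : ℕ) :
    μ {ω | ∀ j < κ, ¬∀ i < R, z + ((j * R + i : ℕ) : ℤ) • w ∈ siteSet ω} ≤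
      (1 - ENNReal.ofReal p ^ R) ^ κ := by
  classical
  have hinj : Function.Injective fun n : ℕ => z + (n : ℤ) • w := fun m n hmn => by
    have := smul_left_injective ℤ hw (add_left_cancel hmn)
    exact_mod_cast this
  refine le_trans (le_of_eq ?_) (h.measure_forall_not_le hp
    (D := fun j => (Finset.range R).image fun i => z + ((j * R + i : ℕ) : ℤ) • w) ?_
    (fun j => ?_) κ)
  · congr 1
    ext ω
    simp [siteSet]
  · intro j j' hjj
    rw [Finset.disjoint_left]
    simp only [Finset.mem_image, Finset.mem_range, not_exists, not_and]
    rintro _ ⟨i, hi, rfl⟩ i' hi' he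
    have he' := hinj he
    apply hjj
    have h1 := congrArg (· / R) he'
    have hR : 0 < R := by omega
    simp only [Nat.mul_comm _ R, Nat.mul_add_div hR, Nat.div_eq_of_lt hi, Nat.div_eq_of_lt hi'] at h1
    omega
  · rw [Finset.card_image_of_injective, Finset.card_range]
    intro i i' hii
    have := hinj hii
    omega

theorem exists_pow_sqrt_le {q : ℝ} (hq0 : 0 ≤ q) (hq1 : q < 1) {K : ℕ} (hK : 0 < K) :
    ∃ C : ℝ, 0 ≤ C ∧ ∀ b : ℕ, q ^ (Nat.sqrt b / K) ≤ C * (((b : ℝ) + 1) ^ 4)⁻¹ := by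
  have hlim := tendsto_pow_const_mul_const_pow_of_abs_lt_one 8 (r := q)
    (by rwa [abs_of_nonneg hq0])
  obtain ⟨C₀, hC₀⟩ := ((Filter.tendsto_add_atTop_iff_nat 1).2 hlim).bddAbove_range
  have hC : ∀ n : ℕ, ((n : ℝ) + 1) ^ 8 * q ^ (n + 1) ≤ C₀ := fun n => by
    simpa using hC₀ ⟨n, rfl⟩
  rcases hq0.eq_or_lt with rfl | hqpos
  · refine ⟨((K : ℝ) ^ 2) ^ 4, by positivity, fun b => ?_⟩
    rw [← div_eq_mul_inv, le_div_iff₀ (by positivity)]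
    rcases Nat.eq_zero_or_pos (Nat.sqrt b / K) with h0 | h0
    · rw [h0, pow_zero, one_mul]
      have h1 : Nat.sqrt b + 1 ≤ K := by
        rw [Nat.div_eq_zero_iff] at h0
        omega
      have h2 : b + 1 ≤ K ^ 2 := by
        have := Nat.lt_succ_sqrt' b
        exact this.trans_le (Nat.pow_le_pow_left h1 2)
      have h3 : (b : ℝ) + 1 ≤ K ^ 2 := by exact_mod_cast h2
      gcongr
    · rw [zero_pow h0.ne', zero_mul]
      positivity
  · have hC0 : 0 ≤ C₀ := le_trans (by positivity) (hC 0)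
    refine ⟨((K : ℝ) ^ 2) ^ 4 * (C₀ / q), by positivity, fun b => ?_⟩
    rw [← div_eq_mul_inv, le_div_iff₀ (by positivity)]
    set κ := Nat.sqrt b / K
    have h1 : Nat.sqrt b + 1 ≤ K * (κ + 1) := Nat.lt_mul_div_succ _ hK
    have h2 : b + 1 ≤ (K * (κ + 1)) ^ 2 := by
      have := Nat.lt_succ_sqrt' b
      exact this.trans_le (Nat.pow_le_pow_left h1 2)
    have h3 : (b : ℝ) + 1 ≤ (K * (κ + 1)) ^ 2 := by exact_mod_cast h2
    calc q ^ κ * ((b : ℝ) + 1) ^ 4 ≤ q ^ κ * ((K * (κ + 1)) ^ 2) ^ 4 := by gcongr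
      _ = ((K : ℝ) ^ 2) ^ 4 * (((κ : ℝ) + 1) ^ 8 * q ^ (κ + 1) / q) := by
        field_simp
        ring
      _ ≤ ((K : ℝ) ^ 2) ^ 4 * (C₀ / q) := by
        gcongr
        exact hC κ

theorem summable_inv_sq_int : Summable fun a : ℤ => ((|(a : ℝ)| + 1) ^ 2)⁻¹ := by
  have h : Summable fun n : ℕ => (((n : ℝ) + 1) ^ 2)⁻¹ := by
    have := (summable_nat_add_iff 1).2 (Real.summable_nat_pow_inv.2 one_lt_two)
    simpa using this
  exact Summable.of_nat_of_neg (by simpa using h) (by simpa using h)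

theorem IsBernoulli.exists_measure_not_hasRuns_le (h : IsBernoulli p μ) (hp : p ∈ Ioc (0 : ℝ) 1)
    {W : Finset Site} (hW : ∀ w ∈ W, w ≠ 0) (R : ℕ) {K : ℕ} (hK : 0 < K) {η : ENNReal}
    (hη : η ≠ 0) : ∃ B : ℤ, 0 ≤ B ∧ ∀ v : Site,
      μ {ω | ¬HasRuns {y | y + v ∈ siteSet ω} W R K B} ≤ η := by
  have hp' : p ∈ Icc (0 : ℝ) 1 := ⟨hp.1.le, hp.2⟩
  obtain ⟨C, hC0, hC⟩ := exists_pow_sqrt_le (q := 1 - p ^ R)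
    (by linarith [pow_le_one₀ hp.1.le hp.2 (n := R)]) (by linarith [pow_pos hp.1 R]) hK
  set f : ℤ → ℝ := fun a => ((|(a : ℝ)| + 1) ^ 2)⁻¹ with hf
  have hf0 : ∀ a, 0 ≤ f a := fun a => by positivity
  have hsum : Summable fun z : Site => C * (f z.1 * f z.2) :=
    (summable_inv_sq_int.mul_of_nonneg summable_inv_sq_int hf0 hf0).mul_left C
  set F : Site → ENNReal := fun z => W.card * ENNReal.ofReal (C * (f z.1 * f z.2)) with hF
  have hFsum : ∑' z, F z ≠ ⊤ := by
    rw [hF, ENNReal.tsum_mul_left, ← ENNReal.ofReal_tsum_of_nonneg _ hsum]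
    · exact ENNReal.mul_ne_top (by simp) (by simp)
    · exact fun z => mul_nonneg hC0 (mul_nonneg (hf0 _) (hf0 _))
  obtain ⟨s, hs⟩ := ((ENNReal.tendsto_tsum_compl_atTop_zero hFsum).eventually_lt_const
    hη.bot_lt).exists
  refine ⟨(s.sup fun z => z.2.natAbs) + 1, by positivity, fun v => ?_⟩
  let fail : Site → Set (Site → Bool) := fun z => {ω | |z.1| ≤ z.2 ∧ ∃ w ∈ W,
    ∀ j < Nat.sqrt z.2.toNat / K, ¬∀ i < R, z + v + ((j * R + i : ℕ) : ℤ) • w ∈ siteSet ω}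
  have hfail : ∀ z, μ (fail z) ≤ F z := by
    intro z
    by_cases hz : |z.1| ≤ z.2
    · have hsub : fail z ⊆ ⋃ w ∈ W, {ω | ∀ j < Nat.sqrt z.2.toNat / K,
          ¬∀ i < R, z + v + ((j * R + i : ℕ) : ℤ) • w ∈ siteSet ω} := by
        rintro ω ⟨-, w, hw, hω⟩
        exact mem_biUnion hw hω
      refine (measure_mono hsub).trans ((measure_biUnion_finset_le _ _).trans ?_)
      rw [hF]
      simp only
      rw [← nsmul_eq_mul]
      refine Finset.sum_le_card_nsmul _ _ _ fun w hw => ?_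
      refine (h.measure_no_run_le hp' (hW w hw) _ _ _).trans ?_
      rw [← ENNReal.ofReal_pow hp.1.le, ← ENNReal.ofReal_one,
        ← ENNReal.ofReal_sub _ (pow_nonneg hp.1.le R), ← ENNReal.ofReal_pow
          (by linarith [pow_le_one₀ hp.1.le hp.2 (n := R)])]
      refine ENNReal.ofReal_le_ofReal ((hC _).trans ?_)
      have hz0 : 0 ≤ z.2 := (abs_nonneg _).trans hz
      have hb : ((z.2.toNat : ℕ) : ℝ) = |(z.2 : ℝ)| := by
        rw [← Int.cast_abs, abs_of_nonneg hz0]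
        exact_mod_cast Int.toNat_of_nonneg hz0
      have ha : |(z.1 : ℝ)| ≤ |(z.2 : ℝ)| := by
        have : |(z.1 : ℝ)| ≤ z.2 := by exact_mod_cast hz
        exact this.trans (le_abs_self _)
      rw [hb, hf]
      simp only
      rw [← mul_inv]
      gcongr
      calc (|(z.1 : ℝ)| + 1) ^ 2 * (|(z.2 : ℝ)| + 1) ^ 2
          ≤ (|(z.2 : ℝ)| + 1) ^ 2 * (|(z.2 : ℝ)| + 1) ^ 2 := by gcongr
        _ = (|(z.2 : ℝ)| + 1) ^ 4 := by ring
    · have : fail z = ∅ := by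
        ext ω
        simp [fail, hz]
      simp [this]
  calc μ {ω | ¬HasRuns {y | y + v ∈ siteSet ω} W R K (((s.sup fun z => z.2.natAbs) + 1 : ℕ) : ℤ)}
      ≤ μ (⋃ z : {z // z ∉ s}, fail z) := by
        refine measure_mono fun ω hω => ?_
        simp only [HasRuns, mem_ofPred_eq, not_forall, not_exists, not_and] at hω
        obtain ⟨z, hz1, hz2, w, hw, hω⟩ := hω
        refine mem_iUnion.2 ⟨⟨z, fun hzs => ?_⟩, hz2, w, hw, fun j hj hall => ?_⟩
        · have := Finset.le_sup (f := fun z : Site => z.2.natAbs) hzs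
          omega
        · obtain ⟨i, hi, hni⟩ := hω j hj
          exact hni (by rw [add_right_comm]; exact hall i hi)
    _ ≤ ∑' z : {z // z ∉ s}, μ (fail z) := measure_iUnion_le _
    _ ≤ ∑' z : {z // z ∉ s}, F z := ENNReal.tsum_le_tsum fun z => hfail z
    _ ≤ η := hs.le

end Environment

section Percolation

variable {U : Finset (Finset Site)} {p : ℝ} {μ : Measure (Site → Bool)}

/-- If the blocks `D j` with `j ≥ k` are independent of the likely events `G k`, then almost
surely up to `ε` some fully occupied block `D k` comes with `G k`. -/
theorem IsBernoulli.measure_forall_not_inter_le (h : IsBernoulli p μ) (hp : p ∈ Ioc (0 : ℝ) 1)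
    {D : ℕ → Finset Site} (hD : Pairwise fun i j => Disjoint (D i) (D j)) {m : ℕ}
    (hm : ∀ i, (D i).card = m) {G : ℕ → Set (Site → Bool)} (hG : ∀ k, MeasurableSet (G k))
    {T : ℕ → Set Site} (hGT : ∀ k, DependsOn (· ∈ G k) (T k))
    (hT : ∀ k j, k ≤ j → Disjoint (↑(D j)) (T k)) {ε : ENNReal} (hε : ∀ k, μ (G k)ᶜ ≤ ε) :
    μ {ω | ∀ k, ¬((∀ x ∈ D k, ω x = true) ∧ ω ∈ G k)} ≤ ε := by
  have hprob := h.isProbabilityMeasure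
  have hp' : p ∈ Icc (0 : ℝ) 1 := ⟨hp.1.le, hp.2⟩
  let S : ℕ → Set (Site → Bool) := fun k => {ω | ∀ x ∈ D k, ω x = true}
  have hS : ∀ k, MeasurableSet (S k) := fun k => measurableSet_forall_true _
  have hSdep : ∀ k ω ω', (∀ x ∈ D k, ω x = ω' x) → (ω ∈ S k ↔ ω' ∈ S k) := fun k ω ω' H =>
    forall₂_congr fun x hx => by rw [H x hx]
  have hbound : ∀ n, μ {ω | ∀ k, ¬((∀ x ∈ D k, ω x = true) ∧ ω ∈ G k)} ≤
      (1 - ENNReal.ofReal p ^ m) ^ n + ε := by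
    intro n
    let F : ℕ → Set (Site → Bool) := fun k => S k ∩ ⋂ j ∈ Finset.Ioo k n, (S j)ᶜ
    have hF : ∀ k, MeasurableSet (F k) := fun k =>
      (hS k).inter (Finset.measurableSet_biInter _ fun j _ => (hS j).compl)
    have hFdep : ∀ k, DependsOn (· ∈ F k) (⋃ j ∈ Ici k, (D j : Set Site)) := by
      intro k ω ω' H
      simp only [mem_iUnion, mem_Ici, Finset.mem_coe] at H
      refine propext ?_
      simp only [F, mem_inter_iff, mem_iInter, mem_compl_iff]
      refine and_congr (hSdep k ω ω' fun x hx => H x ⟨k, le_rfl, hx⟩)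
        (forall₂_congr fun j hj => not_congr (hSdep j ω ω' fun x hx =>
          H x ⟨j, (Finset.mem_Ioo.1 hj).1.le, hx⟩))
    have hFdisj : ∀ i j, i < j → j < n → Disjoint (F i) (F j) := by
      intro i j hij hj
      rw [Set.disjoint_left]
      intro ω hi hj'
      exact mem_iInter₂.1 hi.2 j (Finset.mem_Ioo.2 ⟨hij, hj⟩) hj'.1
    have hcover : {ω | ∀ k, ¬((∀ x ∈ D k, ω x = true) ∧ ω ∈ G k)} ⊆
        {ω | ∀ j < n, ¬∀ x ∈ D j, ω x = true} ∪ ⋃ k ∈ Finset.range n, F k ∩ (G k)ᶜ := by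
      classical
      intro ω hω
      by_cases hex : ((Finset.range n).filter fun k => ω ∈ S k).Nonempty
      · obtain ⟨k, hk, hmax⟩ := Finset.exists_max_image _ id hex
        rw [Finset.mem_filter] at hk
        refine Or.inr (mem_biUnion (x := k) hk.1 ⟨⟨hk.2, ?_⟩, fun hg => hω k ⟨hk.2, hg⟩⟩)
        refine mem_iInter₂.2 fun j hj hSj => ?_
        rw [Finset.mem_Ioo] at hj
        have := hmax j (Finset.mem_filter.2 ⟨Finset.mem_range.2 hj.2, hSj⟩)
        simp only [id] at this
        omega
      · rw [Finset.not_nonempty_iff_eq_empty, Finset.filter_eq_empty_iff] at hex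
        exact Or.inl fun j hj => hex (Finset.mem_range.2 hj)
    calc μ {ω | ∀ k, ¬((∀ x ∈ D k, ω x = true) ∧ ω ∈ G k)}
        ≤ μ {ω | ∀ j < n, ¬∀ x ∈ D j, ω x = true} +
            μ (⋃ k ∈ Finset.range n, F k ∩ (G k)ᶜ) :=
          (measure_mono hcover).trans (measure_union_le _ _)
      _ ≤ (1 - ENNReal.ofReal p ^ m) ^ n + ∑ k ∈ Finset.range n, μ (F k ∩ (G k)ᶜ) := by
          gcongr
          · exact h.measure_forall_not_le hp' hD hm n
          · exact measure_biUnion_finset_le _ _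
      _ ≤ (1 - ENNReal.ofReal p ^ m) ^ n + ∑ k ∈ Finset.range n, μ (F k) * ε := by
          gcongr with k _
          rw [h.measure_inter hp' (hF k) (hG k).compl (hFdep k) (S' := T k)]
          · gcongr
            exact hε k
          · intro ω ω' H
            exact congrArg Not (hGT k H)
          · rw [Set.disjoint_iUnion₂_left]
            exact fun j hj => hT k j hj
      _ = (1 - ENNReal.ofReal p ^ m) ^ n + μ (⋃ k ∈ Finset.range n, F k) * ε := by
          rw [← Finset.sum_mul, measure_biUnion_finset _ fun k _ => hF k]
          intro i hi j hj hij
          rw [Finset.mem_coe, Finset.mem_range] at hi hj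
          rcases hij.lt_or_gt with hlt | hlt
          · exact hFdisj i j hlt hj
          · exact (hFdisj j i hlt hi).symm
      _ ≤ (1 - ENNReal.ofReal p ^ m) ^ n + 1 * ε := by
          gcongr
          exact prob_le_one
      _ = _ := by rw [one_mul]
  have hlim : Filter.Tendsto (fun n => (1 - ENNReal.ofReal p ^ m) ^ n + ε) Filter.atTop
      (nhds (0 + ε)) := by
    refine (ENNReal.tendsto_pow_atTop_nhds_zero_of_lt_one ?_).add tendsto_const_nhds
    exact ENNReal.sub_lt_self (by simp) (by simp)
      (pow_ne_zero m (ENNReal.ofReal_pos.2 hp.1).ne')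
  rw [zero_add] at hlim
  exact ge_of_tendsto' hlim hbound

theorem add_mem_bsClosure {A : Set Site} {v y : Site}
    (hy : y ∈ bsClosure U {y | y + v ∈ A}) : y + v ∈ bsClosure U A := by
  refine bsClosure_subset (B := {y | y + v ∈ bsClosure U A})
    (fun z hz => subset_bsClosure hz) (fun X hX x H => mem_bsClosure_of_rule hX fun z hz => ?_) hy
  rw [← add_assoc]
  exact H z hz

theorem HasRuns.mono {A A' : Set Site} {W : Finset Site} {R K : ℕ} {B : ℤ}
    (h : HasRuns A W R K B) (hA : A ⊆ A') : HasRuns A' W R K B := fun z hz hz' w hw =>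
  (h z hz hz' w hw).imp fun _ hj => ⟨hj.1, fun i hi => hA (hj.2 i hi)⟩

theorem HasRuns.inter_upper {A : Set Site} {W : Finset Site} {R K : ℕ} {B : ℤ}
    (h : HasRuns A W R K B) (hW : ∀ w ∈ W, R * w.2.natAbs ≤ K) :
    HasRuns (A ∩ {y | 0 ≤ y.2}) W R K B := by
  intro z hz hz' w hw
  obtain ⟨j, hj, hA⟩ := h z hz hz' w hw
  refine ⟨j, hj, fun i hi => ⟨hA i hi, ?_⟩⟩
  have hz0 : 0 ≤ z.2 := (abs_nonneg _).trans hz'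
  have h1 : (j * R + i) * w.2.natAbs ≤ z.2.toNat := calc
    (j * R + i) * w.2.natAbs ≤ (j + 1) * R * w.2.natAbs := by gcongr; linarith
    _ = (j + 1) * (R * w.2.natAbs) := by ring
    _ ≤ (Nat.sqrt z.2.toNat / K) * K := Nat.mul_le_mul hj (hW w hw)
    _ ≤ Nat.sqrt z.2.toNat := Nat.div_mul_le_self _ _
    _ ≤ z.2.toNat := Nat.sqrt_le_self _
  have h2 : ((j * R + i : ℕ) : ℤ) * |w.2| ≤ z.2 := by
    rw [← Int.toNat_of_nonneg hz0, Int.abs_eq_natAbs]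
    exact_mod_cast h1
  have h3 : -(((j * R + i : ℕ) : ℤ) * |w.2|) ≤ ((j * R + i : ℕ) : ℤ) * w.2 := by
    rw [← mul_neg]
    exact mul_le_mul_of_nonneg_left (neg_abs_le _) (by positivity)
  simp only [mem_ofPred_eq, Prod.snd_add, Prod.smul_snd, smul_eq_mul]
  linarith

theorem measurableSet_hasRuns (A : (Site → Bool) → Set Site)
    (hA : ∀ x, MeasurableSet {ω | x ∈ A ω}) (W : Finset Site) (R K : ℕ) (B : ℤ) :
    MeasurableSet {ω | HasRuns (A ω) W R K B} := by
  unfold HasRuns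
  refine measurableSet_setOfPred.2 (Measurable.forall fun z => Measurable.imp measurable_const
    (Measurable.imp measurable_const (Measurable.forall fun w => Measurable.imp measurable_const
      (Measurable.exists fun j => Measurable.and measurable_const
        (Measurable.forall fun i => Measurable.imp measurable_const
          (measurableSet_setOfPred.1 (hA _)))))))

variable {Sl : Finset ℝ} {T S δ : ℝ} {r : ℕ}

theorem IsBernoulli.measure_not_mem_bsClosure (h : IsBernoulli p μ) (hp : p ∈ Ioc (0 : ℝ) 1)
    (hF : IsFrame U Sl T S δ r) (x : Site) : μ {ω | x ∉ bsClosure U (siteSet ω)} = 0 := by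
  classical
  obtain ⟨W, R, K, -, hK, hW, hseed⟩ := hF.exists_seed
  refine le_antisymm (le_of_forall_pos_le_add fun ε hε => ?_) zero_le
  rw [zero_add]
  obtain ⟨B, hB0, hB⟩ := h.exists_measure_not_hasRuns_le hp (fun w hw => (hW w hw).1) R hK hε.ne'
  obtain ⟨Seed, hpos, hSeed⟩ := hseed B
  obtain ⟨M, hM0, hM⟩ : ∃ M : ℕ, 0 < M ∧ ∀ y ∈ Seed, y.2 < M := by
    refine ⟨(Seed.sup fun y => y.2.natAbs) + 1, Nat.succ_pos _, fun y hy => ?_⟩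
    have := Finset.le_sup (f := fun y : Site => y.2.natAbs) hy
    omega
  let v : ℕ → Site := fun k => x - (0, ((k * M : ℕ) : ℤ))
  have hv2 : ∀ k, (v k).2 = x.2 - (k * M : ℕ) := fun k => rfl
  let D : ℕ → Finset Site := fun k => Seed.image (· + v k)
  have hDmem : ∀ k y, y ∈ D k ↔ ∃ z ∈ Seed, z + v k = y := fun k y => Finset.mem_image
  let A : ℕ → (Site → Bool) → Set Site := fun k ω =>
    ({y | y + v k ∈ siteSet ω} ∩ {y | 0 ≤ y.2}) ∪ ↑Seed
  let G : ℕ → Set (Site → Bool) := fun k => {ω | HasRuns (A k ω) W R K B}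
  have hheight : ∀ k j, k < j → ∀ y ∈ D j, y.2 < (v k).2 := by
    intro k j hkj y hy
    obtain ⟨z, hz, rfl⟩ := (hDmem j y).1 hy
    have h1 := hM z hz
    have h2 : (k + 1) * M ≤ j * M := Nat.mul_le_mul_right _ hkj
    have h3 : (((k + 1) * M : ℕ) : ℤ) ≤ (j * M : ℕ) := by exact_mod_cast h2
    rw [Prod.snd_add, hv2, hv2]
    push_cast at h3 ⊢
    linarith
  have hlow : ∀ k, ∀ y ∈ D k, (v k).2 ≤ y.2 := by
    intro k y hy
    obtain ⟨z, hz, rfl⟩ := (hDmem k y).1 hy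
    have := hpos z hz
    rw [Prod.snd_add]
    linarith
  have hD : ∀ i j, i < j → Disjoint (D i) (D j) := fun i j hij =>
    Finset.disjoint_left.2 fun y hi hj => (hheight i j hij y hj).not_ge (hlow i y hi)
  refine le_trans (measure_mono ?_) (h.measure_forall_not_inter_le hp (D := D) (m := Seed.card)
    (G := G) (T := fun k => {y | (v k).2 ≤ y.2 ∧ y ∉ D k}) (ε := ε) ?_ ?_ ?_ ?_ ?_ ?_)
  · rintro ω hω k ⟨hS, hG⟩
    apply hω
    have h1 : A k ω ⊆ {y | y + v k ∈ siteSet ω} := by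
      rintro y (hy | hy)
      · exact hy.1
      · exact hS _ ((hDmem k _).2 ⟨y, hy, rfl⟩)
    have h2 : ((0, ((k * M : ℕ) : ℤ)) : Site) ∈ bsClosure U {y | y + v k ∈ siteSet ω} := by
      refine hSeed _ (subset_union_right.trans h1) (HasRuns.mono hG h1) ?_
      simp only [parabola, mem_ofPred_eq]
      positivity
    have h3 := add_mem_bsClosure h2
    rwa [add_sub_cancel] at h3
  · intro i j hij
    rcases hij.lt_or_gt with hlt | hlt
    · exact hD i j hlt
    · exact (hD j i hlt).symm
  · exact fun k => Finset.card_image_of_injective _ (add_left_injective _)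
  · refine fun k => measurableSet_hasRuns _ (fun y => ?_) W R K B
    have h1 : MeasurableSet {ω : Site → Bool | y + v k ∈ siteSet ω} :=
      measurableSet_eq_fun (measurable_pi_apply (y + v k)) measurable_const
    exact (h1.inter (MeasurableSet.const (0 ≤ y.2))).union (MeasurableSet.const (y ∈ Seed))
  · intro k ω ω' H
    have : A k ω = A k ω' := by
      ext y
      by_cases hy : y ∈ Seed
      · simp [A, hy]
      · by_cases hy0 : 0 ≤ y.2
        · have := H (y + v k) ⟨by rw [Prod.snd_add]; linarith, fun hmem => ?_⟩
          · simp [A, hy, siteSet, this]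
          · obtain ⟨z, hz, hzy⟩ := (hDmem k _).1 hmem
            exact hy (add_right_cancel hzy ▸ hz)
        · simp [A, hy, hy0]
    exact congrArg (fun A => HasRuns A W R K B) this
  · intro k j hkj
    rw [Set.disjoint_left]
    rintro y hy ⟨h1, h2⟩
    rcases hkj.eq_or_lt with rfl | hlt
    · exact h2 hy
    · exact (hheight k j hlt y hy).not_ge h1
  · refine fun k => (measure_mono fun ω hω => ?_).trans (hB (v k))
    rw [mem_ofPred_eq]
    exact fun hruns => hω <| (hruns.inter_upper fun w hw => (hW w hw).2).mono subset_union_left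

theorem IsBernoulli.ae_percolates_of_isFrame (h : IsBernoulli p μ) (hp : p ∈ Ioc (0 : ℝ) 1)
    (hF : IsFrame U Sl T S δ r) : ∀ᵐ ω ∂μ, Percolates U (siteSet ω) := by
  have h1 : ∀ᵐ ω ∂μ, ∀ x, x ∈ bsClosure U (siteSet ω) :=
    ae_all_iff.2 fun x => h.measure_not_mem_bsClosure hp hF x
  exact h1.mono fun ω hω => eq_univ_of_forall hω

end Percolation

section Transport

variable {U : Finset (Finset Site)} {p : ℝ} {μ : Measure (Site → Bool)}

theorem IsBernoulli.map_equiv (h : IsBernoulli p μ) (e : Site ≃ Site) :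
    IsBernoulli p (μ.map fun ω x => ω (e.symm x)) := by
  intro s f
  rw [Measure.map_apply (measurable_pi_lambda _ fun x => measurable_pi_apply _)
    (measurableSet_cyl s f)]
  have := h (s.map e.symm.toEmbedding) fun x => f (e x)
  simp only [Finset.prod_map, Equiv.coe_toEmbedding, Equiv.apply_symm_apply, Finset.mem_map,
    forall_exists_index, and_imp, forall_apply_eq_imp_iff₂] at this
  exact this

/-- The additive automorphism of `ℤ²` whose matrix has rows `α` and `β`. -/
def basisEquiv (α β : Site) (h : α.1 * β.2 - α.2 * β.1 = 1) : Site ≃+ Site where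
  toFun x := (α.1 * x.1 + α.2 * x.2, β.1 * x.1 + β.2 * x.2)
  invFun y := (β.2 * y.1 - α.2 * y.2, -(β.1 * y.1) + α.1 * y.2)
  left_inv x := by
    ext
    · linear_combination x.1 * h
    · linear_combination x.2 * h
  right_inv y := by
    ext
    · linear_combination y.1 * h
    · linear_combination y.2 * h
  map_add' x y := by
    ext
    · simp only [Prod.fst_add, Prod.snd_add]; ring
    · simp only [Prod.fst_add, Prod.snd_add]; ring

theorem slopeForm_basisEquiv {α β : Site} (h : α.1 * β.2 - α.2 * β.1 = 1) (c : ℝ) (y : Site) :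
    slopeForm c (basisEquiv α β h y) = pairing y (toPlane β) + c * pairing y (toPlane α) := by
  simp only [slopeForm, basisEquiv, pairing, toPlane, AddEquiv.coe_mk, Equiv.coe_fn_mk]
  push_cast
  ring

theorem Percolates.of_image (e : Site ≃+ Site) {A : Set Site}
    (h : Percolates (U.image fun X => X.image e) {x | e.symm x ∈ A}) : Percolates U A := by
  have hsub : bsClosure (U.image fun X => X.image e) {x | e.symm x ∈ A} ⊆
      {x | e.symm x ∈ bsClosure U A} := by
    refine bsClosure_subset (fun x hx => subset_bsClosure hx) fun X' hX' x H => ?_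
    obtain ⟨X, hX, rfl⟩ := Finset.mem_image.1 hX'
    refine mem_bsClosure_of_rule hX fun y hy => ?_
    simpa using H (e y) (Finset.mem_image_of_mem e hy)
  refine eq_univ_of_forall fun x => ?_
  have := hsub (h.symm ▸ mem_univ (e x))
  simpa using this

theorem IsBernoulli.measure_percolates_of_not_subcritical (h : IsBernoulli p μ)
    (hp : p ∈ Ioc (0 : ℝ) 1) (hU : IsUpdateFamily U) (hsub : ¬Subcritical U) :
    μ {ω | Percolates U (siteSet ω)} = 1 := by
  obtain ⟨α, β, hdet, hP⟩ := exists_basis_of_not_subcritical hU hsub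
  set e := basisEquiv α β hdet
  obtain ⟨Sl, T, S, δ, r, hF⟩ := exists_isFrame (U := U.image fun X => X.image e) fun s t hst => by
    obtain ⟨c, hc, X, hX, hneg⟩ := hP s t hst
    refine ⟨c, hc, X.image e, Finset.mem_image_of_mem _ hX, fun y' hy' => ?_⟩
    obtain ⟨y, hy, rfl⟩ := Finset.mem_image.1 hy'
    rw [slopeForm_basisEquiv]
    exact hneg y hy
  have hmeas : Measurable fun (ω : Site → Bool) x => ω (e.symm x) :=
    measurable_pi_lambda _ fun x => measurable_pi_apply _
  have h1 := ae_of_ae_map hmeas.aemeasurable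
    ((h.map_equiv e.toEquiv).ae_percolates_of_isFrame hp hF)
  have hprob := h.isProbabilityMeasure
  rw [← measure_univ (μ := μ)]
  exact measure_congr (Filter.eventuallyEq_univ.2 (h1.mono fun ω hω => Percolates.of_image e hω))

theorem subcritical_of_critProb_pos (hU : IsUpdateFamily U) (h : 0 < critProb U) :
    Subcritical U := by
  by_contra hsub
  set p := min (critProb U / 2) 1
  have hp : p ∈ Ioc (0 : ℝ) 1 := ⟨lt_min (half_pos h) one_pos, min_le_right _ _⟩
  have hle : critProb U ≤ p := csInf_le ⟨0, fun q hq => hq.1.1⟩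
    ⟨⟨hp.1.le, hp.2⟩, fun μ hμ => hμ.measure_percolates_of_not_subcritical hp hU hsub⟩
  have : p ≤ critProb U / 2 := min_le_left _ _
  linarith

end Transport

/-- Let `U` be an update family in two dimensions.
Then `p_c(ℤ², U) > 0` if and only if `U` is subcritical. -/
theorem critProb_pos_iff_subcritical
    (U : Finset (Finset Site)) (hU : IsUpdateFamily U) :
    0 < critProb U ↔ Subcritical U :=
  ⟨subcritical_of_critProb_pos hU, fun h => h.critProb_pos hU⟩
end

section
/- Let U₁ = {X_1, X_2, X_3} with X_1 = {(1,0),(0,1)}, X_2 = {(−1,−1),(0,1)} and X_3 = {(−1,−1),(1,0)} (the update family equivalent to 2-neighbour bootstrap percolation on the directed triangular lattice). Then p_c(ℤ², U₁) > 10^{−101}. -/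
open Set MeasureTheory

/-- The update family equivalent to 2-neighbour bootstrap percolation on the directed
triangular lattice (DTBP). -/
def dtbpFamily : Finset (Finset Site) :=
  { {((1 : ℤ), (0 : ℤ)), ((0 : ℤ), (1 : ℤ))},
    {((-1 : ℤ), (-1 : ℤ)), ((0 : ℤ), (1 : ℤ))},
    {((-1 : ℤ), (-1 : ℤ)), ((1 : ℤ), (0 : ℤ))} }

namespace Dtbp

/-! ### Derivations of infected sites -/

/-- `Derivable A V`: the sites of `V` can be added one at a time, each one being either initially
infected or infected by an update rule contained in the sites added before. -/
inductive Derivable (A : Set Site) : Finset Site → Prop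
  | empty : Derivable A ∅
  | seed {V : Finset Site} {x : Site} (hV : Derivable A V) (hx : x ∉ V) (hA : x ∈ A) :
      Derivable A (insert x V)
  | rule {V : Finset Site} {x : Site} {X : Finset Site} (hV : Derivable A V) (hx : x ∉ V)
      (hX : X ∈ dtbpFamily) (h : ∀ y ∈ X, y + x ∈ V) : Derivable A (insert x V)

theorem Derivable.union {A : Set Site} {V W : Finset Site} (hV : Derivable A V)
    (hW : Derivable A W) : Derivable A (V ∪ W) := by
  induction hW with
  | empty => simpa using hV
  | @seed W x _ hx hA ih =>
    rw [Finset.union_insert]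
    by_cases h : x ∈ V ∪ W
    · rwa [Finset.insert_eq_of_mem h]
    · exact ih.seed h hA
  | @rule W x X _ hx hX h' ih =>
    rw [Finset.union_insert]
    by_cases h : x ∈ V ∪ W
    · rwa [Finset.insert_eq_of_mem h]
    · exact ih.rule h hX fun y hy => Finset.mem_union_right _ (h' y hy)

theorem exists_derivable_subset {A : Set Site} (X : Finset Site)
    (h : ∀ y ∈ X, ∃ V, Derivable A V ∧ y ∈ V) : ∃ V, Derivable A V ∧ X ⊆ V := by
  induction X using Finset.induction_on with
  | empty => exact ⟨∅, .empty, by simp⟩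
  | insert a s _ ih =>
    obtain ⟨V, hV, hs⟩ := ih fun y hy => h y (Finset.mem_insert_of_mem hy)
    obtain ⟨W, hW, ha⟩ := h a (Finset.mem_insert_self _ _)
    refine ⟨V ∪ W, hV.union hW, Finset.insert_subset (Finset.mem_union_right _ ha) ?_⟩
    exact hs.trans Finset.subset_union_left

theorem exists_derivable_of_mem_bsIter {A : Set Site} (n : ℕ) (x : Site)
    (hx : x ∈ bsIter dtbpFamily n A) : ∃ V, Derivable A V ∧ x ∈ V := by
  induction n generalizing x with
  | zero => exact ⟨insert x ∅, Derivable.empty.seed (by simp) hx, by simp⟩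
  | succ n ih =>
    rcases hx with hx | ⟨X, hX, h⟩
    · exact ih x hx
    · obtain ⟨V, hV, hs⟩ := exists_derivable_subset (A := A) (X.image (· + x)) (by
        intro y hy
        obtain ⟨z, hz, rfl⟩ := Finset.mem_image.1 hy
        exact ih _ (h z hz))
      by_cases hxV : x ∈ V
      · exact ⟨V, hV, hxV⟩
      · exact ⟨insert x V, hV.rule hxV hX fun y hy => hs (Finset.mem_image_of_mem _ hy),
          Finset.mem_insert_self _ _⟩

/-! ### The polar functions -/

/-- Three linear functionals with sum zero; each update rule contains, for every one of them,
a site at which it is at least one. -/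
def polar : Fin 3 → Site → ℤ
  | 0, x => -2 * x.1 + x.2
  | 1, x => x.1 - 2 * x.2
  | 2, x => x.1 + x.2

theorem sum_polar (x : Site) : ∑ s, polar s x = 0 := by
  simp only [Fin.sum_univ_three, polar]
  ring

/-- The nonzero steps of the triangular lattice, together with the zero step. -/
def steps : Finset Site :=
  {(0, 0), (1, 0), (0, 1), (-1, -1), (-1, 0), (0, -1), (1, 1)}

/-- The undirected triangular lattice. -/
def triGraph : SimpleGraph Site where
  Adj x y := x ≠ y ∧ y - x ∈ steps
  symm := ⟨fun x y h => by
    refine ⟨h.1.symm, ?_⟩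
    have h2 := h.2
    simp only [steps, Finset.mem_insert, Finset.mem_singleton, Prod.ext_iff, Prod.fst_sub,
      Prod.snd_sub] at h2 ⊢
    omega⟩
  loopless := ⟨fun x h => h.1 rfl⟩

theorem exists_parents {V : Finset Site} {x : Site} {X : Finset Site} (hX : X ∈ dtbpFamily)
    (h : ∀ y ∈ X, y + x ∈ V) :
    ∃ a ∈ V, ∃ b ∈ V, triGraph.Adj x a ∧ triGraph.Adj x b ∧
      (∀ s, polar s b ≤ polar s a + 3) ∧
      ∀ s, polar s x + 1 ≤ polar s a ∨ polar s x + 1 ≤ polar s b := by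
  obtain ⟨x1, x2⟩ := x
  simp only [dtbpFamily, Finset.mem_insert, Finset.mem_singleton] at hX
  rcases hX with rfl | rfl | rfl <;>
  · simp only [Finset.mem_insert, Finset.mem_singleton, forall_eq_or_imp, forall_eq] at h
    refine ⟨_, h.1, _, h.2, ?_, ?_, ?_, ?_⟩
    · refine ⟨by simp [Prod.ext_iff], by simp [steps]⟩
    · refine ⟨by simp [Prod.ext_iff], by simp [steps]⟩
    · intro s
      fin_cases s <;> simp [polar] <;> omega
    · intro s
      fin_cases s <;> simp [polar] <;> omega

/-! ### Explanations -/

/-- The sites `u s` lie on a closed walk in `C` visiting many initially infected sites. -/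
def ExplainedAt (A C : Set Site) (u : Fin 3 → Site) : Prop :=
  ∃ (v : Site) (c : triGraph.Walk v v) (S : Finset Site),
    (∀ s, u s ∈ c.support) ∧ (∀ w ∈ c.support, w ∈ C) ∧ (∀ w ∈ S, w ∈ c.support ∧ w ∈ A) ∧
    (c.length : ℤ) + 2 * ∑ s, polar s (u s) ≤ 22 * ((S.card : ℤ) - 1)

/-- Any three sites of `C` are explained by a closed walk in `C`. -/
def Explained (A C : Set Site) : Prop :=
  ∀ u : Fin 3 → Site, (∀ s, u s ∈ C) → ExplainedAt A C u

theorem ExplainedAt.mono {A C D : Set Site} {u : Fin 3 → Site} (h : ExplainedAt A C u)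
    (hCD : C ⊆ D) : ExplainedAt A D u := by
  obtain ⟨v, c, S, h1, h2, h3, h4⟩ := h
  exact ⟨v, c, S, h1, fun w hw => hCD (h2 w hw), h3, h4⟩

theorem explained_singleton {A : Set Site} {x : Site} (hx : x ∈ A) : Explained A {x} := by
  intro u hu
  obtain rfl : u = fun _ => x := funext hu
  refine ⟨x, .nil, {x}, by simp, by simp, by simpa using hx, ?_⟩
  simp [sum_polar]

/-- A closed walk, extended by an excursion to a neighbour of one of its sites. -/
theorem exists_walk_through {x y v : Site} (c : triGraph.Walk v v) (hy : y ∈ c.support)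
    (hxy : triGraph.Adj x y) :
    ∃ d : triGraph.Walk x x, d.length = c.length + 2 ∧
      ∀ w, w ∈ d.support ↔ w = x ∨ w ∈ c.support := by
  refine ⟨.cons hxy ((c.rotate y hy).concat hxy.symm), ?_, ?_⟩
  · simp
  · intro w
    simp [SimpleGraph.Walk.support_concat]
    tauto

theorem Explained.explainedAt_insert {A C : Set Site} {x : Site} {u f : Fin 3 → Site}
    (hC : Explained A C) (hfC : ∀ s, f s ∈ C)
    (hfx : ∀ s, u s = x → triGraph.Adj x (f s) ∧ polar s x + 1 ≤ polar s (f s))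
    (hfu : ∀ s, u s ≠ x → u s = f s) : ExplainedAt A (insert x C) u := by
  obtain ⟨v, c, S, h1, h2, h3, h4⟩ := hC f hfC
  by_cases hux : ∃ t, u t = x
  · obtain ⟨t, ht⟩ := hux
    obtain ⟨d, hd1, hd2⟩ := exists_walk_through c (h1 t) (hfx t ht).1
    refine ⟨x, d, S, ?_, ?_, fun w hw => ⟨(hd2 w).2 (Or.inr (h3 w hw).1), (h3 w hw).2⟩, ?_⟩
    · intro s
      by_cases hs : u s = x
      · exact (hd2 _).2 (Or.inl hs)
      · exact (hd2 _).2 (Or.inr (hfu s hs ▸ h1 s))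
    · intro w hw
      exact ((hd2 w).1 hw).imp id (h2 w)
    · have hlt : ∑ s, polar s (u s) < ∑ s, polar s (f s) := by
        refine Finset.sum_lt_sum (fun s _ => ?_) ⟨t, Finset.mem_univ _, ?_⟩
        · by_cases hs : u s = x
          · have := (hfx s hs).2
            rw [hs]
            omega
          · rw [hfu s hs]
        · have := (hfx t ht).2
          rw [ht]
          omega
      rw [hd1]
      push_cast
      omega
  · push Not at hux
    obtain rfl : u = f := funext fun s => hfu s (hux s)
    exact ⟨v, c, S, h1, fun w hw => Or.inr (h2 w hw), h3, h4⟩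

/-- Those of three sites of `insert x C` which equal `x` can be moved to parents of `x` in `C`,
increasing the corresponding polar functions. -/
theorem exists_moved {C : Set Site} {x a b : Site} {u : Fin 3 → Site} (ha : a ∈ C) (hb : b ∈ C)
    (hxa : triGraph.Adj x a) (hxb : triGraph.Adj x b)
    (hp : ∀ s, polar s x + 1 ≤ polar s a ∨ polar s x + 1 ≤ polar s b)
    (hu : ∀ s, u s ∈ insert x C) :
    ∃ f : Fin 3 → Site, (∀ s, f s ∈ C) ∧
      (∀ s, u s = x → triGraph.Adj x (f s) ∧ polar s x + 1 ≤ polar s (f s)) ∧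
      ∀ s, u s ≠ x → u s = f s := by
  have hf : ∀ s, ∃ y ∈ C, (u s = x → triGraph.Adj x y ∧ polar s x + 1 ≤ polar s y) ∧
      (u s ≠ x → u s = y) := by
    intro s
    by_cases hs : u s = x
    · rcases hp s with h | h
      · exact ⟨a, ha, fun _ => ⟨hxa, h⟩, fun h' => absurd hs h'⟩
      · exact ⟨b, hb, fun _ => ⟨hxb, h⟩, fun h' => absurd hs h'⟩
    · exact ⟨u s, (hu s).resolve_left hs, fun h => absurd h hs, fun _ => rfl⟩
  choose f hf1 hf2 hf3 using hf
  exact ⟨f, hf1, hf2, hf3⟩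

theorem Explained.insert_site {A C : Set Site} {x a b : Site} (hC : Explained A C)
    (ha : a ∈ C) (hb : b ∈ C) (hxa : triGraph.Adj x a)
    (hxb : triGraph.Adj x b)
    (hp : ∀ s, polar s x + 1 ≤ polar s a ∨ polar s x + 1 ≤ polar s b) :
    Explained A (insert x C) := by
  intro u hu
  obtain ⟨f, h1, h2, h3⟩ := exists_moved ha hb hxa hxb hp hu
  exact hC.explainedAt_insert h1 h2 h3

theorem Explained.join {A C D : Set Site} {x a b : Site} (hC : Explained A C)
    (hD : Explained A D) (hCD : Disjoint C D) (ha : a ∈ C) (hb : b ∈ D)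
    (hxa : triGraph.Adj x a) (hxb : triGraph.Adj x b) (hab : ∀ s, polar s b ≤ polar s a + 3)
    (hp : ∀ s, polar s x + 1 ≤ polar s a ∨ polar s x + 1 ≤ polar s b) :
    Explained A (insert x (C ∪ D)) := by
  intro u hu
  obtain ⟨f, hf1, hf2, hf3⟩ := exists_moved (C := C ∪ D) (Or.inl ha) (Or.inr hb) hxa hxb hp hu
  by_cases hfC : ∀ s, f s ∈ C
  · exact (hC.explainedAt_insert hfC hf2 hf3).mono (insert_subset_insert subset_union_left)
  by_cases hfD : ∀ s, f s ∈ D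
  · exact (hD.explainedAt_insert hfD hf2 hf3).mono (insert_subset_insert subset_union_right)
  push Not at hfC hfD
  obtain ⟨i, hi⟩ := hfC
  obtain ⟨j, hj⟩ := hfD
  have hf : ∀ s, ∃ y ∈ C, ∃ z ∈ D, polar s (f s) + polar s b ≤ polar s y + polar s z + 3 ∧
      (f s = y ∨ f s = z) ∧ (f s ∉ C → y = a) ∧ (f s ∉ D → z = b) := by
    intro s
    have := hab s
    by_cases hs : f s ∈ C
    · exact ⟨f s, hs, b, hb, by omega, Or.inl rfl, fun h => absurd hs h, fun _ => rfl⟩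
    · have hs' := (hf1 s).resolve_left hs
      exact ⟨a, ha, f s, hs', by omega, Or.inr rfl, fun _ => rfl, fun h => absurd hs' h⟩
  choose y hy z hz hyz hfyz hya hzb using hf
  obtain ⟨v, c, S, h1, h2, h3, h4⟩ := hC y hy
  obtain ⟨v', c', S', h1', h2', h3', h4'⟩ := hD z hz
  obtain ⟨d, hd1, hd2⟩ := exists_walk_through c (hya i hi ▸ h1 i) hxa
  obtain ⟨d', hd1', hd2'⟩ := exists_walk_through c' (hzb j hj ▸ h1' j) hxb
  have hmem : ∀ w, w ∈ (d.append d').support ↔ w = x ∨ w ∈ c.support ∨ w ∈ c'.support := by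
    intro w
    rw [SimpleGraph.Walk.mem_support_append_iff, hd2, hd2']
    tauto
  have hSS : Disjoint S S' := Finset.disjoint_left.2 fun w hw hw' =>
    Set.disjoint_left.1 hCD (h2 w (h3 w hw).1) (h2' w (h3' w hw').1)
  refine ⟨x, d.append d', S ∪ S', ?_, ?_, ?_, ?_⟩
  · intro s
    rw [hmem]
    by_cases hs : u s = x
    · exact Or.inl hs
    · rw [hf3 s hs]
      rcases hfyz s with h | h
      · exact Or.inr (Or.inl (h ▸ h1 s))
      · exact Or.inr (Or.inr (h ▸ h1' s))
  · intro w hw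
    exact ((hmem w).1 hw).imp id (Or.imp (h2 w) (h2' w))
  · intro w hw
    rw [hmem]
    rcases Finset.mem_union.1 hw with hw | hw
    · exact ⟨Or.inr (Or.inl (h3 w hw).1), (h3 w hw).2⟩
    · exact ⟨Or.inr (Or.inr (h3' w hw).1), (h3' w hw).2⟩
  · have hle : ∑ s, (polar s (u s) + polar s b) ≤ ∑ s, (polar s (y s) + polar s (z s) + 3) := by
      refine Finset.sum_le_sum fun s _ => le_trans ?_ (hyz s)
      by_cases hs : u s = x
      · have := (hf2 s hs).2
        rw [hs]
        omega
      · rw [hf3 s hs]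
    simp only [Finset.sum_add_distrib, sum_polar, Finset.sum_const, Finset.card_univ,
      Fintype.card_fin] at hle
    rw [SimpleGraph.Walk.length_append, hd1, hd1', Finset.card_union_of_disjoint hSS]
    push_cast
    simp at hle
    omega

/-- A derivation decomposes into disjoint explained clusters. -/
theorem Derivable.exists_partition {A : Set Site} {V : Finset Site} (hV : Derivable A V) :
    ∃ P : Set (Set Site), P.PairwiseDisjoint id ∧ (∀ C ∈ P, Explained A C) ∧ ⋃₀ P = ↑V := by
  induction hV with
  | empty => exact ⟨∅, by simp, by simp, by simp⟩
  | @seed V x _ hx hA ih =>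
    obtain ⟨P, hd, hP, hPV⟩ := ih
    refine ⟨insert {x} P, ?_, ?_, ?_⟩
    · refine hd.insert fun C hC _ => ?_
      refine disjoint_singleton_left.2 fun hxC => hx ?_
      rw [← Finset.mem_coe, ← hPV]
      exact ⟨C, hC, hxC⟩
    · rintro C (rfl | hC)
      · exact explained_singleton hA
      · exact hP C hC
    · rw [sUnion_insert, hPV, Finset.coe_insert, singleton_union]
  | @rule V x X _ hx hX h ih =>
    obtain ⟨P, hd, hP, hPV⟩ := ih
    obtain ⟨a, ha, b, hb, hxa, hxb, hab, hp⟩ := exists_parents hX h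
    rw [← Finset.mem_coe, ← hPV] at ha hb
    obtain ⟨C, hC, haC⟩ := ha
    obtain ⟨D, hD, hbD⟩ := hb
    have hE : Explained A (insert x (C ∪ D)) := by
      by_cases hCD : C = D
      · subst hCD
        rw [union_self]
        exact (hP C hC).insert_site haC hbD hxa hxb hp
      · exact (hP C hC).join (hP D hD) (hd hC hD hCD) haC hbD hxa hxb hab hp
    refine ⟨insert (insert x (C ∪ D)) (P \ {C, D}), ?_, ?_, ?_⟩
    · refine (hd.subset sdiff_subset).insert fun B hB _ => ?_
      obtain ⟨hB, hBCD⟩ := hB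
      simp only [mem_insert_iff, mem_singleton_iff, not_or] at hBCD
      simp only [id, disjoint_insert_left, disjoint_union_left]
      refine ⟨fun hxB => hx ?_, hd hC hB (Ne.symm hBCD.1), hd hD hB (Ne.symm hBCD.2)⟩
      rw [← Finset.mem_coe, ← hPV]
      exact ⟨B, hB, hxB⟩
    · rintro B (rfl | hB)
      · exact hE
      · exact hP B hB.1
    · rw [sUnion_insert, Finset.coe_insert, ← hPV, insert_union]
      congr 1
      ext w
      simp only [mem_union, mem_sUnion, mem_sdiff, mem_insert_iff, mem_singleton_iff]
      constructor
      · rintro ((hw | hw) | ⟨B, hB, hw⟩)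
        · exact ⟨C, hC, hw⟩
        · exact ⟨D, hD, hw⟩
        · exact ⟨B, hB.1, hw⟩
      · rintro ⟨B, hB, hw⟩
        by_cases hBC : B = C
        · exact Or.inl (Or.inl (hBC ▸ hw))
        by_cases hBD : B = D
        · exact Or.inl (Or.inr (hBD ▸ hw))
        · exact Or.inr ⟨B, ⟨hB, by tauto⟩, hw⟩

/-- An eventually infected site lies on a closed walk visiting many initially infected sites. -/
theorem exists_walk_of_mem_closure {A : Set Site} {x : Site}
    (hx : x ∈ bsClosure dtbpFamily A) :
    ∃ (c : triGraph.Walk x x) (n : ℕ) (S : Finset Site), c.length ≤ 22 * n ∧ S.card = n + 1 ∧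
      (∀ w ∈ S, w ∈ c.support ∧ w ∈ A) := by
  obtain ⟨n, hn⟩ := mem_iUnion.1 hx
  obtain ⟨V, hV, hxV⟩ := exists_derivable_of_mem_bsIter n x hn
  obtain ⟨P, -, hP, hPV⟩ := hV.exists_partition
  rw [← Finset.mem_coe, ← hPV] at hxV
  obtain ⟨C, hC, hxC⟩ := hxV
  obtain ⟨v, c, S, h1, h2, h3, h4⟩ := hP C hC (fun _ => x) fun _ => hxC
  rw [sum_polar] at h4
  refine ⟨c.rotate x (h1 0), S.card - 1, S, ?_, by omega, fun w hw => ⟨?_, (h3 w hw).2⟩⟩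
  · rw [SimpleGraph.Walk.length_rotate]
    omega
  · rw [SimpleGraph.Walk.mem_support_rotate_iff]
    exact (h3 w hw).1

/-! ### Counting walks -/

/-- The sites visited by the walk from the origin with the given steps. -/
def visited {N : ℕ} (l : Fin N → Site) : Finset Site :=
  Finset.univ.image fun k : Fin (N + 1) => ∑ i with i.castSucc < k, l i

theorem card_visited_le {N : ℕ} (l : Fin N → Site) : (visited l).card ≤ N + 1 :=
  Finset.card_image_le.trans (Finset.card_fin _).le

theorem exists_steps_of_walk {v : Site} (c : triGraph.Walk 0 v) {N : ℕ} (hN : c.length ≤ N) :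
    ∃ l ∈ Fintype.piFinset fun _ : Fin N => steps, ∀ w ∈ c.support, w ∈ visited l := by
  refine ⟨fun i => c.getVert (i + 1) - c.getVert i, ?_, ?_⟩
  · refine Fintype.mem_piFinset.2 fun i => ?_
    by_cases hi : (i : ℕ) < c.length
    · exact (c.adj_getVert_succ hi).2
    · rw [c.getVert_of_length_le (by omega), c.getVert_of_length_le (by omega), sub_self]
      decide
  · intro w hw
    obtain ⟨k, rfl, hk⟩ := SimpleGraph.Walk.mem_support_iff_exists_getVert.1 hw
    refine Finset.mem_image.2 ⟨⟨k, by omega⟩, Finset.mem_univ _, ?_⟩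
    have hsum := Finset.sum_range_sub c.getVert k
    rw [c.getVert_zero, sub_zero] at hsum
    refine Eq.trans ?_ hsum
    refine Finset.sum_bij (fun i _ => (i : ℕ)) ?_ ?_ ?_ ?_
    · intro i hi
      simpa [Fin.lt_def] using hi
    · intro i _ j _ h
      exact Fin.ext h
    · intro j hj
      have hj := Finset.mem_range.1 hj
      exact ⟨⟨j, by omega⟩, by simpa [Fin.lt_def] using hj, rfl⟩
    · intro i _
      rfl

/-! ### Probability estimates -/

theorem measure_subset_le {p : ℝ} {μ : Measure (Site → Bool)} (hμ : IsBernoulli p μ)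
    (S : Finset Site) :
    μ {ω | ∀ x ∈ S, ω x = true} = ENNReal.ofReal p ^ S.card := by
  simpa using hμ S fun _ => true

theorem measure_walk_event_le {p : ℝ} {μ : Measure (Site → Bool)} (hμ : IsBernoulli p μ)
    (n : ℕ) :
    μ (⋃ l ∈ Fintype.piFinset fun _ : Fin (22 * n) => steps,
      ⋃ S ∈ (visited l).powersetCard (n + 1), {ω | ∀ x ∈ S, ω x = true}) ≤
      7 ^ (22 * n) * (2 ^ (22 * n + 1) * ENNReal.ofReal p ^ (n + 1)) := by
  refine (measure_biUnion_finset_le _ _).trans ?_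
  refine (Finset.sum_le_card_nsmul _ _ (2 ^ (22 * n + 1) * ENNReal.ofReal p ^ (n + 1)) ?_).trans ?_
  · intro l _
    refine (measure_biUnion_finset_le _ _).trans ?_
    refine (Finset.sum_le_card_nsmul _ _ (ENNReal.ofReal p ^ (n + 1)) ?_).trans ?_
    · intro S hS
      rw [measure_subset_le hμ, (Finset.mem_powersetCard.1 hS).2]
    · rw [nsmul_eq_mul]
      gcongr
      have h1 : ((visited l).powersetCard (n + 1)).card ≤ 2 ^ (22 * n + 1) := by
        rw [Finset.card_powersetCard]
        exact (Nat.choose_le_two_pow _ _).trans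
          (Nat.pow_le_pow_right (by norm_num) (card_visited_le l))
      exact_mod_cast h1
  · have h7 : steps.card = 7 := by decide
    rw [nsmul_eq_mul, Fintype.card_piFinset_const, h7]
    push_cast
    rfl

theorem measure_percolates_lt_one {p : ℝ} (hp : p < ((10 : ℝ) ^ 100)⁻¹)
    {μ : Measure (Site → Bool)} (hμ : IsBernoulli p μ) :
    μ {ω | Percolates dtbpFamily (siteSet ω)} < 1 := by
  have hsub : {ω | Percolates dtbpFamily (siteSet ω)} ⊆
      ⋃ n : ℕ, ⋃ l ∈ Fintype.piFinset fun _ : Fin (22 * n) => steps,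
        ⋃ S ∈ (visited l).powersetCard (n + 1), {ω | ∀ x ∈ S, ω x = true} := by
    intro ω hω
    obtain ⟨c, n, S, h1, h2, h3⟩ := exists_walk_of_mem_closure (A := siteSet ω) (x := 0)
      (by rw [show bsClosure dtbpFamily (siteSet ω) = univ from hω]; trivial)
    obtain ⟨l, hl, hc⟩ := exists_steps_of_walk c h1
    simp only [mem_iUnion]
    exact ⟨n, l, hl, S, Finset.mem_powersetCard.2 ⟨fun w hw => hc w (h3 w hw).1, h2⟩,
      fun w hw => (h3 w hw).2⟩
  have hP : ENNReal.ofReal p ≤ ((10 : ENNReal) ^ 100)⁻¹ := by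
    refine (ENNReal.ofReal_le_ofReal hp.le).trans ?_
    rw [ENNReal.ofReal_inv_of_pos (by positivity), ENNReal.ofReal_pow (by norm_num)]
    norm_num
  have key : ∀ k : ℕ, k ≤ 10 ^ 99 → (k : ENNReal) * ENNReal.ofReal p ≤ 4⁻¹ := by
    intro k hk
    calc (k : ENNReal) * ENNReal.ofReal p ≤ k * ((10 : ENNReal) ^ 100)⁻¹ := by gcongr
      _ ≤ 4⁻¹ := by
        rw [← div_eq_mul_inv, ENNReal.div_le_iff (by positivity) (by finiteness), mul_comm,
          ← div_eq_mul_inv, ENNReal.le_div_iff_mul_le (by simp) (by simp)]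
        have : k * 4 ≤ 10 ^ 100 := by omega
        exact_mod_cast this
  have hterm : ∀ n : ℕ, 7 ^ (22 * n) * (2 ^ (22 * n + 1) * ENNReal.ofReal p ^ (n + 1)) ≤
      (4⁻¹ : ENNReal) * 2⁻¹ ^ n := by
    intro n
    have h1 := key (14 ^ 22) (by norm_num)
    have h2 := key 2 (by norm_num)
    rw [Nat.cast_pow, Nat.cast_ofNat] at h1
    rw [Nat.cast_ofNat] at h2
    calc (7 : ENNReal) ^ (22 * n) * (2 ^ (22 * n + 1) * ENNReal.ofReal p ^ (n + 1))
        = (2 * ENNReal.ofReal p) * (14 ^ 22 * ENNReal.ofReal p) ^ n := by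
          rw [show (14 : ENNReal) = 7 * 2 by norm_num, mul_pow, mul_pow, mul_pow, pow_succ,
            pow_succ, ← pow_mul, ← pow_mul]
          ring
      _ ≤ 4⁻¹ * 2⁻¹ ^ n := by
          gcongr
          refine h1.trans ?_
          rw [ENNReal.inv_le_inv]
          norm_num
  calc μ {ω | Percolates dtbpFamily (siteSet ω)}
      ≤ ∑' n : ℕ, (4⁻¹ : ENNReal) * 2⁻¹ ^ n :=
        (measure_mono hsub).trans ((measure_iUnion_le _).trans
          (ENNReal.tsum_le_tsum fun n => (measure_walk_event_le hμ n).trans (hterm n)))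
    _ = 4⁻¹ * 2 := by rw [ENNReal.tsum_mul_left, ENNReal.tsum_geometric, ENNReal.one_sub_inv_two,
        inv_inv]
    _ < 1 := by
        rw [mul_comm, ← div_eq_mul_inv, ENNReal.div_lt_iff (by simp) (by simp)]
        norm_num

/-! ### The Bernoulli product measure -/

theorem exists_isBernoulli {p : ℝ} (hp : p ∈ Icc (0 : ℝ) 1) :
    ∃ μ : Measure (Site → Bool), IsBernoulli p μ := by
  let ν : Measure Bool := ENNReal.ofReal p • Measure.dirac true +
    ENNReal.ofReal (1 - p) • Measure.dirac false
  have hν : ∀ b : Bool, ν {b} = ENNReal.ofReal (if b then p else 1 - p) := by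
    intro b
    cases b <;> simp [ν]
  have : IsProbabilityMeasure ν := ⟨by
    simp only [ν, Measure.add_apply, Measure.smul_apply, measure_univ, smul_eq_mul, mul_one]
    rw [← ENNReal.ofReal_add hp.1 (by linarith [hp.2])]
    simp⟩
  refine ⟨Measure.infinitePi fun _ => ν, fun s f => ?_⟩
  have : {ω : Site → Bool | ∀ x ∈ s, ω x = f x} = Set.pi s fun x => {f x} := by
    ext ω
    simp [Set.pi]
  rw [this, Measure.infinitePi_pi _ fun _ _ => MeasurableSet.singleton _]
  exact Finset.prod_congr rfl fun x _ => hν (f x)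

theorem measure_percolates_eq_one (U : Finset (Finset Site)) {μ : Measure (Site → Bool)}
    (hμ : IsBernoulli 1 μ) : μ {ω | Percolates U (siteSet ω)} = 1 := by
  have huniv : μ univ = 1 := by simpa using hμ ∅ fun _ => true
  have h : ∀ᵐ ω ∂μ, ∀ x, ω x = true := by
    refine ae_all_iff.2 fun x => ?_
    have := hμ {x} fun _ => false
    rw [ae_iff]
    simpa using this
  have h' : ∀ᵐ ω ∂μ, Percolates U (siteSet ω) := by
    filter_upwards [h] with ω hω
    exact eq_univ_of_forall fun x => mem_iUnion.2 ⟨0, hω x⟩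
  rw [← huniv]
  exact measure_congr (Filter.eventuallyEq_univ.2 h')

end Dtbp

/-- For the DTBP update family `U₁` we have `p_c(ℤ², U₁) > 10^{-101}`. -/
theorem dtbp_critProb_lower_bound :
    ((10 : ℝ) ^ (101 : ℕ))⁻¹ < critProb dtbpFamily := by
  have hlt : ((10 : ℝ) ^ (101 : ℕ))⁻¹ < ((10 : ℝ) ^ (100 : ℕ))⁻¹ := by norm_num
  refine hlt.trans_le (le_csInf ⟨1, by simp, fun μ hμ =>
    Dtbp.measure_percolates_eq_one dtbpFamily hμ⟩ ?_)
  rintro p ⟨hp, hperc⟩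
  by_contra! h
  obtain ⟨μ, hμ⟩ := Dtbp.exists_isBernoulli hp
  exact (Dtbp.measure_percolates_lt_one h hμ).ne (hperc μ hμ)
end
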